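/- arXiv:1309.6267 — 3 statements merged into one kernel-verified Lean document; each statement's English description precedes it below -/
import Mathlib

section
/- Suppose h belongs to ℛ (i.e. Case 1 or Case 2 holds) and q satisfies the corresponding tail condition. Then the mean of the tilted density satisfies m(t) = ψ(t)(1 + o(1)) as t → ∞. -/
open Real Filter MeasureTheory Set ProbabilityTheory Asymptotics

noncomputable section

/-- `f` is regularly varying at infinity with index `α`: `f` is eventually positive and
`f (λ t) / f t → λ ^ α` as `t → ∞` for every `λ > 0`. -/
def RegVary (α : ℝ) (f : ℝ → ℝ) : Prop :=
  (∀ᶠ x in atTop, 0 < f x) ∧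
  ∀ lam : ℝ, 0 < lam →
    Tendsto (fun t => f (lam * t) / f t) atTop (nhds (lam ^ α))

/-- Case 1 (the regularly varying case) for the function `h = g'`:
`h x = c x^β exp (∫₁^x ε(u)/u du)` with `β > 0`, `c > 0`, `ε` twice differentiable with
`ε(x) → 0`, `x ε'(x) = O(1)`, `x² ε''(x) = O(1)`, and `|h''| ∈ RV(θ)` for some `θ ≤ β - 2`. -/
structure Case1 (h : ℝ → ℝ) (β c θ : ℝ) (ε : ℝ → ℝ) : Prop where
  beta_pos : 0 < β
  c_pos : 0 < c
  h_eq : ∀ x ≥ (1:ℝ), h x = c * x ^ β * Real.exp (∫ u in (1:ℝ)..x, ε u / u)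
  eps_diff : ∀ x ≥ (1:ℝ), DifferentiableAt ℝ ε x
  eps_diff2 : ∀ x ≥ (1:ℝ), DifferentiableAt ℝ (deriv ε) x
  eps_to_zero : Tendsto ε atTop (nhds 0)
  eps_deriv_bigO : (fun x => x * deriv ε x) =O[atTop] (fun _ => (1:ℝ))
  eps_deriv2_bigO : (fun x => x ^ 2 * deriv (deriv ε) x) =O[atTop] (fun _ => (1:ℝ))
  h2_RV : RegVary θ (fun x => |deriv (deriv h) x|)
  theta_le : θ ≤ β - 2

/-- Case 2 (the rapidly varying case), stated through `ψ = h⁻¹`: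
`ψ t = c exp (∫₁^t ε(u)/u du)` with `c > 0`, `ε` twice differentiable with `ε(t) → 0`,
`t ε'(t)/ε(t) → 0` and `t² ε''(t)/ε(t) → 0`. -/
structure Case2 (ψ : ℝ → ℝ) (c : ℝ) (ε : ℝ → ℝ) : Prop where
  c_pos : 0 < c
  psi_eq : ∀ t ≥ (1:ℝ), ψ t = c * Real.exp (∫ u in (1:ℝ)..t, ε u / u)
  eps_diff : ∀ t ≥ (1:ℝ), DifferentiableAt ℝ ε t
  eps_diff2 : ∀ t ≥ (1:ℝ), DifferentiableAt ℝ (deriv ε) t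
  eps_to_zero : Tendsto ε atTop (nhds 0)
  eps_ratio1 : Tendsto (fun t => t * deriv ε t / ε t) atTop (nhds 0)
  eps_ratio2 : Tendsto (fun t => t ^ 2 * deriv (deriv ε) t / ε t) atTop (nhds 0)

/-- A convex function on `(0, ∞)` lies above its tangent lines. -/
lemma ConvexOn.tangent_le_of_hasDerivAt {g : ℝ → ℝ} (hg : ConvexOn ℝ (Set.Ioi 0) g)
    {x y d : ℝ} (hx : 0 < x) (hy : 0 < y) (hd : HasDerivAt g d y) :
    g y + d * (x - y) ≤ g x := by
  rcases lt_trichotomy x y with h | h | h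
  · have := hg.slope_le_of_hasDerivAt hx hy h hd
    rw [slope_def_field, div_le_iff₀ (sub_pos.2 h)] at this
    linarith
  · simp [h]
  · have := hg.le_slope_of_hasDerivAt hy hx h hd
    rw [slope_def_field, le_div_iff₀ (sub_pos.2 h)] at this
    linarith

/-- The cumulant generating function is convex on the interior of its domain. -/
lemma convexOn_cgf_interior {Ω : Type*} [MeasurableSpace Ω] (X : Ω → ℝ) (μ : Measure Ω) :
    ConvexOn ℝ (interior (integrableExpSet X μ)) (cgf X μ) := by
  have hA := analyticOnNhd_cgf (X := X) (μ := μ)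
  refine convexOn_of_deriv2_nonneg' convex_integrableExpSet.interior
    (fun x hx => (hA x hx).differentiableAt.differentiableWithinAt)
    (fun x hx => (hA.deriv x hx).differentiableAt.differentiableWithinAt) fun x hx => ?_
  rw [← iteratedDeriv_eq_iterate, iteratedDeriv_two_cgf_eq_integral hx]
  exact div_nonneg (integral_nonneg fun ω => by positivity) mgf_nonneg

/-- The logarithm of a Laplace integral which is finite on `(0, ∞)` is convex and
differentiable there. -/
lemma convexOn_log_laplace {p Φ : ℝ → ℝ} (hp : ∀ x, 0 ≤ p x)
    (hΦ : ∀ t, Φ t = ∫ x, Real.exp (t * x) * p x)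
    (hint : ∀ t > (0 : ℝ), Integrable (fun x => Real.exp (t * x) * p x)) :
    ConvexOn ℝ (Set.Ioi 0) (fun u => Real.log (Φ u)) ∧
      ∀ t > 0, DifferentiableAt ℝ (fun u => Real.log (Φ u)) t := by
  have hpm : AEMeasurable p := by
    have h1 : AEMeasurable (fun x => Real.exp (-x) * (Real.exp (1 * x) * p x)) :=
      (by fun_prop : Measurable fun x : ℝ => Real.exp (-x)).aemeasurable.mul
        (hint 1 one_pos).aestronglyMeasurable.aemeasurable
    refine h1.congr (Eventually.of_forall fun x => ?_)
    simp [← mul_assoc, ← Real.exp_add]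
  have hpm' : AEMeasurable (fun x => ENNReal.ofReal (p x)) := hpm.ennreal_ofReal
  set ν : Measure ℝ := volume.withDensity fun x => ENNReal.ofReal (p x)
  have hΦν : (fun u => Real.log (Φ u)) = cgf id ν := by
    funext u
    rw [cgf, mgf, integral_withDensity_eq_integral_toReal_smul₀ hpm' (by simp), hΦ]
    simp [ENNReal.toReal_ofReal (hp _), mul_comm]
  have hsub : Set.Ioi 0 ⊆ interior (integrableExpSet id ν) := by
    refine interior_maximal (fun t ht => ?_) isOpen_Ioi
    rw [integrableExpSet, Set.mem_ofPred_eq,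
      integrable_withDensity_iff_integrable_smul₀' hpm' (by simp)]
    simpa [ENNReal.toReal_ofReal (hp _), mul_comm] using hint t ht
  rw [hΦν]
  exact ⟨(convexOn_cgf_interior id ν).subset hsub (convex_Ioi 0),
    fun t ht => (analyticAt_cgf (hsub ht)).differentiableAt⟩

/-- A function on the half-line bounded by `C` up to `A`, and by a decaying exponential after
`A`, has a small integral. -/
lemma integral_le_of_exp_tail {f : ℝ → ℝ} {C A s : ℝ} (hA : 0 < A)
    (hs : 0 < s) (hf : Integrable f) (h0 : ∀ x < 0, f x = 0) (h1 : ∀ x > 0, f x ≤ C)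
    (h2 : ∀ x > A, f x ≤ C * Real.exp (-(s * (x - A)))) :
    ∫ x, f x ≤ C * (A + 1 / s) := by
  have hexp : ∀ x, C * Real.exp (-(s * (x - A))) = C * Real.exp (s * A) * Real.exp (-s * x) := by
    intro x
    rw [mul_assoc, ← Real.exp_add]
    ring_nf
  have i1 : IntegrableOn (fun _ : ℝ => C) (Set.Ioc 0 A) := by simp
  have i2 : IntegrableOn (fun x => C * Real.exp (-(s * (x - A)))) (Set.Ioi A) := by
    simp_rw [hexp]
    exact (integrableOn_exp_mul_Ioi (neg_lt_zero.2 hs) A).const_mul _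
  have j1 := i1.integrable_indicator measurableSet_Ioc
  have j2 := i2.integrable_indicator measurableSet_Ioi
  have key : ∫ x, f x ≤ ∫ x, ((Set.Ioc 0 A).indicator (fun _ => C) x +
      (Set.Ioi A).indicator (fun x => C * Real.exp (-(s * (x - A)))) x) := by
    refine integral_mono_ae hf (j1.add j2) ?_
    filter_upwards [Measure.ae_ne volume (0 : ℝ)] with x hx
    rcases lt_or_gt_of_ne hx with h | h
    · have e1 : x ∉ Set.Ioc 0 A := fun h' => absurd h'.1 h.not_gt
      have e2 : x ∉ Set.Ioi A := fun h' => absurd (hA.trans h') h.not_gt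
      simp [e1, e2, h0 x h]
    · rcases le_or_gt x A with h' | h'
      · have e1 : x ∈ Set.Ioc 0 A := ⟨h, h'⟩
        have e2 : x ∉ Set.Ioi A := not_lt.2 h'
        simpa [e1, e2] using h1 x h
      · have e1 : x ∉ Set.Ioc 0 A := fun h'' => absurd h''.2 h'.not_ge
        have e2 : x ∈ Set.Ioi A := h'
        simpa [e1, e2] using h2 x h'
  refine key.trans_eq ?_
  rw [integral_add j1 j2, integral_indicator measurableSet_Ioc, integral_indicator measurableSet_Ioi]
  simp_rw [hexp]
  rw [integral_const_mul, integral_exp_mul_Ioi (neg_lt_zero.2 hs)]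
  have : Real.exp (A * s) * Real.exp (-(A * s)) = 1 := by
    rw [← Real.exp_add]
    simp
  simp only [integral_const, MeasurableSet.univ, measureReal_restrict_apply, Set.univ_inter,
    Real.volume_real_Ioc_of_le hA.le, smul_eq_mul]
  field_simp
  linear_combination C * this

/-- A nonnegative integrable function which is at least `c` on an interval of length one has
integral at least `c`. -/
lemma le_integral_of_le_on_Icc {f : ℝ → ℝ} {a c : ℝ} (hf : Integrable f) (h0 : ∀ x, 0 ≤ f x)
    (h1 : ∀ x ∈ Set.Icc (a - 1) a, c ≤ f x) : c ≤ ∫ x, f x := by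
  calc c = ∫ _ in Set.Icc (a - 1) a, c := by simp
    _ ≤ ∫ x in Set.Icc (a - 1) a, f x :=
      setIntegral_mono_on (by simp) hf.integrableOn measurableSet_Icc h1
    _ ≤ ∫ x, f x := setIntegral_le_integral hf (Eventually.of_forall h0)

/-- If `L` is convex and `o(t ψ t)`-close to a function `G` of which `ψ` is a subgradient, and
`ψ` does not grow much between `t` and `lam * t`, then `L'` is asymptotic to `ψ`. -/
lemma tendsto_deriv_div_of_subgradient {L G ψ : ℝ → ℝ} (hL : ConvexOn ℝ (Set.Ioi 0) L)
    (hLd : ∀ t > 0, DifferentiableAt ℝ L t) (hψ : ∀ᶠ t in atTop, 0 < ψ t)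
    (hG : ∃ T, ∀ t ≥ T, ∀ s ≥ T, G t + (s - t) * ψ t ≤ G s)
    (hclose : ∀ κ > 0, ∀ᶠ t in atTop, |L t - G t| ≤ κ * (t * ψ t))
    (hgrow : ∀ μ > 1, ∃ lam > 1, ∀ᶠ t in atTop, ψ (lam * t) ≤ μ * ψ t) :
    Tendsto (fun t => deriv L t / ψ t) atTop (nhds 1) := by
  obtain ⟨T, hT⟩ := hG
  have key : ∀ δ > 0, δ < 1 → ∀ᶠ t in atTop,
      deriv L t ≤ (1 + δ) * ψ t ∧ (1 - δ) * ψ t ≤ deriv L t := by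
    intro δ hδ hδ1
    obtain ⟨lam, hlam, hgr⟩ := hgrow (1 + δ / 2) (by linarith)
    have hlam0 : 0 < lam := by linarith
    have hmul : Tendsto (fun t => lam * t) atTop atTop := tendsto_id.const_mul_atTop hlam0
    have hdiv : Tendsto (fun t => t / lam) atTop atTop := tendsto_id.atTop_div_const hlam0
    set D := lam * (1 + δ / 2) + 1
    have hD : 0 < D := by positivity
    set κ := (lam - 1) * (δ / 2) / D with hκ
    have hκ0 : 0 < κ := div_pos (mul_pos (by linarith) (by linarith)) hD
    have hκD : κ * D = (lam - 1) * (δ / 2) := by rw [hκ]; field_simp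
    have pair : ∀ᶠ t in atTop, deriv L t ≤ (1 + δ) * ψ t ∧
        (1 - δ) * ψ (lam * t) ≤ deriv L (lam * t) := by
      filter_upwards [hgr, hψ, hmul.eventually hψ, hclose κ hκ0, hmul.eventually (hclose κ hκ0),
        eventually_gt_atTop 0, eventually_ge_atTop T, hmul.eventually_ge_atTop T]
        with t hg hp hp' hc hc' ht htT htT'
      have hlt : t < lam * t := by nlinarith
      have hpos : 0 < lam * t - t := by linarith
      have hup := hL.deriv_le_slope (x := t) (y := lam * t) ht (ht.trans hlt) hlt (hLd t ht)
      have hlo := hL.slope_le_deriv (x := t) (y := lam * t) ht (ht.trans hlt) hlt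
        (hLd _ (ht.trans hlt))
      rw [slope_def_field, le_div_iff₀ hpos] at hup
      rw [slope_def_field, div_le_iff₀ hpos] at hlo
      have g1 := hT t htT _ htT'
      have g2 := hT _ htT' t htT
      rw [abs_le] at hc hc'
      have herr : κ * (t * ψ t) + κ * (lam * t * ψ (lam * t)) ≤
          (lam - 1) * t * (δ / 2 * ψ t) := by
        have : κ * (lam * t) * ψ (lam * t) ≤ κ * (lam * t) * ((1 + δ / 2) * ψ t) :=
          mul_le_mul_of_nonneg_left hg (by positivity)
        calc _ ≤ κ * D * (t * ψ t) := by simp only [D]; linarith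
          _ = _ := by rw [hκD]; ring
      have hpos' : 0 < (lam - 1) * t := by linarith
      constructor
      · refine le_of_mul_le_mul_left ?_ hpos'
        have : (lam - 1) * t * ψ (lam * t) ≤ (lam - 1) * t * ((1 + δ / 2) * ψ t) :=
          mul_le_mul_of_nonneg_left hg hpos'.le
        linarith
      · have h1 : (1 - δ / 2) * ψ t ≤ deriv L (lam * t) := by
          refine le_of_mul_le_mul_left ?_ hpos'
          linarith
        have h2 : (1 - δ) * ψ (lam * t) ≤ (1 - δ) * ((1 + δ / 2) * ψ t) :=
          mul_le_mul_of_nonneg_left hg (by linarith)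
        nlinarith [mul_pos (mul_pos hδ hδ) hp]
    filter_upwards [pair, hdiv.eventually pair] with t h1 h2
    refine ⟨h1.1, ?_⟩
    simpa [mul_div_cancel₀ t hlam0.ne'] using h2.2
  rw [Metric.tendsto_nhds]
  intro r hr
  have hδ : 0 < min (r / 2) (1 / 2) := by positivity
  filter_upwards [key _ hδ ((min_le_right _ _).trans_lt (by norm_num)), hψ] with t ht hp
  have hmin : min (r / 2) (1 / 2) ≤ r / 2 := min_le_left _ _
  rw [Real.dist_eq, abs_lt, lt_sub_iff_add_lt, sub_lt_iff_lt_add, lt_div_iff₀ hp, div_lt_iff₀ hp]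
  constructor <;> nlinarith

/-- `∫_x^{μx} ε(u)/u du` is at most `δ log μ` in absolute value once `|ε| ≤ δ`. -/
lemma abs_integral_div_le {ε : ℝ → ℝ} {δ μ x : ℝ} (hμ : 1 ≤ μ) (hx : 0 < x)
    (hε : ∀ u ≥ x, |ε u| ≤ δ) : |∫ u in x..μ * x, ε u / u| ≤ δ * Real.log μ := by
  have hxy : x ≤ μ * x := by nlinarith
  have hmem : (0 : ℝ) ∉ Set.uIcc x (μ * x) := by
    rw [Set.uIcc_of_le hxy]
    exact fun h => hx.not_ge h.1
  have hi : IntervalIntegrable (fun u : ℝ => δ * u⁻¹) volume x (μ * x) :=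
    (intervalIntegral.intervalIntegrable_inv (fun u hu h => hmem (h ▸ hu))
      continuousOn_id).const_mul δ
  have h := intervalIntegral.norm_integral_le_of_norm_le hxy (f := fun u => ε u / u)
    (g := fun u => δ * u⁻¹) (Eventually.of_forall fun u hu => ?_) hi
  · rw [intervalIntegral.integral_const_mul, integral_inv hmem,
      mul_div_cancel_right₀ _ hx.ne'] at h
    exact h
  · rw [norm_div, Real.norm_eq_abs, Real.norm_eq_abs, abs_of_pos (hx.trans hu.1), div_eq_mul_inv]
    exact mul_le_mul_of_nonneg_right (hε u hu.1.le) (inv_nonneg.2 (hx.trans hu.1).le)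

/-- The integral `∫₁^x ε(u)/u du` with `ε → 0` varies slowly. -/
lemma eventually_abs_integral_div_sub_le {ε : ℝ → ℝ} (hd : ∀ x ≥ (1 : ℝ), DifferentiableAt ℝ ε x)
    (h0 : Tendsto ε atTop (nhds 0)) {δ μ : ℝ} (hδ : 0 < δ) (hμ : 1 ≤ μ) :
    ∀ᶠ x in atTop,
      |(∫ u in (1 : ℝ)..μ * x, ε u / u) - ∫ u in (1 : ℝ)..x, ε u / u| ≤ δ * Real.log μ := by
  have hε : ∀ᶠ x in atTop, |ε x| ≤ δ := by
    filter_upwards [(Metric.tendsto_nhds.1 h0) δ hδ] with x hx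
    simpa using hx.le
  have hii : ∀ x ≥ (1 : ℝ), IntervalIntegrable (fun u => ε u / u) volume 1 x := by
    intro x hx
    refine ContinuousOn.intervalIntegrable fun u hu => ?_
    rw [Set.uIcc_of_le hx] at hu
    exact ((hd u hu.1).continuousAt.div continuousAt_id
      (zero_lt_one.trans_le hu.1).ne').continuousWithinAt
  obtain ⟨N, hN⟩ := eventually_atTop.1 hε
  filter_upwards [eventually_ge_atTop N, eventually_ge_atTop 1] with x hxN hx1
  rw [intervalIntegral.integral_interval_sub_left (hii _ (by nlinarith)) (hii _ hx1)]
  exact abs_integral_div_le hμ (by linarith) fun u hu => hN u (hxN.trans hu)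

/-- In the regularly varying case, `ψ` grows by a factor close to one over short
multiplicative ranges. -/
lemma Case1.exists_growth {h ψ ε : ℝ → ℝ} {β c θ : ℝ} (hc : Case1 h β c θ ε)
    (hmono : ∃ x₀ : ℝ, StrictMonoOn h (Set.Ioi x₀)) (hinv : ∀ᶠ t in atTop, h (ψ t) = t)
    (hψ : Tendsto ψ atTop atTop) {μ : ℝ} (hμ : 1 < μ) :
    ∃ lam > 1, ∀ᶠ t in atTop, ψ (lam * t) ≤ μ * ψ t := by
  obtain ⟨x₀, hx₀⟩ := hmono
  have hβ := hc.beta_pos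
  have hlog : 0 < Real.log μ := Real.log_pos hμ
  have hlam : 1 < Real.exp (β / 2 * Real.log μ) := Real.one_lt_exp_iff.2 (by positivity)
  refine ⟨_, hlam, ?_⟩
  set lam := Real.exp (β / 2 * Real.log μ)
  have hmul : Tendsto (fun t => lam * t) atTop atTop :=
    tendsto_id.const_mul_atTop (by positivity)
  have hμψ : Tendsto (fun t => μ * ψ t) atTop atTop := hψ.const_mul_atTop (by linarith)
  filter_upwards [hinv, hmul.eventually hinv, hψ.eventually_ge_atTop 1, hμψ.eventually_ge_atTop 1,
    (hψ.comp hmul).eventually_gt_atTop x₀, hμψ.eventually_gt_atTop x₀,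
    hψ.eventually (eventually_abs_integral_div_sub_le hc.eps_diff hc.eps_to_zero
      (half_pos hβ) hμ.le)] with t h1 h2 h3 h4 h5 h6 h7
  rw [← hx₀.le_iff_le (by exact h5) h6, h2, hc.h_eq _ h4]
  rw [hc.h_eq _ h3] at h1
  rw [abs_le] at h7
  have hψ0 : 0 < ψ t := by linarith
  have hμβ : μ ^ β = lam * lam := by
    rw [Real.rpow_def_of_pos (by linarith), ← Real.exp_add]
    ring_nf
  have hexp : Real.exp (∫ u in (1 : ℝ)..ψ t, ε u / u) ≤
      lam * Real.exp (∫ u in (1 : ℝ)..μ * ψ t, ε u / u) := by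
    rw [← Real.exp_add, Real.exp_le_exp]
    linarith
  rw [Real.mul_rpow (by linarith) hψ0.le, hμβ]
  have hcp : 0 < lam * (c * ψ t ^ β) := by have := hc.c_pos; positivity
  calc lam * t = lam * (c * ψ t ^ β) * Real.exp (∫ u in (1 : ℝ)..ψ t, ε u / u) := by
        rw [mul_assoc, h1]
    _ ≤ _ := mul_le_mul_of_nonneg_left hexp hcp.le
    _ = _ := by ring

/-- In the rapidly varying case, `ψ` is slowly varying. -/
lemma Case2.exists_growth {ψ ε : ℝ → ℝ} {c : ℝ} (hc : Case2 ψ c ε) {μ : ℝ} (hμ : 1 < μ) :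
    ∃ lam > 1, ∀ᶠ t in atTop, ψ (lam * t) ≤ μ * ψ t := by
  refine ⟨μ, hμ, ?_⟩
  filter_upwards [eventually_abs_integral_div_sub_le hc.eps_diff hc.eps_to_zero one_pos hμ.le,
    eventually_ge_atTop 1] with t ht h1
  rw [hc.psi_eq _ h1, hc.psi_eq _ (by nlinarith)]
  nth_rewrite 2 [← Real.exp_log (zero_lt_one.trans hμ)]
  rw [mul_left_comm, ← Real.exp_add]
  rw [abs_le] at ht
  have := hc.c_pos
  gcongr
  linarith

/-- under Case 1 or Case 2 and the corresponding tail condition on `q`,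
the mean `m(t)` of the tilted density satisfies `m(t) = ψ(t)(1 + o(1))` as `t → ∞`. -/
theorem tilted_mean_asymptotic
    (g ψ q p Φ : ℝ → ℝ)
    (hg_pos : ∀ x > (0:ℝ), 0 < g x)
    (hg_conv : ConvexOn ℝ (Set.Ioi 0) g)
    (hg_smooth : ContDiffOn ℝ 4 g (Set.Ioi 0))
    (hg_super : Tendsto (fun x => g x / x) atTop atTop)
    (hh_mono : ∃ x₀ : ℝ, StrictMonoOn (deriv g) (Set.Ioi x₀))
    (hh_top : Tendsto (deriv g) atTop atTop)
    (hψ_inv : ∀ᶠ t in atTop, deriv g (ψ t) = t)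
    (hψ_inv' : ∀ᶠ x in atTop, ψ (deriv g x) = x)
    (hψ_top : Tendsto ψ atTop atTop)
    (hq_meas : Measurable q)
    (hq_bdd : ∃ M : ℝ, ∀ x ≥ (0:ℝ), |q x| ≤ M)
    (hcase :
      (∃ β c θ ε, Case1 (deriv g) β c θ ε ∧
        ∃ η, η < θ - 3 * β / 2 - 3 / 2 ∧ RegVary η (fun x => |q x|)) ∨
      (∃ c ε, Case2 ψ c ε ∧
        ∃ η, η < -(1/2 : ℝ) ∧ RegVary η (fun t => |q (ψ t)|)))
    (hp : ∀ x, p x = if 0 ≤ x then Real.exp (-(g x - q x)) else 0)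
    (hΦ : ∀ t, Φ t = ∫ x, Real.exp (t * x) * p x)
    (hΦ_int : ∀ t > (0:ℝ), Integrable (fun x => Real.exp (t * x) * p x)) :
    Tendsto (fun t => deriv (fun u => Real.log (Φ u)) t / ψ t) atTop (nhds 1) := by
  have hgd : ∀ x > 0, HasDerivAt g (deriv g x) x := fun x hx =>
    ((hg_smooth.contDiffAt (Ioi_mem_nhds hx)).differentiableAt (by norm_num)).hasDerivAt
  have hgrow : ∀ μ > 1, ∃ lam > 1, ∀ᶠ t in atTop, ψ (lam * t) ≤ μ * ψ t := by
    intro μ hμ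
    rcases hcase with ⟨β, c, θ, ε, hc, -⟩ | ⟨c, ε, hc, -⟩
    · exact hc.exists_growth hh_mono hψ_inv hψ_top hμ
    · exact hc.exists_growth hμ
  have hp0 : ∀ x, 0 ≤ p x := fun x => by
    rw [hp]
    split_ifs <;> positivity
  obtain ⟨hLconv, hLdiff⟩ := convexOn_log_laplace hp0 hΦ hΦ_int
  obtain ⟨M, hM⟩ := hq_bdd
  have hψ_pos : ∀ᶠ t in atTop, 0 < ψ t := hψ_top.eventually_gt_atTop 0
  set G : ℝ → ℝ := fun t => t * ψ t - g (ψ t) with hGdef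
  -- Fenchel–Young inequality
  have hyoung : ∀ᶠ t in atTop, ∀ x > 0, t * x - g x ≤ G t := by
    filter_upwards [hψ_inv, hψ_pos] with t h1 h2 x hx
    have := hg_conv.tangent_le_of_hasDerivAt hx h2 (hgd _ h2)
    rw [h1] at this
    simp only [hGdef]
    linarith
  have hsub : ∃ T, ∀ t ≥ T, ∀ s ≥ T, G t + (s - t) * ψ t ≤ G s := by
    obtain ⟨T, hT⟩ := eventually_atTop.1 (hyoung.and hψ_pos)
    refine ⟨T, fun t ht s hs => ?_⟩
    have := (hT s hs).1 (ψ t) (hT t ht).2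
    simp only [hGdef] at this ⊢
    linarith
  have hlower : ∀ᶠ t in atTop, Real.exp (G t - t - M) ≤ Φ t := by
    obtain ⟨N, hN⟩ := eventually_atTop.1 (hh_top.eventually_ge_atTop 0)
    filter_upwards [hψ_top.eventually_ge_atTop (N + 1), hψ_top.eventually_gt_atTop 1,
      eventually_gt_atTop 0] with t h1 h2 ht
    rw [hΦ]
    refine le_integral_of_le_on_Icc (a := ψ t) (hΦ_int t ht)
      (fun x => mul_nonneg (Real.exp_nonneg _) (hp0 x)) fun x hx => ?_
    have hx0 : 0 < x := by linarith [hx.1]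
    have htan := hg_conv.tangent_le_of_hasDerivAt (x := ψ t) (by linarith) hx0 (hgd _ hx0)
    have hslope : 0 ≤ deriv g x * (ψ t - x) :=
      mul_nonneg (hN x (by linarith [hx.1])) (by linarith [hx.2])
    rw [hp, if_pos hx0.le, ← Real.exp_add, Real.exp_le_exp]
    have hqx := (abs_le.1 (hM x hx0.le)).1
    have htx : t * (ψ t - 1) ≤ t * x := mul_le_mul_of_nonneg_left hx.1 ht.le
    simp only [hGdef]
    linarith
  have hupper : ∀ lam > 1, ∀ᶠ t in atTop,
      Φ t ≤ Real.exp (G t + M) * (ψ (lam * t) + 1 / ((lam - 1) * t)) := by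
    intro lam hlam
    have hmul : Tendsto (fun t => lam * t) atTop atTop :=
      tendsto_id.const_mul_atTop (by linarith)
    filter_upwards [hyoung, hmul.eventually hyoung, hmul.eventually hψ_pos,
      eventually_gt_atTop 0] with t h1 h2 h3 ht
    have hs : 0 < (lam - 1) * t := mul_pos (by linarith) ht
    rw [hΦ]
    refine integral_le_of_exp_tail h3 hs (hΦ_int t ht)
      (fun x hx => by simp [hp, hx.not_ge]) (fun x hx => ?_) (fun x hx => ?_)
    · rw [hp, if_pos hx.le, ← Real.exp_add, Real.exp_le_exp]
      linarith [h1 x hx, (abs_le.1 (hM x hx.le)).2]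
    · have hx0 : 0 < x := h3.trans hx
      rw [hp, if_pos hx0.le, ← Real.exp_add, ← Real.exp_add, Real.exp_le_exp]
      have h4 := h1 _ h3
      have h5 := h2 x hx0
      simp only [hGdef] at h4 h5 ⊢
      linarith [(abs_le.1 (hM x hx0.le)).2]
  have hclose : ∀ κ > 0, ∀ᶠ t in atTop, |Real.log (Φ t) - G t| ≤ κ * (t * ψ t) := by
    intro κ hκ
    obtain ⟨lam, hlam, hgr⟩ := hgrow 2 (by norm_num)
    have hmul : Tendsto (fun t => lam * t) atTop atTop :=
      tendsto_id.const_mul_atTop (by linarith)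
    have hsm : Tendsto (fun t => (lam - 1) * t) atTop atTop :=
      tendsto_id.const_mul_atTop (by linarith)
    filter_upwards [hlower, hupper lam hlam, hgr, hmul.eventually hψ_pos,
      hsm.eventually_ge_atTop 1, eventually_ge_atTop 1, hψ_top.eventually_ge_atTop 1,
      eventually_ge_atTop ((|M| + 3) / κ), hψ_top.eventually_ge_atTop ((|M| + 1) / κ)]
      with t hl hu hg hψ1 hs ht hψt ht' hψt'
    have hMabs := le_abs_self M
    have hM0 := abs_nonneg M
    rw [div_le_iff₀ hκ] at ht' hψt'
    have hΦ0 : 0 < Φ t := (Real.exp_pos _).trans_le hl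
    have hl' := Real.log_le_log (Real.exp_pos _) hl
    have hinv : 1 / ((lam - 1) * t) ≤ 1 := by
      rw [div_le_one (by linarith)]
      exact hs
    have hinv0 : 0 < 1 / ((lam - 1) * t) := by positivity
    have hu' := Real.log_le_log hΦ0 hu
    rw [Real.log_exp] at hl'
    rw [Real.log_mul (Real.exp_ne_zero _) (by linarith), Real.log_exp] at hu'
    have hlog := Real.log_le_self (x := ψ (lam * t) + 1 / ((lam - 1) * t)) (by linarith)
    rw [abs_le]
    constructor
    · nlinarith [mul_le_mul_of_nonneg_left hψt' (zero_le_one.trans ht)]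
    · nlinarith [mul_le_mul_of_nonneg_left ht' (zero_le_one.trans hψt)]
  exact tendsto_deriv_div_of_subgradient hLconv hLdiff hψ_pos hsub hclose hgrow
end
end

section
/- Suppose h belongs to ℛ (i.e. Case 1 or Case 2 holds) and q satisfies the corresponding tail condition. Then the variance of the tilted density satisfies s²(t) = ψ'(t)(1 + o(1)) as t → ∞. -/
open Real Filter MeasureTheory Set ProbabilityTheory Asymptotics

noncomputable section

/-- A second-order expansion with an explicit error bound. -/
lemma abs_sub_quadratic_le {f f' f'' : ℝ → ℝ} {u δ : ℝ}
    (hf : ∀ v, |v| ≤ |u| → HasDerivAt f (f' v) v)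
    (hf' : ∀ v, |v| ≤ |u| → HasDerivAt f' (f'' v) v)
    (hf'' : ∀ v, |v| ≤ |u| → |f'' v - 1| ≤ δ) :
    |f u - f 0 - f' 0 * u - u ^ 2 / 2| ≤ δ * u ^ 2 := by
  have hconv : Convex ℝ {v : ℝ | |v| ≤ |u|} := by
    have : {v : ℝ | |v| ≤ |u|} = Icc (-|u|) |u| := by
      ext v; simp [abs_le]
    rw [this]; exact convex_Icc _ _
  have h0 : (0 : ℝ) ∈ {v : ℝ | |v| ≤ |u|} := by simp
  have hu : u ∈ {v : ℝ | |v| ≤ |u|} := by simp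
  have hδ : 0 ≤ δ := (abs_nonneg _).trans (hf'' 0 h0)
  have h1 : ∀ v ∈ {v : ℝ | |v| ≤ |u|}, ‖f' v - f' 0 - v‖ ≤ δ * |u| := by
    intro v hv
    have := hconv.norm_image_sub_le_of_norm_hasDerivWithin_le
      (f := fun v => f' v - v) (f' := fun v => f'' v - 1) (C := δ)
      (fun w hw => ((hf' w hw).sub (hasDerivAt_id' w)).hasDerivWithinAt)
      (fun w hw => hf'' w hw) h0 hv
    calc ‖f' v - f' 0 - v‖ = ‖f' v - v - (f' 0 - 0)‖ := by congr 1; ring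
      _ ≤ δ * ‖v - 0‖ := this
      _ ≤ δ * |u| := by
        rw [sub_zero]; exact mul_le_mul_of_nonneg_left hv hδ
  have h2 := hconv.norm_image_sub_le_of_norm_hasDerivWithin_le
      (f := fun v => f v - f' 0 * v - v ^ 2 / 2) (f' := fun v => f' v - f' 0 - v)
      (C := δ * |u|)
      (fun w hw => by
        have h3 := (((hf w hw).sub ((hasDerivAt_id' w).const_mul (f' 0))).sub
          ((hasDerivAt_pow 2 w).div_const 2))
        refine (h3.congr_deriv ?_).hasDerivWithinAt
        norm_num) h1 h0 hu
  calc |f u - f 0 - f' 0 * u - u ^ 2 / 2|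
      = ‖f u - f' 0 * u - u ^ 2 / 2 - (f 0 - f' 0 * 0 - 0 ^ 2 / 2)‖ := by
        rw [Real.norm_eq_abs]; congr 1; ring
    _ ≤ δ * |u| * ‖u - 0‖ := h2
    _ = δ * u ^ 2 := by rw [sub_zero, Real.norm_eq_abs, mul_assoc, ← sq, sq_abs]

/-- A convex function vanishing at `0` and suitably bounded at `±1` grows at least linearly. -/
lemma ConvexOn.abs_div_four_sub_two_le {f : ℝ → ℝ} {S : Set ℝ} (hf : ConvexOn ℝ S f)
    (h0S : (0 : ℝ) ∈ S) (h1S : (1 : ℝ) ∈ S) (h1S' : (-1 : ℝ) ∈ S) (h0 : f 0 = 0)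
    (h1 : |f 1 - 1 / 2| ≤ 1 / 4) (h1' : |f (-1) - 1 / 2| ≤ 1 / 4) {u : ℝ} (hu : u ∈ S) :
    |u| / 4 - 2 ≤ f u := by
  rw [abs_le] at h1 h1'
  have hc : ∀ x ∈ S, ∀ y ∈ S, ∀ a b : ℝ, 0 ≤ a → 0 ≤ b → a + b = 1 →
      f (a * x + b * y) ≤ a * f x + b * f y := 
    fun x hx y hy a b ha hb hab => by simpa using hf.2 hx hy ha hb hab
  rcases le_total 0 u with hu0 | hu0
  · rw [abs_of_nonneg hu0]
    rcases le_total 1 u with hu1 | hu1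
    · have := hc _ h0S _ hu (1 - u⁻¹) (u⁻¹)
        (by have := inv_le_one_of_one_le₀ hu1; linarith) (by positivity) (by ring)
      have hu' : u⁻¹ * u = 1 := inv_mul_cancel₀ (by linarith)
      simp only [mul_zero, zero_add, h0, hu'] at this
      have h2 : u * f 1 ≤ u * (u⁻¹ * f u) := mul_le_mul_of_nonneg_left this hu0
      rw [← mul_assoc, mul_inv_cancel₀ (by linarith), one_mul] at h2
      nlinarith
    · have hp : 0 < 1 + u := by linarith
      have := hc _ h1S' _ hu (u / (1 + u)) (1 / (1 + u))
        (by positivity) (by positivity) (by field_simp; ring)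
      rw [show u / (1 + u) * -1 + 1 / (1 + u) * u = 0 by field_simp; ring, h0] at this
      have h2 : 0 ≤ u * f (-1) + f u := by
        have := mul_nonneg hp.le this
        field_simp at this
        linarith
      nlinarith
  · rw [abs_of_nonpos hu0]
    rcases le_total u (-1) with hu1 | hu1
    · have hpos : 0 < -u := by linarith
      have := hc _ h0S _ hu (1 - (-u)⁻¹) ((-u)⁻¹)
        (by have := inv_le_one_of_one_le₀ (show 1 ≤ -u by linarith); linarith)
        (by positivity) (by ring)
      have hu' : (-u)⁻¹ * u = -1 := by rw [inv_neg, neg_mul, inv_mul_cancel₀ (by linarith)]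
      simp only [mul_zero, zero_add, h0, hu'] at this
      have h2 : -u * f (-1) ≤ -u * ((-u)⁻¹ * f u) := mul_le_mul_of_nonneg_left this hpos.le
      rw [← mul_assoc, mul_inv_cancel₀ hpos.ne', one_mul] at h2
      nlinarith
    · have hp : 0 < 1 - u := by linarith
      have := hc _ h1S _ hu (-u / (1 - u)) (1 / (1 - u))
        (div_nonneg (by linarith) hp.le) (by positivity) (by field_simp; ring)
      rw [show -u / (1 - u) * 1 + 1 / (1 - u) * u = 0 by field_simp; ring, h0] at this
      have h2 : 0 ≤ -u * f 1 + f u := by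
        have := mul_nonneg hp.le this
        field_simp at this
        linarith
      nlinarith

/-- A bounded regularly varying function of negative index tends to zero. -/
lemma RegVary.tendsto_zero {f : ℝ → ℝ} {η M : ℝ} (hf : RegVary η f) (hη : η < 0)
    (hM : ∀ᶠ x in atTop, f x ≤ M) : Tendsto f atTop (nhds 0) := by
  have hM0 : 0 < M := by
    obtain ⟨x, hx, hx'⟩ := (hf.1.and hM).exists
    linarith
  refine tendsto_order.2 ⟨fun a ha => hf.1.mono fun x hx => ha.trans hx, fun a ha => ?_⟩
  obtain ⟨lam, hlam, hlam0⟩ : ∃ lam : ℝ, lam ^ η < a / M ∧ 0 < lam :=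
    (((tendsto_rpow_neg_atTop (show 0 < -η by linarith)).eventually_lt_const
      (show 0 < a / M by positivity)).and (eventually_gt_atTop 0)).exists.imp fun x hx => by
        simpa using hx
  have h1 : ∀ᶠ t in atTop, f (lam * t) < a := by
    filter_upwards [(hf.2 lam hlam0).eventually_lt_const hlam, hf.1, hM] with t h1 h2 h3
    rw [div_lt_iff₀ h2] at h1
    calc f (lam * t) < a / M * f t := h1
      _ ≤ a / M * M := by gcongr
      _ = a := by field_simp
  have h2 : Tendsto (fun x : ℝ => lam⁻¹ * x) atTop atTop :=
    tendsto_id.const_mul_atTop (by positivity)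
  filter_upwards [h2.eventually h1] with x hx
  rwa [mul_inv_cancel_left₀ hlam0.ne'] at hx

lemma measure_withDensity_ofReal_facts {p : ℝ → ℝ} (hp0 : ∀ x, 0 ≤ p x)
    (hp_int : ∀ t > (0 : ℝ), Integrable (fun x => Real.exp (t * x) * p x)) :
    (∀ f : ℝ → ℝ, Integrable f (volume.withDensity fun x => ENNReal.ofReal (p x)) ↔
      Integrable fun x => p x * f x) ∧
    (∀ f : ℝ → ℝ, ∫ x, f x ∂(volume.withDensity fun x => ENNReal.ofReal (p x)) =
      ∫ x, p x * f x) := by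
  have hpm : AEStronglyMeasurable p volume := by
    have h1 := (hp_int 1 one_pos).aestronglyMeasurable
    have h2 : Continuous fun x : ℝ => Real.exp (-x) := by fun_prop
    refine (h2.aestronglyMeasurable.mul h1).congr (ae_of_all _ fun x => ?_)
    simp only [Pi.mul_apply, one_mul]
    rw [← mul_assoc, ← Real.exp_add, neg_add_cancel, Real.exp_zero, one_mul]
  have hpm' : AEMeasurable (fun x => ENNReal.ofReal (p x)) volume :=
    hpm.aemeasurable.ennreal_ofReal
  have hlt : ∀ᵐ x ∂(volume : Measure ℝ), ENNReal.ofReal (p x) < ⊤ :=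
    ae_of_all _ fun x => ENNReal.ofReal_lt_top
  constructor
  · intro f
    rw [integrable_withDensity_iff_integrable_smul₀' hpm' hlt]
    simp [ENNReal.toReal_ofReal (hp0 _)]
  · intro f
    rw [integral_withDensity_eq_integral_toReal_smul₀ hpm' hlt]
    simp [ENNReal.toReal_ofReal (hp0 _)]

/-- The second derivative of the log-Laplace transform of a density, together with the
integrability of the moments involved. -/
lemma iteratedDeriv_two_log_integral_exp_mul {p : ℝ → ℝ} (hp0 : ∀ x, 0 ≤ p x)
    (hp_int : ∀ t > (0 : ℝ), Integrable (fun x => Real.exp (t * x) * p x)) {t : ℝ} (ht : 0 < t) :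
    (∀ n : ℕ, Integrable fun x => x ^ n * (Real.exp (t * x) * p x)) ∧
    iteratedDeriv 2 (fun u => Real.log (∫ x, Real.exp (u * x) * p x)) t =
      (∫ x, x ^ 2 * (Real.exp (t * x) * p x)) / (∫ x, Real.exp (t * x) * p x) -
        ((∫ x, x * (Real.exp (t * x) * p x)) / (∫ x, Real.exp (t * x) * p x)) ^ 2 := by
  obtain ⟨hI, hE⟩ := measure_withDensity_ofReal_facts hp0 hp_int
  set μ : Measure ℝ := volume.withDensity fun x => ENNReal.ofReal (p x) with hμ
  have hsub : Set.Ioi (0 : ℝ) ⊆ integrableExpSet id μ := by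
    intro s hs
    refine (hI _).2 ((hp_int s hs).congr (ae_of_all _ fun x => ?_))
    simp [mul_comm]
  have htint : t ∈ interior (integrableExpSet id μ) := interior_maximal hsub isOpen_Ioi ht
  have hmgf : ∀ s, mgf id μ s = ∫ x, Real.exp (s * x) * p x := by
    intro s
    rw [mgf, hE]
    simp [mul_comm]
  have hcgf : (fun u => Real.log (∫ x, Real.exp (u * x) * p x)) = cgf id μ := by
    funext u
    rw [cgf, hmgf]
  refine ⟨fun n => ?_, ?_⟩
  · have := (hI _).1 (integrable_pow_mul_exp_of_mem_interior_integrableExpSet htint n)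
    refine this.congr (ae_of_all _ fun x => ?_)
    simp only [id]
    ring
  · rw [hcgf, iteratedDeriv_two_cgf htint, deriv_cgf htint, hmgf, hE, hE]
    simp only [id]
    congr 2
    · exact integral_congr_ae (ae_of_all _ fun x => by ring)
    · congr 1
      exact integral_congr_ae (ae_of_all _ fun x => by ring)

/-- Affine change of variables in the formula for a variance. -/
lemma variance_ratio_affine {f w : ℝ → ℝ} {a s c : ℝ} (hs : 0 < s) (hc : c ≠ 0)
    (hw : ∀ u, w u = c * f (a + s * u))
    (hf : ∀ n : ℕ, Integrable fun x => x ^ n * f x)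
    (hw0 : ∫ u, w u ≠ 0) :
    (∫ x, x ^ 2 * f x) / (∫ x, f x) - ((∫ x, x * f x) / (∫ x, f x)) ^ 2 =
      s ^ 2 * ((∫ u, u ^ 2 * w u) / (∫ u, w u) - ((∫ u, u * w u) / (∫ u, w u)) ^ 2) := by
  have hcv : ∀ F : ℝ → ℝ, ∫ x, F x = s * ∫ u, F (a + s * u) := by
    intro F
    have h1 := Measure.integral_comp_mul_left (fun x => F (a + x)) s
    rw [h1, integral_add_left_eq_self F a, abs_of_pos (by positivity), smul_eq_mul,
      mul_inv_cancel_left₀ hs.ne']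
  have hfa : ∀ n : ℕ, Integrable fun x => x ^ n * f (a + x) := by
    intro n
    have h1 : Integrable fun x => (x - a) ^ n * f x := by
      have : (fun x => (x - a) ^ n * f x) = fun x => ∑ m ∈ Finset.range (n + 1),
          ((-a) ^ (n - m) * n.choose m) * (x ^ m * f x) := by
        funext x
        rw [sub_eq_add_neg, add_pow, Finset.sum_mul]
        exact Finset.sum_congr rfl fun m _ => by ring
      rw [this]
      exact integrable_finsetSum _ fun m _ => (hf m).const_mul _
    simpa using h1.comp_add_left a
  have hfw : ∀ n : ℕ, Integrable fun u => u ^ n * w u := by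
    intro n
    have h1 := ((hfa n).comp_mul_left' hs.ne').const_mul (c * (s ^ n)⁻¹)
    refine h1.congr (ae_of_all _ fun u => ?_)
    simp only [hw, mul_pow]
    field_simp
  have hw0' : Integrable w := by simpa using hfw 0
  have hw1' : Integrable fun u => u * w u := by simpa using hfw 1
  have hfw' : ∀ u, f (a + s * u) = c⁻¹ * w u := fun u => by
    rw [hw, inv_mul_cancel_left₀ hc]
  have e0 : ∫ x, f x = s * (c⁻¹ * ∫ u, w u) := by
    rw [hcv, ← integral_const_mul c⁻¹]
    simp_rw [hfw']
  have e1 : ∫ x, x * f x = s * (c⁻¹ * (a * (∫ u, w u) + s * ∫ u, u * w u)) := by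
    rw [hcv, ← integral_const_mul a, ← integral_const_mul s (fun u => u * w u),
      ← integral_add (hw0'.const_mul a) (hw1'.const_mul s), ← integral_const_mul c⁻¹]
    congr 1
    exact integral_congr_ae (ae_of_all _ fun u => by simp only [hfw']; ring)
  have e2 : ∫ x, x ^ 2 * f x = s * (c⁻¹ * (a ^ 2 * (∫ u, w u) + 2 * a * s * (∫ u, u * w u) +
      s ^ 2 * ∫ u, u ^ 2 * w u)) := by
    have h01 : Integrable fun u => a ^ 2 * w u + 2 * a * s * (u * w u) :=
      (hw0'.const_mul _).add (hw1'.const_mul _)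
    rw [hcv, ← integral_const_mul (a ^ 2), ← integral_const_mul (2 * a * s),
      ← integral_const_mul (s ^ 2), ← integral_add (hw0'.const_mul _) (hw1'.const_mul _),
      ← integral_add h01 ((hfw 2).const_mul _),
      ← integral_const_mul c⁻¹]
    congr 1
    exact integral_congr_ae (ae_of_all _ fun u => by
      simp only [hfw']; ring)
  rw [e0, e1, e2]
  field_simp
  ring

lemma gaussian_moments :
    (∫ u : ℝ, Real.exp (-(u ^ 2 / 2))) = √(2 * π) ∧
    (∫ u : ℝ, u * Real.exp (-(u ^ 2 / 2))) = 0 ∧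
    (∫ u : ℝ, u ^ 2 * Real.exp (-(u ^ 2 / 2))) = √(2 * π) := by
  have hpos : 0 < √(2 * π) := by positivity
  have key : ∀ F : ℝ → ℝ, ∫ u, F u * Real.exp (-(u ^ 2 / 2)) =
      √(2 * π) * ∫ u, F u ∂(gaussianReal 0 1) := by
    intro F
    rw [integral_gaussianReal_eq_integral_smul one_ne_zero, ← integral_const_mul]
    refine integral_congr_ae (ae_of_all _ fun u => ?_)
    simp only [gaussianPDFReal_def, smul_eq_mul, NNReal.coe_one, mul_one, sub_zero, neg_div]
    field_simp
  refine ⟨?_, ?_, ?_⟩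
  · simpa using key fun _ => 1
  · rw [key, integral_id_gaussianReal, mul_zero]
  · rw [key]
    have h := variance_fun_id_gaussianReal (μ := 0) (v := 1)
    rw [variance_eq_integral (by fun_prop)] at h
    simp only [integral_id_gaussianReal, sub_zero, NNReal.coe_one] at h
    rw [h, mul_one]

/-- Gaussian limit of the variances of dominated weights. -/
lemma tendsto_variance_of_gaussian_limit {w : ℝ → ℝ → ℝ} {C : ℝ}
    (hmeas : ∀ᶠ t in atTop, AEStronglyMeasurable (w t) volume)
    (hbound : ∀ᶠ t in atTop, ∀ᵐ u, |w t u| ≤ C * Real.exp (-(|u| / 4)))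
    (hlim : ∀ u, Tendsto (fun t => w t u) atTop (nhds (Real.exp (-(u ^ 2 / 2))))) :
    (∀ᶠ t in atTop, ∫ u, w t u ≠ 0) ∧
    Tendsto (fun t => (∫ u, u ^ 2 * w t u) / (∫ u, w t u) -
      ((∫ u, u * w t u) / (∫ u, w t u)) ^ 2) atTop (nhds 1) := by
  have hdom : ∀ n : ℕ, Integrable fun u : ℝ => |u| ^ n * (C * Real.exp (-(|u| / 4))) := by
    intro n
    have h1 : IntegrableOn (fun u : ℝ => u ^ n * Real.exp (-(u / 4))) (Set.Ioi 0) := by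
      have := integrableOn_rpow_mul_exp_neg_mul_rpow (p := 1) (s := n) (b := 1 / 4)
        (by have : (0 : ℝ) ≤ n := by positivity
            linarith) one_pos (by norm_num)
      refine this.congr_fun (fun x _ => ?_) measurableSet_Ioi
      simp only [rpow_natCast, rpow_one]
      congr 2
      ring
    have h2 := (integrable_fun_norm_addHaar (volume : Measure ℝ)
      (f := fun u : ℝ => u ^ n * Real.exp (-(u / 4)))).2 (by simpa using h1)
    exact (h2.const_mul C).congr (ae_of_all _ fun u => by
      simp only [Real.norm_eq_abs]; ring)
  have hJ : ∀ n : ℕ, Tendsto (fun t => ∫ u, u ^ n * w t u) atTop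
      (nhds (∫ u, u ^ n * Real.exp (-(u ^ 2 / 2)))) := by
    intro n
    refine tendsto_integral_filter_of_dominated_convergence _ ?_ ?_ (hdom n) ?_
    · filter_upwards [hmeas] with t ht
      exact (by fun_prop : Continuous fun u : ℝ => u ^ n).aestronglyMeasurable.mul ht
    · filter_upwards [hbound] with t ht
      filter_upwards [ht] with u hu
      rw [norm_mul, norm_pow, Real.norm_eq_abs, Real.norm_eq_abs]
      gcongr
    · exact ae_of_all _ fun u => (hlim u).const_mul _
  obtain ⟨g0, g1, g2⟩ := gaussian_moments
  have hpos : √(2 * π) ≠ 0 := by positivity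
  have h0 := hJ 0
  have h1 := hJ 1
  have h2 := hJ 2
  simp only [pow_zero, one_mul, pow_one, g0, g1, g2] at h0 h1 h2
  refine ⟨h0.eventually_ne hpos, ?_⟩
  have := (h2.div h0 hpos).sub ((h1.div h0 hpos).pow 2)
  rwa [div_self hpos, zero_div, zero_pow two_ne_zero, sub_zero] at this

/-- **Laplace's method for the variance of an exponentially tilted log-concave density**:
if `g''` is asymptotically constant on the scale `g''(ψ t) ^ (-1/2)` around the maximizer `ψ t`
of `t x - g x`, then the variance is asymptotic to `1 / g''(ψ t)`. -/
theorem tendsto_tilted_variance_mul {g ψ q p : ℝ → ℝ} {M : ℝ}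
    (hg_conv : ConvexOn ℝ (Set.Ioi 0) g)
    (hg1 : ∀ x > (0 : ℝ), HasDerivAt g (deriv g x) x)
    (hg2 : ∀ x > (0 : ℝ), HasDerivAt (deriv g) (deriv (deriv g) x) x)
    (hψ_inv : ∀ᶠ t in atTop, deriv g (ψ t) = t)
    (hpos : ∀ᶠ t in atTop, 0 < deriv (deriv g) (ψ t))
    (hloc : ∀ A > (0 : ℝ), ∀ δ > (0 : ℝ), ∀ N : ℝ, ∀ᶠ t in atTop, ∀ y,
      |y - ψ t| ≤ A * (√(deriv (deriv g) (ψ t)))⁻¹ →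
        N ≤ y ∧ |deriv (deriv g) y / deriv (deriv g) (ψ t) - 1| ≤ δ)
    (hq_bdd : ∀ x ≥ (0 : ℝ), |q x| ≤ M) (hq : Tendsto q atTop (nhds 0))
    (hp : ∀ x, p x = if 0 ≤ x then Real.exp (-(g x - q x)) else 0)
    (hp_int : ∀ t > (0 : ℝ), Integrable (fun x => Real.exp (t * x) * p x)) :
    Tendsto (fun t => iteratedDeriv 2
      (fun u => Real.log (∫ x, Real.exp (u * x) * p x)) t * deriv (deriv g) (ψ t))
      atTop (nhds 1) := by
  have hp0 : ∀ x, 0 ≤ p x := fun x => by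
    rw [hp]; split_ifs <;> positivity
  set s : ℝ → ℝ := fun t => (√(deriv (deriv g) (ψ t)))⁻¹ with hs
  set f : ℝ → ℝ → ℝ := fun t u => g (ψ t + s t * u) - g (ψ t) - t * (s t * u) with hf
  set w : ℝ → ℝ → ℝ := fun t u => Real.exp (g (ψ t) - t * ψ t) *
    (Real.exp (t * (ψ t + s t * u)) * p (ψ t + s t * u)) with hw
  have hs_pos : ∀ᶠ t in atTop, 0 < s t := hpos.mono fun t ht => by
    simp only [hs]; positivity
  have hs_sq : ∀ᶠ t in atTop, s t ^ 2 * deriv (deriv g) (ψ t) = 1 := hpos.mono fun t ht => by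
    simp only [hs]
    rw [inv_pow, Real.sq_sqrt ht.le, inv_mul_cancel₀ ht.ne']
  have hψ_pos : ∀ᶠ t in atTop, 0 < ψ t := by
    filter_upwards [hloc 1 one_pos 1 one_pos 1, hpos] with t ht ht'
    linarith [(ht (ψ t) (by simp)).1]
  have hw_eq : ∀ t u, 0 < ψ t + s t * u →
      w t u = Real.exp (-f t u + q (ψ t + s t * u)) := by
    intro t u hu
    simp only [hw, hf, hp, if_pos hu.le]
    rw [← Real.exp_add, ← Real.exp_add]
    congr 1
    ring
  -- the exponent is asymptotically quadratic
  have hquad : ∀ u : ℝ, ∀ δ > (0 : ℝ), ∀ᶠ t in atTop, |f t u - u ^ 2 / 2| ≤ δ * u ^ 2 := by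
    intro u δ hδ
    filter_upwards [hloc (|u| + 1) (by positivity) δ hδ 1, hpos, hψ_inv, hs_pos, hs_sq,
      hψ_pos] with t hl hpt hinv hst hsq hψt
    have hmem : ∀ v, |v| ≤ |u| → |ψ t + s t * v - ψ t| ≤ (|u| + 1) * s t := by
      intro v hv
      rw [add_sub_cancel_left, abs_mul, abs_of_pos hst, mul_comm]
      exact mul_le_mul_of_nonneg_right (by linarith) hst.le
    have haff : ∀ v, HasDerivAt (fun v => ψ t + s t * v) (s t) v := fun v => by
      simpa using ((hasDerivAt_id' v).const_mul (s t)).const_add (ψ t)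
    have hxpos : ∀ v, |v| ≤ |u| → 0 < ψ t + s t * v := fun v hv => by
      linarith [(hl _ (hmem v hv)).1]
    have := abs_sub_quadratic_le (f := fun v => g (ψ t + s t * v))
      (f' := fun v => deriv g (ψ t + s t * v) * s t)
      (f'' := fun v => deriv (deriv g) (ψ t + s t * v) * s t * s t) (u := u) (δ := δ)
      (fun v hv => (hg1 _ (hxpos v hv)).comp v (haff v))
      (fun v hv => ((hg2 _ (hxpos v hv)).comp v (haff v)).mul_const _)
      (fun v hv => by
        convert (hl _ (hmem v hv)).2 using 3
        rw [eq_div_iff hpt.ne']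
        linear_combination deriv (deriv g) (ψ t + s t * v) * hsq)
    convert this using 2
    simp only [hf, mul_zero, add_zero, hinv]
    ring
  have hlim_f : ∀ u, Tendsto (fun t => f t u) atTop (nhds (u ^ 2 / 2)) := by
    intro u
    refine Metric.tendsto_nhds.2 fun ε hε => ?_
    filter_upwards [hquad u (ε / (u ^ 2 + 1)) (by positivity)] with t ht
    rw [Real.dist_eq]
    refine ht.trans_lt ?_
    rw [div_mul_eq_mul_div, div_lt_iff₀ (by positivity)]
    nlinarith
  have hx_top : ∀ u, Tendsto (fun t => ψ t + s t * u) atTop atTop := by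
    intro u
    refine tendsto_atTop.2 fun N => ?_
    filter_upwards [hloc (|u| + 1) (by positivity) 1 one_pos N, hs_pos] with t ht hst
    refine (ht _ ?_).1
    rw [add_sub_cancel_left, abs_mul, abs_of_pos hst, mul_comm]
    exact mul_le_mul_of_nonneg_right (by linarith) hst.le
  have hlim : ∀ u, Tendsto (fun t => w t u) atTop (nhds (Real.exp (-(u ^ 2 / 2)))) := by
    intro u
    have h1 : Tendsto (fun t => Real.exp (-f t u + q (ψ t + s t * u))) atTop
        (nhds (Real.exp (-(u ^ 2 / 2)))) := by
      have := ((hlim_f u).neg.add (hq.comp (hx_top u))).rexp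
      simpa using this
    refine h1.congr' ?_
    filter_upwards [(hx_top u).eventually_gt_atTop 0] with t ht
    exact (hw_eq t u ht).symm
  have hbound : ∀ᶠ t in atTop, ∀ᵐ u : ℝ,
      |w t u| ≤ Real.exp (2 + M) * Real.exp (-(|u| / 4)) := by
    filter_upwards [hψ_pos, hs_pos, hquad 1 (1 / 4) (by norm_num),
      hquad (-1) (1 / 4) (by norm_num), (hx_top 1).eventually_gt_atTop 0,
      (hx_top (-1)).eventually_gt_atTop 0] with t hψt hst h1 h1' hx1 hx1'
    have hne : ∀ᵐ u : ℝ, u ≠ -ψ t / s t := by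
      simp [ae_iff, measure_singleton]
    filter_upwards [hne] with u hu
    rcases lt_trichotomy (ψ t + s t * u) 0 with h | h | h
    · have : w t u = 0 := by
        simp only [hw, hp, if_neg h.not_ge, mul_zero]
      rw [this, abs_zero]
      positivity
    · exact absurd (by rw [eq_div_iff hst.ne']; linarith) hu
    · rw [hw_eq t u h, abs_of_pos (Real.exp_pos _), ← Real.exp_add, Real.exp_le_exp]
      have hconv : ConvexOn ℝ {u | 0 < ψ t + s t * u} (f t) := by
        have hc : Convex ℝ {u | 0 < ψ t + s t * u} := by
          intro x hx y hy a b ha hb hab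
          have := (convex_Ioi (0 : ℝ)) hx hy ha hb hab
          simp only [smul_eq_mul, Set.mem_Ioi] at this
          change 0 < ψ t + s t * (a * x + b * y)
          linear_combination this + ψ t * hab
        refine ⟨hc, fun x hx y hy a b ha hb hab => ?_⟩
        have := hg_conv.2 (x := ψ t + s t * x) hx (y := ψ t + s t * y) hy ha hb hab
        simp only [smul_eq_mul, hf] at this ⊢
        have e : ψ t + s t * (a * x + b * y) =
            a * (ψ t + s t * x) + b * (ψ t + s t * y) := by
          linear_combination (-ψ t) * hab
        rw [e]
        have e2 : g (ψ t) = a * g (ψ t) + b * g (ψ t) := by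
          rw [← add_mul, hab, one_mul]
        linarith
      have hlow := hconv.abs_div_four_sub_two_le (by simpa using hψt) hx1 hx1' (by simp [hf])
        (by simpa using h1) (by simpa using h1') h
      have hqM := (abs_le.1 (hq_bdd _ h.le)).2
      linarith
  have hmeas : ∀ᶠ t in atTop, AEStronglyMeasurable (w t) volume := by
    filter_upwards [hs_pos, eventually_gt_atTop 0] with t hst ht
    have := ((hp_int t ht).comp_add_left (ψ t)).comp_mul_left' hst.ne'
    exact (this.const_mul _).aestronglyMeasurable
  obtain ⟨hne, hvar⟩ := tendsto_variance_of_gaussian_limit hmeas hbound hlim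
  refine hvar.congr' ?_
  filter_upwards [hne, hs_pos, hs_sq, eventually_gt_atTop 0] with t hne hst hsq ht
  obtain ⟨hI, hD⟩ := iteratedDeriv_two_log_integral_exp_mul hp0 hp_int ht
  rw [hD, variance_ratio_affine (w := w t) hst (Real.exp_ne_zero _) (fun u => rfl) hI hne,
    mul_right_comm, hsq, one_mul]

/-- The filter of pairs `(x, y)` with `x → ∞` and `y / x → 1`. -/
def nearDiagonal : Filter (ℝ × ℝ) :=
  comap (fun z => z.2 / z.1) (nhds 1) ⊓ comap Prod.fst atTop

lemma eventually_nearDiagonal {P : ℝ → ℝ → Prop} :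
    (∀ᶠ z in nearDiagonal, P z.1 z.2) ↔
      ∃ η > (0 : ℝ), ∃ X : ℝ, ∀ x y, |y / x - 1| < η → X ≤ x → P x y := by
  rw [nearDiagonal, ((Metric.nhds_basis_ball.comap _).inf (atTop_basis.comap _)).eventually_iff]
  constructor
  · rintro ⟨⟨η, X⟩, ⟨hη, -⟩, h⟩
    exact ⟨η, hη, X, fun x y h1 h2 => h (x := (x, y)) ⟨h1, h2⟩⟩
  · rintro ⟨η, hη, X, h⟩
    exact ⟨⟨η, X⟩, ⟨hη, trivial⟩, fun z hz => h z.1 z.2 hz.1 hz.2⟩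

lemma tendsto_nearDiagonal_fst : Tendsto Prod.fst nearDiagonal atTop :=
  tendsto_comap.mono_left inf_le_right

lemma tendsto_nearDiagonal_div : Tendsto (fun z => z.2 / z.1) nearDiagonal (nhds 1) :=
  tendsto_comap.mono_left inf_le_left

lemma tendsto_nearDiagonal_snd : Tendsto Prod.snd nearDiagonal atTop := by
  have := tendsto_nearDiagonal_div.pos_mul_atTop one_pos tendsto_nearDiagonal_fst
  refine this.congr' ?_
  filter_upwards [tendsto_nearDiagonal_fst.eventually_gt_atTop 0] with z hz
  exact div_mul_cancel₀ _ hz.ne'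

/-- `f` is pseudo-regularly varying: `f y / f x → 1` as `x → ∞` and `y / x → 1`. -/
def PseudoRegVary (f : ℝ → ℝ) : Prop :=
  Tendsto (fun z : ℝ × ℝ => f z.2 / f z.1) nearDiagonal (nhds 1)

lemma PseudoRegVary.mul {f g : ℝ → ℝ} (hf : PseudoRegVary f) (hg : PseudoRegVary g) :
    PseudoRegVary fun x => f x * g x := by
  have := Tendsto.mul hf hg
  rw [one_mul] at this
  exact this.congr fun z => by rw [mul_div_mul_comm]

lemma PseudoRegVary.inv {f : ℝ → ℝ} (hf : PseudoRegVary f) :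
    PseudoRegVary fun x => (f x)⁻¹ := by
  have := Tendsto.inv₀ hf one_ne_zero
  rw [inv_one] at this
  exact this.congr fun z => by rw [inv_div, div_eq_mul_inv, div_eq_mul_inv, inv_inv, mul_comm]

lemma pseudoRegVary_id : PseudoRegVary fun x => x := tendsto_nearDiagonal_div

lemma PseudoRegVary.congr' {f g : ℝ → ℝ} (hf : PseudoRegVary f) (h : f =ᶠ[atTop] g) :
    PseudoRegVary g := by
  refine Tendsto.congr' ?_ hf
  filter_upwards [tendsto_nearDiagonal_fst.eventually h, tendsto_nearDiagonal_snd.eventually h]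
    with z h1 h2
  rw [h1, h2]

lemma pseudoRegVary_of_tendsto {f : ℝ → ℝ} {l : ℝ} (hf : Tendsto f atTop (nhds l))
    (hl : l ≠ 0) : PseudoRegVary f := by
  have := (hf.comp tendsto_nearDiagonal_snd).div (hf.comp tendsto_nearDiagonal_fst) hl
  rw [div_self hl] at this
  exact this

/-- A function with bounded elasticity is pseudo-regularly varying. -/
lemma pseudoRegVary_of_elasticity_le {f f' : ℝ → ℝ} {C : ℝ}
    (hpos : ∀ᶠ x in atTop, 0 < f x) (hd : ∀ᶠ x in atTop, HasDerivAt f (f' x) x)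
    (hC : ∀ᶠ x in atTop, |x * f' x / f x| ≤ C) : PseudoRegVary f := by
  obtain ⟨X, hX⟩ := eventually_atTop.1 (hpos.and (hd.and (hC.and (eventually_gt_atTop 0))))
  have hC0 : 0 ≤ C := (abs_nonneg _).trans (hX X le_rfl).2.2.1
  have hX0 : 0 < X := (hX X le_rfl).2.2.2
  have hlog : ∀ x y, |y / x - 1| < 1 / 2 → 2 * X ≤ x →
      |Real.log (f y) - Real.log (f x)| ≤ 2 * C * |y / x - 1| := by
    intro x y hy hx
    have hx0 : 0 < x := by linarith
    have hy' : x / 2 ≤ y := by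
      have := (abs_lt.1 hy).1
      rw [lt_sub_iff_add_lt, lt_div_iff₀ hx0] at this
      linarith
    have := (convex_Ici (x / 2)).norm_image_sub_le_of_norm_hasDerivWithin_le
      (f := fun z => Real.log (f z)) (f' := fun z => f' z / f z) (C := 2 * C / x)
      (fun z hz => ((hX z (by linarith [Set.mem_Ici.1 hz])).2.1.log
        (hX z (by linarith [Set.mem_Ici.1 hz])).1.ne').hasDerivWithinAt)
      (fun z hz => by
        have hz' := Set.mem_Ici.1 hz
        have h := (hX z (by linarith)).2.2.1
        have hz0 : 0 < z := by linarith
        rw [mul_div_assoc, abs_mul, abs_of_pos hz0] at h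
        rw [Real.norm_eq_abs, le_div_iff₀ hx0]
        nlinarith [abs_nonneg (f' z / f z)])
      (Set.mem_Ici.2 (by linarith : x / 2 ≤ x)) (Set.mem_Ici.2 hy')
    refine this.trans (le_of_eq ?_)
    rw [Real.norm_eq_abs, show y / x - 1 = (y - x) / x by field_simp, abs_div, abs_of_pos hx0]
    ring
  have hlim : Tendsto (fun z : ℝ × ℝ => Real.log (f z.2) - Real.log (f z.1)) nearDiagonal
      (nhds 0) := by
    have hb : Tendsto (fun z : ℝ × ℝ => 2 * C * |z.2 / z.1 - 1|) nearDiagonal (nhds 0) := by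
      have := ((tendsto_nearDiagonal_div.sub_const 1).abs).const_mul (2 * C)
      simpa using this
    refine squeeze_zero_norm' ?_ hb
    exact eventually_nearDiagonal.2 ⟨1 / 2, by norm_num, 2 * X, hlog⟩
  have := hlim.rexp
  rw [Real.exp_zero] at this
  refine Tendsto.congr' ?_ this
  filter_upwards [tendsto_nearDiagonal_fst.eventually hpos,
    tendsto_nearDiagonal_snd.eventually hpos] with z h1 h2
  rw [Real.exp_sub, Real.exp_log h1, Real.exp_log h2]

lemma Filter.Eventually.eventually_nhds_atTop {P : ℝ → Prop} (hP : ∀ᶠ t in atTop, P t) :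
    ∀ᶠ t in atTop, ∀ᶠ s in nhds t, P s := by
  obtain ⟨T, hT⟩ := eventually_atTop.1 hP
  filter_upwards [eventually_gt_atTop T] with t ht
  filter_upwards [Ioi_mem_nhds ht] with s hs using hT s (le_of_lt hs)


/-- The derivative of the exponential of a Karamata integral. -/
lemma hasDerivAt_exp_integral_div {ε : ℝ → ℝ} (hε : ∀ x ≥ (1 : ℝ), DifferentiableAt ℝ ε x)
    {x : ℝ} (hx : 1 < x) :
    HasDerivAt (fun x => Real.exp (∫ u in (1 : ℝ)..x, ε u / u))
      (Real.exp (∫ u in (1 : ℝ)..x, ε u / u) * (ε x / x)) x := by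
  have hc : ContinuousOn (fun u => ε u / u) (Set.Ici 1) := fun u hu =>
    ((hε u hu).continuousAt.div continuousAt_id
      (by have : (1 : ℝ) ≤ u := hu
          simp only [id]; linarith)).continuousWithinAt
  have hp_int : IntervalIntegrable (fun u => ε u / u) volume 1 x :=
    (hc.mono (by rw [uIcc_of_le hx.le]; exact Icc_subset_Ici_self)).intervalIntegrable
  have hmeas : StronglyMeasurableAtFilter (fun u => ε u / u) (nhds x) volume :=
    (hc.mono Ioi_subset_Ici_self).stronglyMeasurableAtFilter isOpen_Ioi x hx
  exact (intervalIntegral.integral_hasDerivAt_right hp_int hmeas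
    (hc.continuousAt (Ici_mem_nhds hx))).exp

/-- In the regularly varying case, `h` is asymptotically linear on the scale `h' ^ (-1/2)`. -/
lemma Case1.eventually_deriv_ratio {h : ℝ → ℝ} {β c θ : ℝ} {ε : ℝ → ℝ}
    (H : Case1 h β c θ ε) (hh_top : Tendsto h atTop atTop) :
    (∀ᶠ x in atTop, 0 < deriv h x) ∧
    ∀ A > (0 : ℝ), ∀ δ > (0 : ℝ), ∀ N : ℝ, ∀ᶠ x in atTop, ∀ y,
      |y - x| ≤ A * (√(deriv h x))⁻¹ → N ≤ y ∧ |deriv h y / deriv h x - 1| ≤ δ := by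
  have hd : ∀ x > (1 : ℝ), HasDerivAt h (h x * (β + ε x) / x) x := by
    intro x hx
    have hx0 : 0 < x := by linarith
    have h1 := ((hasDerivAt_rpow_const (p := β) (Or.inl hx0.ne')).const_mul c).mul
      (hasDerivAt_exp_integral_div H.eps_diff hx)
    refine (h1.congr_of_eventuallyEq ?_).congr_deriv ?_
    · filter_upwards [Ioi_mem_nhds hx] with y hy
      exact H.h_eq y (le_of_lt hy)
    · rw [H.h_eq x hx.le, rpow_sub_one hx0.ne']
      field_simp
  have hβε : Tendsto (fun x => β + ε x) atTop (nhds β) := by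
    simpa using H.eps_to_zero.const_add β
  have hβε_pos : ∀ᶠ x in atTop, β / 2 < β + ε x :=
    hβε.eventually_const_lt (by linarith [H.beta_pos])
  have hder : ∀ᶠ x in atTop, deriv h x = h x * (β + ε x) * x⁻¹ := by
    filter_upwards [eventually_gt_atTop 1] with x hx
    rw [(hd x hx).deriv, div_eq_mul_inv]
  have hpos : ∀ᶠ x in atTop, 0 < deriv h x := by
    filter_upwards [hder, hβε_pos, eventually_gt_atTop 0, hh_top.eventually_gt_atTop 0]
      with x h1 h2 h3 h4
    have : 0 < β + ε x := by linarith [H.beta_pos]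
    rw [h1]
    positivity
  have hprv : PseudoRegVary (deriv h) := by
    have h1 : PseudoRegVary h := by
      refine pseudoRegVary_of_elasticity_le (f' := fun x => h x * (β + ε x) / x) (C := β + 1)
        (hh_top.eventually_gt_atTop 0)
        ((eventually_gt_atTop 1).mono fun x hx => hd x hx) ?_
      filter_upwards [hβε_pos, hβε.eventually_lt_const (show β < β + 1 by linarith),
        eventually_gt_atTop 0, hh_top.eventually_gt_atTop 0] with x h1 h2 h3 h4
      have : x * (h x * (β + ε x) / x) / h x = β + ε x := by field_simp
      rw [this, abs_of_pos (by linarith [H.beta_pos])]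
      exact h2.le
    exact ((h1.mul (pseudoRegVary_of_tendsto hβε H.beta_pos.ne')).mul
      pseudoRegVary_id.inv).congr' (hder.mono fun x hx => hx.symm)
  have hscale : Tendsto (fun x => x * √(deriv h x)) atTop atTop := by
    have h1 : Tendsto (fun x => √(β / 2 * (x * h x))) atTop atTop :=
      tendsto_sqrt_atTop.comp
        ((tendsto_id.atTop_mul_atTop₀ hh_top).const_mul_atTop (by linarith [H.beta_pos]))
    refine tendsto_atTop_mono' _ ?_ h1
    filter_upwards [hder, hβε_pos, eventually_gt_atTop 0, hh_top.eventually_gt_atTop 0]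
      with x h1 h2 h3 h4
    have h5 : x * √(deriv h x) = √(x ^ 2 * deriv h x) := by
      rw [Real.sqrt_mul (by positivity), Real.sqrt_sq h3.le]
    rw [h5, h1]
    apply Real.sqrt_le_sqrt
    have : x ^ 2 * (h x * (β + ε x) * x⁻¹) = (β + ε x) * (x * h x) := by field_simp
    rw [this]
    gcongr
  refine ⟨hpos, fun A hA δ hδ N => ?_⟩
  have h1 : ∀ᶠ z in nearDiagonal, N ≤ z.2 ∧ |deriv h z.2 / deriv h z.1 - 1| ≤ δ := by
    refine (tendsto_nearDiagonal_snd.eventually_ge_atTop N).and ?_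
    filter_upwards [Metric.tendsto_nhds.1 hprv δ hδ] with z hz
    rw [Real.dist_eq] at hz
    exact hz.le
  obtain ⟨η, hη, X, hX⟩ := (eventually_nearDiagonal
    (P := fun x y => N ≤ y ∧ |deriv h y / deriv h x - 1| ≤ δ)).1 h1
  filter_upwards [hscale.eventually_gt_atTop (A / η), eventually_ge_atTop X,
    eventually_gt_atTop 0, hpos] with x h2 h3 h4 h5 y hy
  refine hX x y ?_ h3
  rw [show y / x - 1 = (y - x) / x by field_simp, abs_div, abs_of_pos h4, div_lt_iff₀ h4]
  refine hy.trans_lt ?_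
  have : 0 < √(deriv h x) := Real.sqrt_pos.2 h5
  rw [div_lt_iff₀ hη] at h2
  rw [← div_eq_mul_inv, div_lt_iff₀ this]
  linarith

/-- In the rapidly varying case, `h` is asymptotically linear on the scale `h' ^ (-1/2)`. -/
lemma Case2.eventually_deriv_ratio {h ψ : ℝ → ℝ} {c : ℝ} {ε : ℝ → ℝ} (H : Case2 ψ c ε)
    (hd : ∀ᶠ x in atTop, HasDerivAt h (deriv h x) x)
    (hmono : ∃ x₀ : ℝ, StrictMonoOn h (Set.Ioi x₀))
    (hψ_inv : ∀ᶠ t in atTop, h (ψ t) = t) (hψ_inv' : ∀ᶠ x in atTop, ψ (h x) = x)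
    (hψ_top : Tendsto ψ atTop atTop) :
    (∀ᶠ t in atTop, 0 < deriv h (ψ t)) ∧ (∀ᶠ t in atTop, deriv ψ t * deriv h (ψ t) = 1) ∧
    ∀ A > (0 : ℝ), ∀ δ > (0 : ℝ), ∀ N : ℝ, ∀ᶠ t in atTop, ∀ y,
      |y - ψ t| ≤ A * (√(deriv h (ψ t)))⁻¹ →
        N ≤ y ∧ |deriv h y / deriv h (ψ t) - 1| ≤ δ := by
  obtain ⟨x₀, hx₀⟩ := hmono
  have hψd : ∀ t > (1 : ℝ), HasDerivAt ψ (ψ t * ε t * t⁻¹) t := by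
    intro t ht
    have h1 := (hasDerivAt_exp_integral_div H.eps_diff ht).const_mul c
    refine (h1.congr_of_eventuallyEq ?_).congr_deriv ?_
    · filter_upwards [Ioi_mem_nhds ht] with y hy
      exact H.psi_eq y (le_of_lt hy)
    · rw [H.psi_eq t ht.le]
      ring
  have hderψ : ∀ᶠ t in atTop, deriv ψ t = ψ t * ε t * t⁻¹ :=
    (eventually_gt_atTop 1).mono fun t ht => (hψd t ht).deriv
  have hprod : ∀ᶠ t in atTop, deriv ψ t * deriv h (ψ t) = 1 := by
    filter_upwards [hψ_top.eventually hd, eventually_gt_atTop 1,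
      hψ_inv.eventually_nhds_atTop] with t h1 h2 h3
    have h4 := (h1.comp t (hψd t h2).differentiableAt.hasDerivAt)
    have h5 : HasDerivAt (h ∘ ψ) 1 t := (hasDerivAt_id t).congr_of_eventuallyEq h3
    rw [mul_comm]
    exact h4.unique h5
  have hnonneg : ∀ᶠ x in atTop, 0 ≤ deriv h x := by
    filter_upwards [eventually_gt_atTop x₀] with x hx
    rw [← derivWithin_of_isOpen isOpen_Ioi (show x ∈ Set.Ioi x₀ from hx)]
    exact hx₀.monotoneOn.derivWithin_nonneg
  have hpos : ∀ᶠ t in atTop, 0 < deriv h (ψ t) := by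
    filter_upwards [hψ_top.eventually hnonneg, hprod] with t h1 h2
    refine h1.lt_of_ne fun h0 => ?_
    rw [← h0, mul_zero] at h2
    exact zero_ne_one h2
  have hψ'pos : ∀ᶠ t in atTop, 0 < deriv ψ t := by
    filter_upwards [hpos, hprod] with t h1 h2
    exact pos_of_mul_pos_left (by rw [h2]; exact one_pos) h1.le
  have hεpos : ∀ᶠ t in atTop, 0 < ε t := by
    filter_upwards [hψ'pos, hderψ, eventually_gt_atTop 0, hψ_top.eventually_gt_atTop 0]
      with t h1 h2 h3 h4
    rw [h2] at h1
    have h5 : 0 < t⁻¹ := inv_pos.2 h3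
    exact (pos_iff_pos_of_mul_pos (pos_of_mul_pos_left h1 h5.le)).1 h4
  have hprv : PseudoRegVary (deriv ψ) := by
    have h1 : PseudoRegVary ψ := by
      refine pseudoRegVary_of_elasticity_le (f' := fun t => ψ t * ε t * t⁻¹) (C := 1)
        (hψ_top.eventually_gt_atTop 0) ((eventually_gt_atTop 1).mono fun t ht => hψd t ht) ?_
      filter_upwards [hεpos, H.eps_to_zero.eventually_lt_const one_pos, eventually_gt_atTop 0,
        hψ_top.eventually_gt_atTop 0] with t h1 h2 h3 h4
      have : t * (ψ t * ε t * t⁻¹) / ψ t = ε t := by field_simp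
      rw [this, abs_of_pos h1]
      exact h2.le
    have h2 : PseudoRegVary ε := by
      refine pseudoRegVary_of_elasticity_le (f' := deriv ε) (C := 1) hεpos
        ((eventually_ge_atTop 1).mono fun t ht => (H.eps_diff t ht).hasDerivAt) ?_
      have h3 := H.eps_ratio1.abs
      rw [abs_zero] at h3
      filter_upwards [h3.eventually_lt_const one_pos] with t ht
      exact ht.le
    exact ((h1.mul h2).mul pseudoRegVary_id.inv).congr' (hderψ.mono fun t ht => ht.symm)
  -- `t ε(t)` is eventually nondecreasing, hence bounded below
  obtain ⟨a, ha, hεlow⟩ : ∃ a > (0 : ℝ), ∀ᶠ t in atTop, a ≤ t * ε t := by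
    obtain ⟨T, hT⟩ := eventually_atTop.1 (hεpos.and ((H.eps_ratio1.eventually_const_lt
      (show (-1 : ℝ) < 0 by norm_num)).and (eventually_gt_atTop 1)))
    have hmon : MonotoneOn (fun t => t * ε t) (Set.Ici T) := by
      have hdT : ∀ t ≥ T, HasDerivAt (fun t => t * ε t) (1 * ε t + t * deriv ε t) t :=
        fun t ht => (hasDerivAt_id' t).mul (H.eps_diff t (hT t ht).2.2.le).hasDerivAt
      refine monotoneOn_of_deriv_nonneg (convex_Ici T)
        (fun t ht => (hdT t ht).continuousAt.continuousWithinAt)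
        (fun t ht => (hdT t (interior_subset ht)).differentiableAt.differentiableWithinAt)
        fun t ht => ?_
      have htT := interior_subset ht
      rw [(hdT t htT).deriv]
      have h1 := (hT t htT).2.1
      rw [lt_div_iff₀ (hT t htT).1] at h1
      linarith
    refine ⟨T * ε T, mul_pos (by linarith [(hT T le_rfl).2.2]) (hT T le_rfl).1, ?_⟩
    filter_upwards [eventually_ge_atTop T] with t ht
    exact hmon (Set.mem_Ici.2 le_rfl) ht ht
  have hscale : Tendsto (fun t => t * √(deriv ψ t)) atTop atTop := by
    have h1 : Tendsto (fun t => √(a * ψ t)) atTop atTop :=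
      tendsto_sqrt_atTop.comp (hψ_top.const_mul_atTop ha)
    refine tendsto_atTop_mono' _ ?_ h1
    filter_upwards [hderψ, hεlow, eventually_gt_atTop 0, hψ_top.eventually_gt_atTop 0]
      with t h1 h2 h3 h4
    have h5 : t * √(deriv ψ t) = √(t ^ 2 * deriv ψ t) := by
      rw [Real.sqrt_mul (by positivity), Real.sqrt_sq h3.le]
    rw [h5, h1]
    apply Real.sqrt_le_sqrt
    have : t ^ 2 * (ψ t * ε t * t⁻¹) = t * ε t * ψ t := by field_simp
    rw [this]
    gcongr
  refine ⟨hpos, hprod, fun A hA δ hδ N => ?_⟩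
  -- pairs `(t, τ)` with `τ / t` close to `1`
  obtain ⟨N', hN'⟩ := eventually_atTop.1 (hψ_inv'.and ((eventually_gt_atTop x₀).and
    (eventually_ge_atTop N)))
  have hnear : ∀ᶠ z in nearDiagonal, |(deriv ψ z.2 / deriv ψ z.1)⁻¹ - 1| ≤ δ ∧
      1 / 2 ≤ deriv ψ z.2 / deriv ψ z.1 ∧ 1 < z.2 ∧ N' ≤ ψ z.2 ∧ h (ψ z.2) = z.2 ∧
      deriv ψ z.2 * deriv h (ψ z.2) = 1 ∧ 0 < deriv ψ z.2 := by
    have h1 := Tendsto.inv₀ hprv one_ne_zero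
    rw [inv_one] at h1
    filter_upwards [Metric.tendsto_nhds.1 h1 δ hδ,
      Tendsto.eventually_const_lt (show (1 / 2 : ℝ) < 1 by norm_num) hprv,
      tendsto_nearDiagonal_snd.eventually_gt_atTop 1,
      tendsto_nearDiagonal_snd.eventually (hψ_top.eventually_ge_atTop N'),
      tendsto_nearDiagonal_snd.eventually hψ_inv,
      tendsto_nearDiagonal_snd.eventually hprod,
      tendsto_nearDiagonal_snd.eventually hψ'pos] with z h1 h2 h3 h4 h5 h6 h7
    rw [Real.dist_eq] at h1
    exact ⟨h1.le, h2.le, h3, h4, h5, h6, h7⟩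
  obtain ⟨η, hη, T, hT⟩ := (eventually_nearDiagonal (P := fun t τ =>
    |(deriv ψ τ / deriv ψ t)⁻¹ - 1| ≤ δ ∧ 1 / 2 ≤ deriv ψ τ / deriv ψ t ∧ 1 < τ ∧ N' ≤ ψ τ ∧
      h (ψ τ) = τ ∧ deriv ψ τ * deriv h (ψ τ) = 1 ∧ 0 < deriv ψ τ)).1 hnear
  filter_upwards [hscale.eventually_ge_atTop (4 * A / η), eventually_ge_atTop T,
    eventually_gt_atTop 0] with t hsc htT ht0 y hy
  have hclose : ∀ τ, |τ - t| ≤ η / 2 * t → |τ / t - 1| < η := by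
    intro τ hτ
    rw [show τ / t - 1 = (τ - t) / t by field_simp, abs_div, abs_of_pos ht0, div_lt_iff₀ ht0]
    nlinarith
  have hP : ∀ τ, |τ - t| ≤ η / 2 * t → _ := fun τ hτ => hT t τ (hclose τ hτ) htT
  have hηt : 0 < η / 2 * t := by positivity
  have htt : |t - t| ≤ η / 2 * t := by simpa using hηt.le
  obtain ⟨-, -, -, -, hψt_inv, hprodt, hψ't⟩ := hP t htt
  have hσ : (√(deriv h (ψ t)))⁻¹ = √(deriv ψ t) := by
    rw [← Real.sqrt_inv, eq_inv_of_mul_eq_one_left hprodt]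
  rw [hσ] at hy
  have hsq : √(deriv ψ t) * √(deriv ψ t) = deriv ψ t := Real.mul_self_sqrt hψ't.le
  have hwin : A * √(deriv ψ t) ≤ deriv ψ t / 2 * (η / 2 * t) := by
    rw [div_le_iff₀ hη] at hsc
    nlinarith [Real.sqrt_nonneg (deriv ψ t)]
  -- lower bounds on the increments of `ψ`
  have hinc : ∀ τ₁ τ₂, |τ₁ - t| ≤ η / 2 * t → |τ₂ - t| ≤ η / 2 * t → τ₁ ≤ τ₂ →
      deriv ψ t / 2 * (τ₂ - τ₁) ≤ ψ τ₂ - ψ τ₁ := by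
    intro τ₁ τ₂ h1 h2 h12
    have hsub : ∀ τ ∈ Set.Icc τ₁ τ₂, |τ - t| ≤ η / 2 * t := fun τ hτ => by
      rw [abs_le] at h1 h2 ⊢
      exact ⟨by linarith [hτ.1], by linarith [hτ.2]⟩
    have hdiff : ∀ τ ∈ Set.Icc τ₁ τ₂, DifferentiableAt ℝ ψ τ := fun τ hτ =>
      (hψd τ (hP τ (hsub τ hτ)).2.2.1).differentiableAt
    refine (convex_Icc τ₁ τ₂).mul_sub_le_image_sub_of_le_deriv
      (fun τ hτ => (hdiff τ hτ).continuousAt.continuousWithinAt)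
      (fun τ hτ => (hdiff τ (interior_subset hτ)).differentiableWithinAt)
      (fun τ hτ => ?_) τ₁ ⟨le_rfl, h12⟩ τ₂ ⟨h12, le_rfl⟩ h12
    have := (hP τ (hsub τ (interior_subset hτ))).2.1
    rw [le_div_iff₀ hψ't] at this
    linarith
  have hmemlo : |t - η / 2 * t - t| ≤ η / 2 * t := by
    rw [show t - η / 2 * t - t = -(η / 2 * t) by ring, abs_neg, abs_of_pos hηt]
  have hmemhi : |t + η / 2 * t - t| ≤ η / 2 * t := by
    rw [add_sub_cancel_left, abs_of_pos hηt]
  have hlo := hinc (t - η / 2 * t) t hmemlo htt (by linarith)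
  have hhi := hinc t (t + η / 2 * t) htt hmemhi (by linarith)
  rw [sub_sub_cancel] at hlo
  rw [add_sub_cancel_left] at hhi
  rw [abs_le] at hy
  have hy1 : ψ (t - η / 2 * t) ≤ y := by linarith
  have hy2 : y ≤ ψ (t + η / 2 * t) := by linarith
  obtain ⟨-, -, -, hN1, hinv1, -, -⟩ := hP _ hmemlo
  obtain ⟨-, -, -, hN2, hinv2, -, -⟩ := hP _ hmemhi
  have hyN := hN' y (hN1.trans hy1)
  have hτ1 := hx₀.monotoneOn (hN' _ hN1).2.1 hyN.2.1 hy1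
  have hτ2 := hx₀.monotoneOn hyN.2.1 (hN' _ hN2).2.1 hy2
  rw [hinv1] at hτ1
  rw [hinv2] at hτ2
  have hτ : |h y - t| ≤ η / 2 * t := abs_le.2 ⟨by linarith, by linarith⟩
  obtain ⟨hr, -, -, -, -, hprody, -⟩ := hP _ hτ
  refine ⟨hyN.2.2, ?_⟩
  rw [hyN.1] at hprody
  rw [eq_inv_of_mul_eq_one_left hprody, eq_inv_of_mul_eq_one_left hprodt] at hr
  rwa [inv_div_inv, inv_div] at hr

/-- the variance `s²(t)` of the tilted density satisfies
`s²(t) = ψ'(t)(1 + o(1))` as `t → ∞`. -/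
theorem tilted_variance_asymptotic
    (g ψ q p Φ : ℝ → ℝ)
    (hg_pos : ∀ x > (0:ℝ), 0 < g x)
    (hg_conv : ConvexOn ℝ (Set.Ioi 0) g)
    (hg_smooth : ContDiffOn ℝ 4 g (Set.Ioi 0))
    (hg_super : Tendsto (fun x => g x / x) atTop atTop)
    (hh_mono : ∃ x₀ : ℝ, StrictMonoOn (deriv g) (Set.Ioi x₀))
    (hh_top : Tendsto (deriv g) atTop atTop)
    (hψ_inv : ∀ᶠ t in atTop, deriv g (ψ t) = t)
    (hψ_inv' : ∀ᶠ x in atTop, ψ (deriv g x) = x)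
    (hψ_top : Tendsto ψ atTop atTop)
    (hq_meas : Measurable q)
    (hq_bdd : ∃ M : ℝ, ∀ x ≥ (0:ℝ), |q x| ≤ M)
    (hcase :
      (∃ β c θ ε, Case1 (deriv g) β c θ ε ∧
        ∃ η, η < θ - 3 * β / 2 - 3 / 2 ∧ RegVary η (fun x => |q x|)) ∨
      (∃ c ε, Case2 ψ c ε ∧
        ∃ η, η < -(1/2 : ℝ) ∧ RegVary η (fun t => |q (ψ t)|)))
    (hp : ∀ x, p x = if 0 ≤ x then Real.exp (-(g x - q x)) else 0)
    (hΦ : ∀ t, Φ t = ∫ x, Real.exp (t * x) * p x)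
    (hΦ_int : ∀ t > (0:ℝ), Integrable (fun x => Real.exp (t * x) * p x)) :
    Tendsto (fun t => iteratedDeriv 2 (fun u => Real.log (Φ u)) t / deriv ψ t)
      atTop (nhds 1) := by
  obtain rfl : Φ = fun t => ∫ x, Real.exp (t * x) * p x := funext hΦ
  obtain ⟨M, hM⟩ := hq_bdd
  have hcd : ContDiffOn ℝ 3 (deriv g) (Set.Ioi 0) :=
    hg_smooth.deriv_of_isOpen isOpen_Ioi (by norm_num)
  have hcda : ∀ x > (0 : ℝ), ContDiffAt ℝ 3 (deriv g) x := fun x hx =>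
    hcd.contDiffAt (Ioi_mem_nhds hx)
  have hg1 : ∀ x > (0 : ℝ), HasDerivAt g (deriv g x) x := fun x hx =>
    ((hg_smooth.contDiffAt (Ioi_mem_nhds hx)).differentiableAt (by norm_num)).hasDerivAt
  have hg2 : ∀ x > (0 : ℝ), HasDerivAt (deriv g) (deriv (deriv g) x) x := fun x hx =>
    ((hcda x hx).differentiableAt (by norm_num)).hasDerivAt
  suffices hmain : Tendsto q atTop (nhds 0) ∧ (∀ᶠ t in atTop, 0 < deriv (deriv g) (ψ t)) ∧
      (∀ᶠ t in atTop, deriv ψ t * deriv (deriv g) (ψ t) = 1) ∧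
      ∀ A > (0 : ℝ), ∀ δ > (0 : ℝ), ∀ N : ℝ, ∀ᶠ t in atTop, ∀ y,
        |y - ψ t| ≤ A * (√(deriv (deriv g) (ψ t)))⁻¹ →
          N ≤ y ∧ |deriv (deriv g) y / deriv (deriv g) (ψ t) - 1| ≤ δ by
    obtain ⟨hq, hpos, hprod, hloc⟩ := hmain
    refine (tendsto_tilted_variance_mul hg_conv hg1 hg2 hψ_inv hpos hloc hM hq hp
      hΦ_int).congr' ?_
    filter_upwards [hprod] with t ht
    rw [div_eq_mul_inv, inv_eq_of_mul_eq_one_right ht]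
  rcases hcase with ⟨β, c, θ, ε, H, η, hη, hqη⟩ | ⟨c, ε, H, η, hη, hqη⟩
  · obtain ⟨hpos, hloc⟩ := H.eventually_deriv_ratio hh_top
    refine ⟨(tendsto_zero_iff_abs_tendsto_zero q).2 (hqη.tendsto_zero ?_ (M := M) ?_),
      hψ_top.eventually hpos, ?_,
      fun A hA δ hδ N => hψ_top.eventually (hloc A hA δ hδ N)⟩
    · linarith [H.theta_le, H.beta_pos]
    · filter_upwards [eventually_ge_atTop 0] with x hx using hM x hx
    · filter_upwards [hψ_top.eventually hpos, hψ_top.eventually_gt_atTop 0, hψ_inv,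
        hψ_top.eventually hψ_inv'.eventually_nhds_atTop] with t h1 h2 h3 h4
      have h5 : HasStrictDerivAt (deriv g) (deriv (deriv g) (ψ t)) (ψ t) :=
        (hcda _ h2).hasStrictDerivAt (by norm_num)
      have h6 := (h5.to_local_left_inverse h1.ne' h4).hasDerivAt
      rw [h3] at h6
      rw [h6.deriv, inv_mul_cancel₀ h1.ne']
  · obtain ⟨hpos, hprod, hloc⟩ := H.eventually_deriv_ratio
      ((eventually_gt_atTop 0).mono hg2) hh_mono hψ_inv hψ_inv' hψ_top
    refine ⟨(tendsto_zero_iff_abs_tendsto_zero q).2 ?_, hpos, hprod, hloc⟩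
    have hqψ := hqη.tendsto_zero (M := M) (by linarith)
      ((hψ_top.eventually_ge_atTop 0).mono fun t ht => hM _ ht)
    refine (hqψ.comp hh_top).congr' ?_
    filter_upwards [hψ_inv'] with x hx
    simp [hx]
end
end

section
/- Suppose h belongs to ℛ (i.e. Case 1 or Case 2 holds) and q satisfies the corresponding tail condition. Then the third centered moment of the tilted density satisfies μ₃(t) = ψ''(t)(1 + o(1)) as t → ∞. -/
open Real Filter MeasureTheory Set ProbabilityTheory Asymptotics

noncomputable section

/-- Additive form of the uniform convergence theorem for slowly varying functions. -/
theorem uniform_convergence_additive {k : ℝ → ℝ} (hk : Measurable k)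
    (hlim : ∀ u : ℝ, Tendsto (fun x => k (x + u) - k x) atTop (nhds 0))
    {ε : ℝ} (hε : 0 < ε) :
    ∀ᶠ x in atTop, ∀ u ∈ Icc (-1 : ℝ) 1, |k (x + u) - k x| ≤ ε := by
  set d : ℝ → ℝ → ℝ := fun x u => min 1 |k (x + u) - k x| with hd
  have hd0 : ∀ x u, 0 ≤ d x u := fun x u => le_min zero_le_one (abs_nonneg _)
  have hd1 : ∀ x u, d x u ≤ 1 := fun x u => min_le_left _ _
  have hdm : ∀ x, Measurable (d x) := fun x =>
    measurable_const.min ((hk.comp (measurable_const.add measurable_id)).sub_const _).abs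
  have hdint : ∀ x a b, IntervalIntegrable (d x) volume a b := by
    intro x a b
    refine (intervalIntegrable_const (c := (1 : ℝ))).mono_fun (hdm x).aestronglyMeasurable ?_
    refine Eventually.of_forall fun u => ?_
    simpa [abs_of_nonneg (hd0 x u)] using hd1 x u
  have hF : Tendsto (fun x => ∫ u in (0 : ℝ)..4, d x u) atTop (nhds 0) := by
    have h0 : Tendsto (fun x => ∫ u in (0 : ℝ)..4, d x u) atTop
        (nhds (∫ _ in (0 : ℝ)..4, (0 : ℝ))) := by
      refine intervalIntegral.tendsto_integral_filter_of_dominated_convergence (fun _ => 1)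
        (Eventually.of_forall fun x => (hdm x).aestronglyMeasurable)
        (Eventually.of_forall fun x => Eventually.of_forall fun u _ => ?_)
        intervalIntegrable_const (Eventually.of_forall fun u _ => ?_)
      · simpa [abs_of_nonneg (hd0 x u)] using hd1 x u
      · have h1 := (hlim u).abs
        have h2 := (tendsto_const_nhds (x := (1 : ℝ))).min h1
        simpa [hd] using h2
    simpa using h0
  have hε' : 0 < min 1 ε / 2 := by positivity
  obtain ⟨X, hX⟩ := eventually_atTop.1 (hF.eventually (gt_mem_nhds hε'))
  filter_upwards [eventually_ge_atTop (X + 1)] with x hx u hu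
  have key : ∀ l, d x u ≤ d x l + d (x + u) (l - u) := by
    intro l
    have e1 : x + u + (l - u) = x + l := by ring
    simp only [hd, e1]
    have tri : |k (x + u) - k x| ≤ |k (x + l) - k x| + |k (x + l) - k (x + u)| := by
      have := abs_sub_abs_le_abs_sub (k (x + u) - k x) (k (x + l) - k x)
      rw [show k (x + u) - k x - (k (x + l) - k x) = -(k (x + l) - k (x + u)) by ring,
        abs_neg] at this
      linarith
    rcases le_total 1 |k (x + l) - k x| with h | h <;>
    rcases le_total 1 |k (x + l) - k (x + u)| with h' | h' <;>
    simp only [min_eq_left, min_eq_right, h, h'] <;>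
    first
    | exact (min_le_right _ _).trans tri
    | (refine (min_le_left _ _).trans ?_
       linarith [abs_nonneg (k (x + l) - k x), abs_nonneg (k (x + l) - k (x + u))])
  have hsh : IntervalIntegrable (fun l => d (x + u) (l - u)) volume 1 3 := by
    simpa using (hdint (x + u) (1 - u) (3 - u)).comp_sub_right u
  have hi : ∫ _ in (1 : ℝ)..3, d x u ≤ ∫ l in (1 : ℝ)..3, (d x l + d (x + u) (l - u)) := by
    refine intervalIntegral.integral_mono_on (by norm_num) intervalIntegrable_const ?_
      (fun l _ => key l)
    exact (hdint _ _ _).add hsh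
  rw [intervalIntegral.integral_add (hdint _ _ _) hsh,
    intervalIntegral.integral_comp_sub_right (fun l => d (x + u) l),
    intervalIntegral.integral_const] at hi
  have m1 : ∫ l in (1 : ℝ)..3, d x l ≤ ∫ l in (0 : ℝ)..4, d x l :=
    intervalIntegral.integral_mono_interval (by norm_num) (by norm_num) (by norm_num)
      (Eventually.of_forall fun l => hd0 x l) (hdint _ _ _)
  have m2 : ∫ l in (1 - u)..(3 - u), d (x + u) l ≤ ∫ l in (0 : ℝ)..4, d (x + u) l :=
    intervalIntegral.integral_mono_interval (by linarith [hu.2]) (by linarith) (by linarith [hu.1])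
      (Eventually.of_forall fun l => hd0 _ l) (hdint _ _ _)
  have f1 := hX x (by linarith)
  have f2 := hX (x + u) (by linarith [hu.1])
  have hlt : d x u < min 1 ε := by
    simp only [smul_eq_mul] at hi
    linarith [min_le_left 1 ε]
  rcases min_lt_iff.1 hlt with h | h
  · exact absurd h (min_le_left _ _).not_gt
  · exact (h.trans_le (min_le_right _ _)).le
namespace RegVary

variable {α β : ℝ} {f f₁ f₂ : ℝ → ℝ}

theorem congr (hf : RegVary α f₁) (h : f₁ =ᶠ[atTop] f₂) : RegVary α f₂ := by
  refine ⟨by filter_upwards [hf.1, h] with x hx he using he ▸ hx, fun l hl => ?_⟩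
  refine (hf.2 l hl).congr' ?_
  filter_upwards [h, (tendsto_id.const_mul_atTop hl).eventually h] with x h1 h2
  simp only [id] at h2
  rw [h1, h2]

theorem mul (h₁ : RegVary α f₁) (h₂ : RegVary β f₂) :
    RegVary (α + β) (fun x => f₁ x * f₂ x) := by
  refine ⟨by filter_upwards [h₁.1, h₂.1] with x a b using mul_pos a b, fun l hl => ?_⟩
  rw [rpow_add hl]
  refine ((h₁.2 l hl).mul (h₂.2 l hl)).congr fun x => ?_
  rw [div_mul_div_comm]

theorem inv (h : RegVary α f) : RegVary (-α) (fun x => (f x)⁻¹) := by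
  refine ⟨by filter_upwards [h.1] with x a using inv_pos.2 a, fun l hl => ?_⟩
  rw [rpow_neg hl.le]
  refine ((h.2 l hl).inv₀ (rpow_pos_of_pos hl _).ne').congr fun x => ?_
  rw [inv_div, inv_div_inv]

theorem rpow (h : RegVary α f) (r : ℝ) : RegVary (α * r) (fun x => f x ^ r) := by
  refine ⟨by filter_upwards [h.1] with x a using rpow_pos_of_pos a _, fun l hl => ?_⟩
  rw [rpow_mul hl.le]
  refine ((h.2 l hl).rpow_const (Or.inl (rpow_pos_of_pos hl _).ne')).congr' ?_
  filter_upwards [h.1, (tendsto_id.const_mul_atTop hl).eventually h.1] with x h1 h2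
  exact div_rpow (le_of_lt h2) h1.le r

theorem of_tendsto {L : ℝ} (hL : 0 < L) (h : Tendsto f atTop (nhds L)) : RegVary 0 f := by
  refine ⟨h.eventually (lt_mem_nhds hL), fun l hl => ?_⟩
  have := (h.comp (tendsto_id.const_mul_atTop hl)).div h hL.ne'
  rw [div_self hL.ne'] at this
  rw [rpow_zero]
  exact this

theorem id : RegVary 1 (fun x => x) := by
  refine ⟨eventually_gt_atTop 0, fun l hl => ?_⟩
  rw [rpow_one]
  refine tendsto_const_nhds.congr' ?_
  filter_upwards [eventually_gt_atTop 0] with x hx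
  field_simp

/-- A function with `x f'(x) / f(x) → α` is regularly varying with index `α`. -/
theorem of_logDeriv {f' : ℝ → ℝ} (hpos : ∀ᶠ x in atTop, 0 < f x)
    (hder : ∀ᶠ x in atTop, HasDerivAt f (f' x) x)
    (hlim : Tendsto (fun x => x * f' x / f x) atTop (nhds α)) : RegVary α f := by
  refine ⟨hpos, fun l hl => ?_⟩
  suffices h : Tendsto (fun x => log (f (l * x)) - log (f x)) atTop (nhds (α * log l)) by
    have h2 := (continuous_exp.tendsto _).comp h
    rw [mul_comm α, ← rpow_def_of_pos hl] at h2
    refine h2.congr' ?_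
    filter_upwards [hpos, (tendsto_id.const_mul_atTop hl).eventually hpos] with x h1 h3
    simp only [_root_.id] at h3
    simp only [Function.comp, exp_sub, exp_log h1, exp_log h3]
  obtain ⟨X, hX⟩ := eventually_atTop.1 (hpos.and (hder.and (eventually_gt_atTop 0)))
  have hkder : ∀ u : ℝ, X ≤ exp u →
      HasDerivAt (fun u => log (f (exp u))) (exp u * f' (exp u) / f (exp u)) u := by
    intro u hu
    obtain ⟨h1, h2, _⟩ := hX _ hu
    have := (h2.comp u (hasDerivAt_exp u)).log h1.ne'
    simpa [mul_comm] using this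
  have hmv : ∀ᶠ x in atTop, ∃ ξ, min x (l * x) ≤ ξ ∧
      log (f (l * x)) - log (f x) = (ξ * f' ξ / f ξ) * log l := by
    filter_upwards [eventually_ge_atTop X, eventually_gt_atTop 0,
      (tendsto_id.const_mul_atTop hl).eventually (eventually_ge_atTop X)] with x h1 h0 h2
    simp only [_root_.id] at h2
    have hlx : 0 < l * x := mul_pos hl h0
    have hu : uIcc (log x) (log (l * x)) ⊆ {u | min x (l * x) ≤ exp u} := by
      intro u hu
      rcases min_choice x (l * x) with h | h <;> simp only [mem_ofPred_eq, uIcc, mem_Icc] at hu ⊢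
      all_goals
        have : log (min x (l * x)) ≤ u := by
          rcases le_total x (l * x) with h' | h'
          · rw [min_eq_left h']
            rw [min_eq_left (log_le_log h0 h')] at hu
            exact hu.1
          · rw [min_eq_right h']
            rw [min_eq_right (log_le_log hlx h')] at hu
            exact hu.1
        rw [← exp_log (lt_min h0 hlx)]
        exact exp_le_exp.2 this
    have hD : ∀ u ∈ uIcc (log x) (log (l * x)),
        HasDerivAt (fun u => log (f (exp u))) (exp u * f' (exp u) / f (exp u)) u :=
      fun u hu' => hkder u ((le_min h1 h2).trans (hu hu'))
    have hlog : log (l * x) = log l + log x := log_mul hl.ne' h0.ne'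
    rcases lt_trichotomy (log x) (log (l * x)) with h | h | h
    · rw [uIcc_of_lt h] at hD hu
      obtain ⟨c, hc, hc'⟩ := exists_hasDerivAt_eq_slope _ _ h
        (fun u hu' => (hD u hu').continuousAt.continuousWithinAt)
        (fun u hu' => hD u (Ioo_subset_Icc_self hu'))
      refine ⟨exp c, hu (Ioo_subset_Icc_self hc), ?_⟩
      rw [hc', exp_log h0, exp_log hlx, hlog]
      have : log l ≠ 0 := by intro h'; rw [hlog, h'] at h; linarith
      rw [add_sub_cancel_right, div_mul_cancel₀ _ this]
    · have : log l = 0 := by linarith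
      have hl1 : l * x = x := by
        rw [← exp_log hlx, ← h, exp_log h0]
      exact ⟨x, min_le_left _ _, by rw [hl1, this]; simp⟩
    · rw [uIcc_of_gt h] at hD hu
      obtain ⟨c, hc, hc'⟩ := exists_hasDerivAt_eq_slope _ _ h
        (fun u hu' => (hD u hu').continuousAt.continuousWithinAt)
        (fun u hu' => hD u (Ioo_subset_Icc_self hu'))
      refine ⟨exp c, hu (Ioo_subset_Icc_self hc), ?_⟩
      rw [hc', exp_log h0, exp_log hlx, hlog]
      have : log l ≠ 0 := by intro h'; rw [hlog, h'] at h; linarith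
      rw [sub_add_cancel_right, div_neg, neg_mul, div_mul_cancel₀ _ this]
      ring
  choose! ξ hξ using hmv.exists_forall_of_atTop.choose_spec
  have hξtop : Tendsto ξ atTop atTop := by
    have : Tendsto (fun x => min x (l * x)) atTop atTop :=
      tendsto_atTop.2 fun b => by
        filter_upwards [eventually_ge_atTop b,
          (tendsto_id.const_mul_atTop hl).eventually (eventually_ge_atTop b)] with x h1 h2
        exact le_min h1 h2
    refine tendsto_atTop_mono' _ ?_ this
    filter_upwards [eventually_ge_atTop hmv.exists_forall_of_atTop.choose] with x hx
    exact (hξ x hx).1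
  refine ((hlim.comp hξtop).mul_const (log l)).congr' ?_
  filter_upwards [eventually_ge_atTop hmv.exists_forall_of_atTop.choose] with x hx
  exact (hξ x hx).2.symm

theorem uniform (hf : RegVary α f) (hm : Measurable f) {ε : ℝ} (hε : 0 < ε) :
    ∀ᶠ v in atTop, ∀ l ∈ Icc (1 / 2 : ℝ) 2,
      0 < f (l * v) ∧ |log (f (l * v)) - log (f v) - α * log l| ≤ ε := by
  set k : ℝ → ℝ := fun x => log (f (exp x)) - α * x with hk
  have hkm : Measurable k :=
    (measurable_log.comp (hm.comp measurable_exp)).sub (measurable_id.const_mul α)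
  have hlim : ∀ u : ℝ, Tendsto (fun x => k (x + u) - k x) atTop (nhds 0) := by
    intro u
    have h1 := ((hf.2 (exp u) (exp_pos u)).log (rpow_pos_of_pos (exp_pos u) _).ne').comp
      tendsto_exp_atTop
    rw [log_rpow (exp_pos u), log_exp] at h1
    have h2 := h1.sub_const (α * u)
    rw [sub_self] at h2
    refine h2.congr' ?_
    filter_upwards [tendsto_exp_atTop.eventually hf.1,
      ((tendsto_id.const_mul_atTop (exp_pos u)).comp tendsto_exp_atTop).eventually hf.1]
      with x p1 p2
    simp only [Function.comp, _root_.id] at p2 ⊢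
    rw [log_div p2.ne' p1.ne', ← exp_add, add_comm u x]
    simp only [hk]
    ring
  have hU := tendsto_log_atTop.eventually (uniform_convergence_additive hkm hlim hε)
  obtain ⟨X, hX⟩ := eventually_atTop.1 hf.1
  filter_upwards [hU, eventually_ge_atTop (2 * X), eventually_gt_atTop 0] with v hv hvX hv0 l hl
  have hl0 : 0 < l := by linarith [hl.1]
  refine ⟨hX _ (by nlinarith [hl.1]), ?_⟩
  have hlog : log l ∈ Icc (-1 : ℝ) 1 := by
    have h2 : log 2 ≤ 1 := by linarith [log_two_lt_d9]
    have a := log_le_log hl0 hl.2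
    have b := log_le_log (by norm_num) hl.1
    rw [one_div, log_inv] at b
    exact ⟨by linarith, by linarith⟩
  have := hv (log l) hlog
  simp only [hk] at this
  rw [exp_add, exp_log hv0, exp_log hl0, mul_comm v l] at this
  convert this using 2
  ring

theorem bounds (hf : RegVary α f) (hm : Measurable f) :
    ∃ c C : ℝ, 0 < c ∧ 0 < C ∧ ∀ᶠ v in atTop, 0 < f v ∧ ∀ l ∈ Icc (1 / 2 : ℝ) 2,
      c * f v ≤ f (l * v) ∧ f (l * v) ≤ C * f v := by
  refine ⟨exp (-(|α| + 1)), exp (|α| + 1), exp_pos _, exp_pos _, ?_⟩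
  filter_upwards [hf.uniform hm one_pos, hf.1] with v hv hv0
  refine ⟨hv0, fun l hl => ?_⟩
  obtain ⟨hp, hb⟩ := hv l hl
  have hl0 : 0 < l := by linarith [hl.1]
  have hlog : |log l| ≤ 1 := by
    have h2 : log 2 ≤ 1 := by linarith [log_two_lt_d9]
    have a := log_le_log hl0 hl.2
    have b := log_le_log (by norm_num) hl.1
    rw [one_div, log_inv] at b
    exact abs_le.2 ⟨by linarith, by linarith⟩
  have hα : |α * log l| ≤ |α| := by
    rw [abs_mul]; exact mul_le_of_le_one_right (abs_nonneg _) hlog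
  rw [abs_le] at hb hα
  constructor
  · rw [← exp_log hp]
    nth_rw 1 [← exp_log hv0]
    rw [← exp_add]
    exact exp_le_exp.2 (by linarith)
  · rw [← exp_log hp]
    nth_rw 1 [← exp_log hv0]
    rw [← exp_add]
    exact exp_le_exp.2 (by linarith)

theorem near_one (hf : RegVary α f) (hm : Measurable f) {ε : ℝ} (hε : 0 < ε) :
    ∃ ρ : ℝ, 0 < ρ ∧ ρ ≤ 1 / 2 ∧ ∀ᶠ v in atTop, ∀ l ∈ Icc (1 - ρ) (1 + ρ),
      |f (l * v) / f v - 1| ≤ ε := by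
  have hc : ContinuousAt exp 0 := continuous_exp.continuousAt
  obtain ⟨η, hη, hexp⟩ := Metric.continuousAt_iff.1 hc ε hε
  have hc2 : Tendsto (fun l => α * log l) (nhds 1) (nhds 0) := by
    have : ContinuousAt (fun l => α * log l) 1 :=
      continuousAt_const.mul (continuousAt_log one_ne_zero)
    simpa using this.tendsto
  obtain ⟨r, hr, hr'⟩ := Metric.tendsto_nhds_nhds.1 hc2 (η / 2) (by positivity)
  refine ⟨min (r / 2) (1 / 2), by positivity, min_le_right _ _, ?_⟩
  filter_upwards [hf.uniform hm (ε := η / 4) (by positivity), hf.1] with v hv hv0 l hl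
  have m1 := min_le_left (r / 2) (1 / 2 : ℝ)
  have m2 := min_le_right (r / 2) (1 / 2 : ℝ)
  obtain ⟨hp, hb⟩ := hv l ⟨by linarith [hl.1], by linarith [hl.2]⟩
  have h1 := @hr' l (by rw [Real.dist_eq, abs_lt]; constructor <;> linarith [hl.1, hl.2])
  rw [Real.dist_eq, sub_zero] at h1
  have h2 : |log (f (l * v)) - log (f v)| < η := by
    have := abs_add_le (log (f (l * v)) - log (f v) - α * log l) (α * log l)
    rw [sub_add_cancel] at this
    linarith
  have h3 := @hexp (log (f (l * v)) - log (f v)) (by rwa [Real.dist_eq, sub_zero])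
  rw [Real.dist_eq, exp_zero, exp_sub, exp_log hp, exp_log hv0] at h3
  exact h3.le

theorem tendsto_zero_s2 (hf : RegVary α f) (hm : Measurable f) (hα : α < 0) :
    Tendsto f atTop (nhds 0) := by
  obtain ⟨c0, hc0, hc1, h2⟩ : ∃ r : ℝ, 0 < r ∧ r < 1 ∧
      ∀ᶠ v in atTop, ∀ l ∈ Icc (1 : ℝ) 2, f (2 * (l * v)) ≤ r * f (l * v) := by
    refine ⟨((2 : ℝ) ^ α + 1) / 2, by positivity, ?_, ?_⟩
    · linarith [rpow_lt_one_of_one_lt_of_neg (by norm_num : (1 : ℝ) < 2) hα]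
    · have hlt : (2 : ℝ) ^ α < ((2 : ℝ) ^ α + 1) / 2 := by
        linarith [rpow_lt_one_of_one_lt_of_neg (by norm_num : (1 : ℝ) < 2) hα]
      have h1 := (hf.2 2 two_pos).eventually (gt_mem_nhds hlt)
      obtain ⟨X, hX⟩ := eventually_atTop.1 (h1.and hf.1)
      filter_upwards [eventually_ge_atTop X, eventually_ge_atTop 0] with v hv hv0 l hl
      obtain ⟨a, b⟩ := hX (l * v) (by nlinarith [hl.1])
      rw [div_lt_iff₀ b] at a
      exact a.le
  obtain ⟨c, C, _, hC, hb⟩ := hf.bounds hm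
  obtain ⟨V, hV⟩ := eventually_atTop.1 (h2.and (hb.and (hf.1.and (eventually_gt_atTop 0))))
  have hV0 : 0 < V := (hV V le_rfl).2.2.2
  have hfV : 0 < f V := (hV V le_rfl).2.2.1
  have hstep : ∀ n : ℕ, ∀ l ∈ Icc (1 : ℝ) 2, f (l * (2 ^ n * V)) ≤ c0 ^ n * (C * f V) := by
    intro n
    induction n with
    | zero =>
      intro l hl
      simpa using ((hV V le_rfl).2.1.2 l ⟨by linarith [hl.1], hl.2⟩).2
    | succ n ih =>
      intro l hl
      have h1 : V ≤ 2 ^ n * V := le_mul_of_one_le_left hV0.le (one_le_pow₀ (by norm_num))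
      have := (hV _ h1).1 l hl
      rw [show l * (2 ^ (n + 1) * V) = 2 * (l * (2 ^ n * V)) by ring]
      refine this.trans ?_
      rw [pow_succ', mul_assoc]
      exact mul_le_mul_of_nonneg_left (ih l hl) hc0.le
  rw [Metric.tendsto_nhds]
  intro ε hε
  obtain ⟨n, hn⟩ := exists_pow_lt_of_lt_one (div_pos hε (mul_pos hC hfV)) hc1
  rw [lt_div_iff₀ (mul_pos hC hfV)] at hn
  filter_upwards [eventually_ge_atTop (2 ^ n * V), eventually_ge_atTop V] with x hx hxV
  have hx0 : 0 < f x := (hV x hxV).2.2.1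
  have hxp : 1 ≤ x / V := (one_le_div hV0).2 hxV
  obtain ⟨m, hm1, hm2⟩ := exists_nat_pow_near hxp (by norm_num : (1 : ℝ) < 2)
  rw [le_div_iff₀ hV0] at hm1
  rw [div_lt_iff₀ hV0] at hm2
  have hnm : n ≤ m := by
    by_contra! hlt
    have : (2 : ℝ) ^ (m + 1) * V ≤ 2 ^ n * V :=
      mul_le_mul_of_nonneg_right (pow_le_pow_right₀ (by norm_num) hlt) hV0.le
    linarith
  have hmV : 0 < 2 ^ m * V := by positivity
  have := hstep m (x / (2 ^ m * V)) ⟨(one_le_div hmV).2 hm1, by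
    rw [div_le_iff₀ hmV]; rw [pow_succ] at hm2; linarith⟩
  rw [div_mul_cancel₀ _ hmV.ne'] at this
  rw [Real.dist_eq, sub_zero, abs_of_pos hx0]
  refine this.trans_lt (lt_of_le_of_lt ?_ hn)
  exact mul_le_mul_of_nonneg_right (pow_le_pow_of_le_one hc0.le hc1.le hnm) (by positivity)

theorem tendsto_atTop (hf : RegVary α f) (hm : Measurable f) (hα : 0 < α) :
    Tendsto f atTop atTop := by
  have h := hf.inv.tendsto_zero_s2 hm.inv (neg_lt_zero.2 hα)
  have h2 : Tendsto (fun x => (f x)⁻¹) atTop (nhdsWithin 0 (Ioi 0)) :=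
    tendsto_nhdsWithin_iff.2 ⟨h, hf.inv.1⟩
  exact h2.inv_tendsto_nhdsGT_zero.congr fun x => inv_inv (f x)

end RegVary

theorem exists_exp_neg_mul_sq_le {c : ℝ} (hc : 0 < c) (n : ℕ) :
    ∃ C : ℝ, 0 < C ∧ ∀ z : ℝ, exp (-c * z ^ 2) ≤ C * ((1 + z ^ 2) ^ n)⁻¹ := by
  refine ⟨exp c * (n.factorial / c ^ n), by positivity, fun z => ?_⟩
  have h := pow_div_factorial_le_exp (x := c * (1 + z ^ 2)) (by positivity) n
  have hp : 0 < (1 + z ^ 2) ^ n := by positivity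
  have e1 : exp (-c * z ^ 2) = exp c * (exp (c * (1 + z ^ 2)))⁻¹ := by
    rw [← exp_neg, ← exp_add]; ring_nf
  rw [e1, mul_assoc]
  refine mul_le_mul_of_nonneg_left ?_ (exp_pos _).le
  have hf : (0 : ℝ) < n.factorial := by exact_mod_cast n.factorial_pos
  rw [mul_pow] at h
  calc (exp (c * (1 + z ^ 2)))⁻¹ ≤ (c ^ n * (1 + z ^ 2) ^ n / n.factorial)⁻¹ :=
        inv_anti₀ (by positivity) h
    _ = _ := by field_simp

theorem abs_pow_le_one_add_sq_pow (z : ℝ) (k : ℕ) : |z| ^ k ≤ (1 + z ^ 2) ^ k := by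
  refine pow_le_pow_left₀ (abs_nonneg _) ?_ k
  nlinarith [sq_nonneg (|z| - 1), sq_abs z]

theorem integrable_pow_mul_of_decay {f : ℝ → ℝ} {B : ℝ} {k : ℕ} (hk : k ≤ 3)
    (hf : AEStronglyMeasurable f volume)
    (hB : ∀ᵐ z : ℝ, |f z| ≤ B * ((1 + z ^ 2) ^ 5)⁻¹) :
    Integrable (fun z => z ^ k * f z) := by
  refine ((integrable_inv_one_add_sq).const_mul |B|).mono'
    ((continuous_pow k).aestronglyMeasurable.mul hf) ?_
  filter_upwards [hB] with z hz
  rw [norm_mul, norm_pow, Real.norm_eq_abs, Real.norm_eq_abs]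
  have h1 : (1 : ℝ) ≤ 1 + z ^ 2 := by nlinarith [sq_nonneg z]
  calc |z| ^ k * |f z| ≤ (1 + z ^ 2) ^ 4 * (|B| * ((1 + z ^ 2) ^ 5)⁻¹) := by
        refine mul_le_mul ((abs_pow_le_one_add_sq_pow z k).trans
          (pow_le_pow_right₀ h1 (by omega))) (hz.trans ?_) (abs_nonneg _) (by positivity)
        exact mul_le_mul_of_nonneg_right (le_abs_self B) (by positivity)
    _ = |B| * (1 + z ^ 2)⁻¹ := by
        have : (1 + z ^ 2) ≠ 0 := by positivity
        field_simp

theorem integrable_pow_mul_gaussian (n : ℕ) :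
    Integrable (fun z : ℝ => z ^ n * exp (-z ^ 2 / 2)) := by
  have h := integrable_rpow_mul_exp_neg_mul_sq (b := 1 / 2) (by norm_num) (s := (n : ℝ))
    (by have : (0 : ℝ) ≤ n := n.cast_nonneg
        linarith)
  refine h.congr (Eventually.of_forall fun z => ?_)
  simp only [rpow_natCast]
  congr 2
  ring

theorem integral_pow_mul_gaussian_add_two (n : ℕ) :
    ∫ z : ℝ, z ^ (n + 2) * exp (-z ^ 2 / 2) = (n + 1) * ∫ z : ℝ, z ^ n * exp (-z ^ 2 / 2) := by
  have h := integral_eq_zero_of_hasDerivAt_of_integrable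
    (f := fun z : ℝ => z ^ (n + 1) * exp (-z ^ 2 / 2))
    (f' := fun z : ℝ => (n + 1) * (z ^ n * exp (-z ^ 2 / 2)) - z ^ (n + 2) * exp (-z ^ 2 / 2))
    (fun z => by
      have h1 : HasDerivAt (fun z : ℝ => -z ^ 2 / 2) (-z) z := by
        refine (((hasDerivAt_pow 2 z).neg).div_const 2).congr_deriv ?_
        push_cast
        ring
      refine ((hasDerivAt_pow (n + 1) z).mul h1.exp).congr_deriv ?_
      push_cast
      ring)
    (((integrable_pow_mul_gaussian n).const_mul _).sub (integrable_pow_mul_gaussian _))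
    (integrable_pow_mul_gaussian _)
  rw [integral_sub ((integrable_pow_mul_gaussian n).const_mul _) (integrable_pow_mul_gaussian _),
    integral_const_mul] at h
  linarith

theorem integral_id_mul_gaussian : ∫ z : ℝ, z ^ 1 * exp (-z ^ 2 / 2) = 0 := by
  have h := integral_neg_eq_self (fun z : ℝ => z ^ 1 * exp (-z ^ 2 / 2)) volume
  simp only [pow_one, even_two, Even.neg_pow, neg_mul, integral_neg] at h ⊢
  linarith

theorem integral_one_mul_gaussian :
    ∫ z : ℝ, z ^ 0 * exp (-z ^ 2 / 2) = √(2 * π) := by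
  have h := integral_gaussian (1 / 2)
  rw [show π / (1 / 2) = 2 * π by ring] at h
  rw [← h]
  congr 1
  ext z
  rw [pow_zero, one_mul]
  congr 1
  ring

theorem exists_exp_neg_mul_le_of_le_abs {c : ℝ} (hc : 0 < c) (N : ℕ) :
    ∃ B : ℝ, 0 < B ∧ ∀ Z z d : ℝ, 1 ≤ Z → Z ≤ |z| → 1 ≤ d * Z ^ N →
      exp (-(c * (Z * |z|))) ≤ d * (B * ((1 + z ^ 2) ^ 5)⁻¹) := by
  set n := N + 10
  have hf : (0 : ℝ) < n.factorial := by exact_mod_cast n.factorial_pos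
  refine ⟨n.factorial / c ^ n * 32, by positivity, fun Z z d hZ hz hd => ?_⟩
  have hZ0 : 0 < Z := by linarith
  have hz1 : 1 ≤ |z| := hZ.trans hz
  have hz0 : 0 < |z| := by linarith
  have hd0 : 0 < d := by
    by_contra! h
    have := mul_nonpos_of_nonpos_of_nonneg h (pow_pos hZ0 N).le
    linarith
  have h := pow_div_factorial_le_exp (x := c * (Z * |z|)) (by positivity) n
  rw [exp_neg]
  have hsq : 1 + z ^ 2 ≤ 2 * |z| ^ 2 := by rw [sq_abs]; nlinarith [sq_abs z]
  have h5 : (1 + z ^ 2) ^ 5 ≤ 32 * |z| ^ 10 := by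
    calc (1 + z ^ 2) ^ 5 ≤ (2 * |z| ^ 2) ^ 5 := pow_le_pow_left₀ (by positivity) hsq 5
      _ = 32 * |z| ^ 10 := by ring
  have hZn : Z ^ N * |z| ^ 10 ≤ (Z * |z|) ^ n := by
    rw [mul_pow]
    exact mul_le_mul (pow_le_pow_right₀ hZ (by omega)) (pow_le_pow_right₀ hz1 (by omega))
      (by positivity) (by positivity)
  calc (exp (c * (Z * |z|)))⁻¹ ≤ ((c * (Z * |z|)) ^ n / n.factorial)⁻¹ :=
        inv_anti₀ (by positivity) h
    _ = n.factorial / c ^ n * ((Z * |z|) ^ n)⁻¹ := by rw [mul_pow]; field_simp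
    _ ≤ n.factorial / c ^ n * (d * (32 * ((1 + z ^ 2) ^ 5)⁻¹)) := by
        refine mul_le_mul_of_nonneg_left ?_ (by positivity)
        rw [inv_le_iff_one_le_mul₀ (by positivity)]
        calc (1 : ℝ) ≤ (d * Z ^ N) * ((32 * |z| ^ 10) * ((1 + z ^ 2) ^ 5)⁻¹) := by
              refine one_le_mul_of_one_le_of_one_le hd ?_
              rw [← div_eq_mul_inv, one_le_div (by positivity)]
              exact h5
          _ = d * (32 * ((1 + z ^ 2) ^ 5)⁻¹) * (Z ^ N * |z| ^ 10) := by ring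
          _ ≤ _ := mul_le_mul_of_nonneg_left hZn (by positivity)
    _ = _ := by ring

section PerturbedGaussian

variable {w : ℝ → ℝ → ℝ} {δ Z : ℝ → ℝ} {N : ℕ} {c C : ℝ}

/-- A uniform bound of order `δ` between a perturbed Gaussian weight and the Gaussian weight. -/
theorem exists_sub_gaussian_le (hc : 0 < c) (hC : 0 ≤ C) (hZ : Tendsto Z atTop atTop)
    (hN : ∀ᶠ v in atTop, 1 ≤ |δ v| * Z v ^ N)
    (hin : ∀ᶠ v in atTop, ∀ᵐ z : ℝ, |z| ≤ Z v →
      |w v z - exp (-z ^ 2 / 2)| ≤ C * |δ v| * ((1 + |z| ^ 3) * exp (-c * z ^ 2)))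
    (hout : ∀ᶠ v in atTop, ∀ᵐ z : ℝ, Z v < |z| → |w v z| ≤ C * exp (-(c * (Z v * |z|)))) :
    ∃ B : ℝ, ∀ᶠ v in atTop, ∀ᵐ z : ℝ,
      |w v z - exp (-z ^ 2 / 2)| ≤ |δ v| * (B * ((1 + z ^ 2) ^ 5)⁻¹) := by
  obtain ⟨B1, hB1, h1⟩ := exists_exp_neg_mul_sq_le hc 8
  obtain ⟨B2, hB2, h2⟩ := exists_exp_neg_mul_le_of_le_abs hc N
  obtain ⟨B3, hB3, h3⟩ := exists_exp_neg_mul_le_of_le_abs (c := 1 / 2) (by norm_num) N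
  refine ⟨C * (2 * B1) + (C * B2 + B3), ?_⟩
  filter_upwards [hZ.eventually (eventually_ge_atTop 1), hN, hin, hout] with v hZ1 hNv hi ho
  filter_upwards [hi, ho] with z hiz hoz
  have hq : 0 < ((1 + z ^ 2) ^ 5)⁻¹ := by positivity
  rcases le_or_gt |z| (Z v) with h | h
  · have hsq : (1 : ℝ) ≤ 1 + z ^ 2 := by nlinarith [sq_nonneg z]
    have h13 : 1 + |z| ^ 3 ≤ 2 * (1 + z ^ 2) ^ 3 := by
      have := abs_pow_le_one_add_sq_pow z 3
      have := one_le_pow₀ hsq (n := 3)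
      linarith
    have hb : (1 + |z| ^ 3) * exp (-c * z ^ 2) ≤ 2 * B1 * ((1 + z ^ 2) ^ 5)⁻¹ := by
      calc (1 + |z| ^ 3) * exp (-c * z ^ 2)
          ≤ (2 * (1 + z ^ 2) ^ 3) * (B1 * ((1 + z ^ 2) ^ 8)⁻¹) :=
            mul_le_mul h13 (h1 z) (exp_pos _).le (by positivity)
        _ = _ := by
            have : (1 + z ^ 2) ≠ 0 := by positivity
            field_simp
    calc _ ≤ C * |δ v| * ((1 + |z| ^ 3) * exp (-c * z ^ 2)) := hiz h
      _ ≤ C * |δ v| * (2 * B1 * ((1 + z ^ 2) ^ 5)⁻¹) :=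
          mul_le_mul_of_nonneg_left hb (by positivity)
      _ = |δ v| * (C * (2 * B1) * ((1 + z ^ 2) ^ 5)⁻¹) := by ring
      _ ≤ _ := by
          refine mul_le_mul_of_nonneg_left (mul_le_mul_of_nonneg_right ?_ hq.le) (abs_nonneg _)
          have : 0 ≤ C * B2 + B3 := by positivity
          linarith
  · have hg : exp (-z ^ 2 / 2) ≤ exp (-(1 / 2 * (Z v * |z|))) := by
      refine exp_le_exp.2 ?_
      have : Z v * |z| ≤ |z| * |z| := mul_le_mul_of_nonneg_right h.le (abs_nonneg _)
      rw [abs_mul_abs_self] at this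
      nlinarith
    calc |w v z - exp (-z ^ 2 / 2)| ≤ |w v z| + |exp (-z ^ 2 / 2)| := abs_sub _ _
      _ ≤ C * exp (-(c * (Z v * |z|))) + exp (-(1 / 2 * (Z v * |z|))) := by
          rw [abs_of_pos (exp_pos _)]
          exact add_le_add (hoz h) hg
      _ ≤ C * (|δ v| * (B2 * ((1 + z ^ 2) ^ 5)⁻¹)) + |δ v| * (B3 * ((1 + z ^ 2) ^ 5)⁻¹) :=
          add_le_add (mul_le_mul_of_nonneg_left (h2 _ _ _ hZ1 h.le hNv) hC)
            (h3 _ _ _ hZ1 h.le hNv)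
      _ = |δ v| * ((C * B2 + B3) * ((1 + z ^ 2) ^ 5)⁻¹) := by ring
      _ ≤ _ := by
          refine mul_le_mul_of_nonneg_left (mul_le_mul_of_nonneg_right ?_ hq.le) (abs_nonneg _)
          have : 0 ≤ C * (2 * B1) := by positivity
          linarith

/-- First order expansion of the moments of a perturbed Gaussian weight. -/
theorem tendsto_moment_sub_gaussian_div {k : ℕ} (hk : k ≤ 3) {B : ℝ}
    (hw : ∀ᶠ v in atTop, AEStronglyMeasurable (w v) volume) (hδ : ∀ᶠ v in atTop, δ v ≠ 0)
    (hB : ∀ᶠ v in atTop, ∀ᵐ z : ℝ,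
      |w v z - exp (-z ^ 2 / 2)| ≤ |δ v| * (B * ((1 + z ^ 2) ^ 5)⁻¹))
    (hlim : ∀ z : ℝ, z ≠ 0 → Tendsto (fun v => (w v z - exp (-z ^ 2 / 2)) / δ v) atTop
      (nhds (-z ^ 3 / 6 * exp (-z ^ 2 / 2)))) :
    (∀ᶠ v in atTop, Integrable (fun z => z ^ k * w v z)) ∧
    Tendsto (fun v => ((∫ z, z ^ k * w v z) - ∫ z : ℝ, z ^ k * exp (-z ^ 2 / 2)) / δ v) atTop
      (nhds (-(∫ z : ℝ, z ^ (k + 3) * exp (-z ^ 2 / 2)) / 6)) := by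
  have hgc : Continuous (fun z : ℝ => exp (-z ^ 2 / 2)) := by fun_prop
  have hInt : ∀ᶠ v in atTop, Integrable (fun z => z ^ k * (w v z - exp (-z ^ 2 / 2))) := by
    filter_upwards [hw, hB] with v hwv hBv
    refine integrable_pow_mul_of_decay (B := |δ v| * B) hk
      (hwv.sub hgc.aestronglyMeasurable) ?_
    filter_upwards [hBv] with z hz
    rwa [mul_assoc]
  have hwint : ∀ᶠ v in atTop, Integrable (fun z => z ^ k * w v z) := by
    filter_upwards [hInt] with v hv
    refine (hv.add (integrable_pow_mul_gaussian k)).congr (Eventually.of_forall fun z => ?_)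
    simp only [Pi.add_apply]
    ring
  refine ⟨hwint, ?_⟩
  have hlimit : Tendsto (fun v => ∫ z, z ^ k * ((w v z - exp (-z ^ 2 / 2)) / δ v)) atTop
      (nhds (∫ z : ℝ, z ^ k * (-z ^ 3 / 6 * exp (-z ^ 2 / 2)))) := by
    refine tendsto_integral_filter_of_dominated_convergence
      (fun z => |z ^ k * (B * ((1 + z ^ 2) ^ 5)⁻¹)|) ?_ ?_ ?_ ?_
    · filter_upwards [hw] with v hwv
      exact (continuous_pow k).aestronglyMeasurable.mul
        ((hwv.sub hgc.aestronglyMeasurable).mul_const (δ v)⁻¹)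
    · filter_upwards [hB, hδ] with v hBv hδv
      filter_upwards [hBv] with z hz
      rw [norm_mul, abs_mul, Real.norm_eq_abs, Real.norm_eq_abs]
      refine mul_le_mul_of_nonneg_left ?_ (abs_nonneg _)
      rw [abs_div, div_le_iff₀ (abs_pos.2 hδv), mul_comm]
      exact hz.trans (mul_le_mul_of_nonneg_left (le_abs_self _) (abs_nonneg _))
    · refine (integrable_pow_mul_of_decay (B := |B|) hk (f := fun z => B * ((1 + z ^ 2) ^ 5)⁻¹)
        ?_ (Eventually.of_forall fun z => ?_)).norm
      · exact (Measurable.aestronglyMeasurable (by fun_prop))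
      · rw [abs_mul, abs_of_pos (by positivity : (0 : ℝ) < ((1 + z ^ 2) ^ 5)⁻¹)]
    · have h0 : ∀ᵐ z : ℝ, z ≠ 0 := Measure.ae_ne volume 0
      filter_upwards [h0] with z hz
      exact (hlim z hz).const_mul _
  have e : ∫ z : ℝ, z ^ k * (-z ^ 3 / 6 * exp (-z ^ 2 / 2)) =
      -(∫ z : ℝ, z ^ (k + 3) * exp (-z ^ 2 / 2)) / 6 := by
    rw [neg_div, ← integral_div, ← integral_neg]
    congr 1
    ext z
    ring
  rw [e] at hlimit
  refine hlimit.congr' ?_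
  filter_upwards [hwint] with v hv
  rw [← integral_sub hv (integrable_pow_mul_gaussian k), ← integral_div]
  congr 1
  ext z
  ring

/-- The third cumulant of a perturbed Gaussian weight is `-δ (1 + o(1))`. -/
theorem tendsto_third_cumulant_div {B : ℝ}
    (hw : ∀ᶠ v in atTop, AEStronglyMeasurable (w v) volume) (hδ : ∀ᶠ v in atTop, δ v ≠ 0)
    (hδ0 : Tendsto δ atTop (nhds 0))
    (hB : ∀ᶠ v in atTop, ∀ᵐ z : ℝ,
      |w v z - exp (-z ^ 2 / 2)| ≤ |δ v| * (B * ((1 + z ^ 2) ^ 5)⁻¹))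
    (hlim : ∀ z : ℝ, z ≠ 0 → Tendsto (fun v => (w v z - exp (-z ^ 2 / 2)) / δ v) atTop
      (nhds (-z ^ 3 / 6 * exp (-z ^ 2 / 2)))) :
    Tendsto (fun v => ((∫ z, z ^ 3 * w v z) / (∫ z, z ^ 0 * w v z)
      - 3 * (∫ z, z ^ 2 * w v z) * (∫ z, z ^ 1 * w v z) / (∫ z, z ^ 0 * w v z) ^ 2
      + 2 * (∫ z, z ^ 1 * w v z) ^ 3 / (∫ z, z ^ 0 * w v z) ^ 3) / δ v) atTop (nhds (-1)) := by
  have g0 := integral_one_mul_gaussian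
  have g1 := integral_id_mul_gaussian
  have g2 := integral_pow_mul_gaussian_add_two 0
  have g3 := integral_pow_mul_gaussian_add_two 1
  have g4 := integral_pow_mul_gaussian_add_two 2
  have g5 := integral_pow_mul_gaussian_add_two 3
  have g6 := integral_pow_mul_gaussian_add_two 4
  norm_num only at g2 g3 g4 g5 g6
  have m0 := (tendsto_moment_sub_gaussian_div (k := 0) (by norm_num) hw hδ hB hlim).2
  have m1 := (tendsto_moment_sub_gaussian_div (k := 1) (by norm_num) hw hδ hB hlim).2
  have m2 := (tendsto_moment_sub_gaussian_div (k := 2) (by norm_num) hw hδ hB hlim).2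
  have m3 := (tendsto_moment_sub_gaussian_div (k := 3) (by norm_num) hw hδ hB hlim).2
  norm_num only at m0 m1 m2 m3
  rw [g3, g1] at m0 m3
  rw [g4, g2, g0, g1] at m1
  rw [g5, g3, g2, g1, g0] at m2
  rw [g6, g4, g2, g0, mul_zero] at m3
  rw [g0] at m0
  set s := √(2 * π) with hs
  have hs0 : 0 < s := by positivity
  set A0 := fun v => ∫ z, z ^ 0 * w v z with hA0
  set A1 := fun v => ∫ z, z ^ 1 * w v z with hA1
  set A2 := fun v => ∫ z, z ^ 2 * w v z with hA2
  set A3 := fun v => ∫ z, z ^ 3 * w v z with hA3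
  have l0 : Tendsto A0 atTop (nhds s) := by
    have := (m0.mul hδ0).add_const s
    rw [mul_zero, zero_add] at this
    refine this.congr' ?_
    filter_upwards [hδ] with v hv
    rw [div_mul_cancel₀ _ hv, sub_add_cancel]
  have l2 : Tendsto A2 atTop (nhds s) := by
    have := (m2.mul hδ0).add_const s
    rw [mul_zero, zero_add] at this
    refine this.congr' ?_
    filter_upwards [hδ] with v hv
    rw [div_mul_cancel₀ _ hv, one_mul, sub_add_cancel]
  have l1 : Tendsto A1 atTop (nhds 0) := by
    have := m1.mul hδ0
    rw [mul_zero] at this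
    refine this.congr' ?_
    filter_upwards [hδ] with v hv
    rw [div_mul_cancel₀ _ hv, sub_zero]
  have r : Tendsto (fun v => ((A3 v - 0) / δ v) / A0 v
      - 3 * A2 v * ((A1 v - 0) / δ v) / A0 v ^ 2
      + 2 * ((A1 v - 0) / δ v) * A1 v ^ 2 / A0 v ^ 3) atTop (nhds (-1)) := by
    have t1 := m3.div l0 hs0.ne'
    have t2 := ((l2.const_mul 3).mul m1).div (l0.pow 2) (pow_pos hs0 2).ne'
    have t3 := ((m1.const_mul 2).mul (l1.pow 2)).div (l0.pow 3) (pow_pos hs0 3).ne'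
    have := (t1.sub t2).add t3
    rw [show -(5 * (3 * (1 * s))) / 6 / s - 3 * s * (-(3 * (1 * s)) / 6) / s ^ 2
      + 2 * (-(3 * (1 * s)) / 6) * 0 ^ 2 / s ^ 3 = -1 by field_simp; ring] at this
    exact this
  refine r.congr' ?_
  filter_upwards [hδ] with v hv
  simp only [sub_zero]
  ring

end PerturbedGaussian

section Cumulant

variable {p : ℝ → ℝ}

theorem aemeasurable_of_integrable_exp_mul_density
    (hInt : ∀ t > (0 : ℝ), Integrable (fun x => exp (t * x) * p x)) : AEMeasurable p := by
  have h := (hInt 1 one_pos).aemeasurable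
  have h2 : AEMeasurable (fun x : ℝ => exp (-(1 * x)) * (exp (1 * x) * p x)) :=
    (Measurable.aemeasurable (by fun_prop)).mul h
  refine h2.congr (Eventually.of_forall fun x => ?_)
  simp only
  rw [← mul_assoc, ← exp_add, neg_add_cancel, exp_zero, one_mul]

theorem integrable_and_hasDerivAt_exponential_moment (hp : ∀ x, 0 ≤ p x)
    (hInt : ∀ t > (0 : ℝ), Integrable (fun x => exp (t * x) * p x)) {t : ℝ} (ht : 0 < t) (n : ℕ) :
    Integrable (fun x => x ^ n * (exp (t * x) * p x)) ∧
    HasDerivAt (fun t => ∫ x, x ^ n * (exp (t * x) * p x))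
      (∫ x, x ^ (n + 1) * (exp (t * x) * p x)) t := by
  have hm := aemeasurable_of_integrable_exp_mul_density hInt
  have hme : AEMeasurable (fun x => ENNReal.ofReal (p x)) := hm.ennreal_ofReal
  have hfin : ∀ᵐ x : ℝ, ENNReal.ofReal (p x) < ⊤ :=
    Eventually.of_forall fun x => ENNReal.ofReal_lt_top
  set μ : Measure ℝ := volume.withDensity (fun x => ENNReal.ofReal (p x)) with hμ
  have hI : ∀ f : ℝ → ℝ, Integrable f μ ↔ Integrable (fun x => f x * p x) := by
    intro f
    rw [hμ, integrable_withDensity_iff_integrable_smul₀' hme hfin]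
    refine integrable_congr (Eventually.of_forall fun x => ?_)
    simp [ENNReal.toReal_ofReal (hp x), mul_comm]
  have hE : ∀ f : ℝ → ℝ, ∫ x, f x ∂μ = ∫ x, f x * p x := by
    intro f
    rw [hμ, integral_withDensity_eq_integral_toReal_smul₀ hme hfin]
    refine integral_congr_ae (Eventually.of_forall fun x => ?_)
    simp [ENNReal.toReal_ofReal (hp x), mul_comm]
  have hmem : t ∈ interior (integrableExpSet (fun x : ℝ => x) μ) := by
    refine mem_interior.2 ⟨Ioi 0, fun s hs => ?_, isOpen_Ioi, ht⟩
    exact (hI _).2 (hInt s hs)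
  constructor
  · have := (hI _).1 (integrable_pow_mul_exp_of_mem_interior_integrableExpSet hmem n)
    simpa [mul_assoc] using this
  · have := hasDerivAt_integral_pow_mul_exp_real hmem n
    simp only [hE] at this
    simpa only [mul_assoc] using this

theorem iteratedDeriv_three_log_exponential_moment (hp : ∀ x, 0 ≤ p x)
    (hInt : ∀ t > (0 : ℝ), Integrable (fun x => exp (t * x) * p x)) {Φ : ℝ → ℝ}
    (hΦ : ∀ t, Φ t = ∫ x, exp (t * x) * p x) (hpos : ∀ t > (0 : ℝ), 0 < Φ t) {t : ℝ} (ht : 0 < t) :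
    iteratedDeriv 3 (fun u => log (Φ u)) t =
      (∫ x, x ^ 3 * (exp (t * x) * p x)) / (∫ x, x ^ 0 * (exp (t * x) * p x))
      - 3 * (∫ x, x ^ 2 * (exp (t * x) * p x)) * (∫ x, x ^ 1 * (exp (t * x) * p x))
        / (∫ x, x ^ 0 * (exp (t * x) * p x)) ^ 2
      + 2 * (∫ x, x ^ 1 * (exp (t * x) * p x)) ^ 3
        / (∫ x, x ^ 0 * (exp (t * x) * p x)) ^ 3 := by
  set M : ℕ → ℝ → ℝ := fun n t => ∫ x, x ^ n * (exp (t * x) * p x) with hM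
  have hD : ∀ n, ∀ t > (0 : ℝ), HasDerivAt (M n) (M (n + 1) t) t := fun n t ht =>
    (integrable_and_hasDerivAt_exponential_moment hp hInt ht n).2
  have hΦM : Φ = M 0 := by
    ext t
    rw [hΦ]
    simp [hM]
  have hM0 : ∀ t > (0 : ℝ), M 0 t ≠ 0 := fun t ht => by rw [← hΦM]; exact (hpos t ht).ne'
  have d1 : ∀ t > (0 : ℝ), deriv (fun u => log (Φ u)) t = M 1 t / M 0 t := fun t ht => by
    rw [hΦM]
    exact ((hD 0 t ht).log (hM0 t ht)).deriv
  have d2 : ∀ t > (0 : ℝ), deriv (deriv (fun u => log (Φ u))) t =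
      (M 2 t * M 0 t - M 1 t * M 1 t) / M 0 t ^ 2 := fun t ht => by
    have he : deriv (fun u => log (Φ u)) =ᶠ[nhds t] fun t => M 1 t / M 0 t := by
      filter_upwards [lt_mem_nhds ht] with s hs using d1 s hs
    rw [he.deriv_eq]
    exact ((hD 1 t ht).div (hD 0 t ht) (hM0 t ht)).deriv
  have he : deriv (deriv (fun u => log (Φ u))) =ᶠ[nhds t]
      fun t => (M 2 t * M 0 t - M 1 t * M 1 t) / M 0 t ^ 2 := by
    filter_upwards [lt_mem_nhds ht] with s hs using d2 s hs
  rw [iteratedDeriv_succ, iteratedDeriv_succ, iteratedDeriv_one, he.deriv_eq]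
  have h0 := hM0 t ht
  have := ((((hD 2 t ht).mul (hD 0 t ht)).sub ((hD 1 t ht).mul (hD 1 t ht))).div
    ((hD 0 t ht).pow 2) (pow_ne_zero 2 h0)).deriv
  refine this.trans ?_
  change _ = M 3 t / M 0 t - 3 * M 2 t * M 1 t / M 0 t ^ 2 + 2 * M 1 t ^ 3 / M 0 t ^ 3
  simp only [Pi.mul_apply, Pi.sub_apply, Pi.pow_apply]
  norm_num only
  field_simp
  ring

/-- The third cumulant expressed through the rescaled weight `z ↦ K e^{t(x₀+σz)} p(x₀+σz)`. -/
theorem iteratedDeriv_three_log_rescaled (hp : ∀ x, 0 ≤ p x)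
    (hInt : ∀ t > (0 : ℝ), Integrable (fun x => exp (t * x) * p x)) {Φ : ℝ → ℝ}
    (hΦ : ∀ t, Φ t = ∫ x, exp (t * x) * p x) (hpos : ∀ t > (0 : ℝ), 0 < Φ t) {t : ℝ} (ht : 0 < t)
    (x₀ : ℝ) {σ K : ℝ} (hσ : 0 < σ) (hK : 0 < K) {w : ℝ → ℝ}
    (hw : ∀ z, w z = K * (exp (t * (x₀ + σ * z)) * p (x₀ + σ * z))) :
    iteratedDeriv 3 (fun u => log (Φ u)) t = σ ^ 3 *
      ((∫ z, z ^ 3 * w z) / (∫ z, z ^ 0 * w z)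
      - 3 * (∫ z, z ^ 2 * w z) * (∫ z, z ^ 1 * w z) / (∫ z, z ^ 0 * w z) ^ 2
      + 2 * (∫ z, z ^ 1 * w z) ^ 3 / (∫ z, z ^ 0 * w z) ^ 3) := by
  rw [iteratedDeriv_three_log_exponential_moment hp hInt hΦ hpos ht]
  set F : ℝ → ℝ := fun x => exp (t * x) * p x with hF
  have hI : ∀ n : ℕ, Integrable (fun x => x ^ n * F x) := fun n =>
    (integrable_and_hasDerivAt_exponential_moment hp hInt ht n).1
  have hA : ∀ k : ℕ, ∫ z, z ^ k * w z = K / σ * ∫ x, ((x - x₀) / σ) ^ k * F x := by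
    intro k
    have h1 := integral_add_left_eq_self (μ := volume) (fun x => ((x - x₀) / σ) ^ k * F x) x₀
    have h2 := Measure.integral_comp_mul_left
      (fun y => ((x₀ + y - x₀) / σ) ^ k * F (x₀ + y)) σ
    rw [h1, abs_of_pos (inv_pos.2 hσ), smul_eq_mul] at h2
    rw [div_mul_eq_mul_div, mul_div_assoc, ← inv_mul_eq_div, ← h2, ← integral_const_mul]
    refine integral_congr_ae (Eventually.of_forall fun z => ?_)
    simp only [hw, hF]
    rw [add_sub_cancel_left, mul_div_cancel_left₀ _ hσ.ne']
    ring
  have hM0 : (∫ x, x ^ 0 * F x) ≠ 0 := by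
    have := (hpos t ht).ne'
    rw [hΦ] at this
    simpa [hF] using this
  have hB0 : ∫ x, ((x - x₀) / σ) ^ 0 * F x = ∫ x, x ^ 0 * F x := by simp
  have hB1 : ∫ x, ((x - x₀) / σ) ^ 1 * F x =
      ((∫ x, x ^ 1 * F x) - x₀ * ∫ x, x ^ 0 * F x) / σ := by
    rw [← integral_const_mul, ← integral_sub (hI 1) ((hI 0).const_mul _), ← integral_div]
    exact integral_congr_ae (Eventually.of_forall fun x => by simp only; ring)
  have hB2 : ∫ x, ((x - x₀) / σ) ^ 2 * F x =
      ((∫ x, x ^ 2 * F x) - 2 * x₀ * (∫ x, x ^ 1 * F x) + x₀ ^ 2 * ∫ x, x ^ 0 * F x) / σ ^ 2 := by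
    have i1 : Integrable (fun x => x ^ 2 * F x - 2 * x₀ * (x ^ 1 * F x)) :=
      (hI 2).sub ((hI 1).const_mul _)
    rw [← integral_const_mul, ← integral_const_mul, ← integral_sub (hI 2) ((hI 1).const_mul _),
      ← integral_add i1 ((hI 0).const_mul _), ← integral_div]
    exact integral_congr_ae (Eventually.of_forall fun x => by simp only; ring)
  have hB3 : ∫ x, ((x - x₀) / σ) ^ 3 * F x =
      ((∫ x, x ^ 3 * F x) - 3 * x₀ * (∫ x, x ^ 2 * F x) + 3 * x₀ ^ 2 * (∫ x, x ^ 1 * F x)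
        - x₀ ^ 3 * ∫ x, x ^ 0 * F x) / σ ^ 3 := by
    have i1 : Integrable (fun x => x ^ 3 * F x - 3 * x₀ * (x ^ 2 * F x)) :=
      (hI 3).sub ((hI 2).const_mul _)
    have i2 : Integrable (fun x => x ^ 3 * F x - 3 * x₀ * (x ^ 2 * F x)
        + 3 * x₀ ^ 2 * (x ^ 1 * F x)) := i1.add ((hI 1).const_mul _)
    rw [← integral_const_mul, ← integral_const_mul, ← integral_const_mul,
      ← integral_sub (hI 3) ((hI 2).const_mul _), ← integral_add i1 ((hI 1).const_mul _),
      ← integral_sub i2 ((hI 0).const_mul _), ← integral_div]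
    exact integral_congr_ae (Eventually.of_forall fun x => by simp only; ring)
  rw [hA, hA, hA, hA, hB0, hB1, hB2, hB3]
  generalize (∫ x, x ^ 0 * F x) = m0 at *
  generalize (∫ x, x ^ 1 * F x) = m1
  generalize (∫ x, x ^ 2 * F x) = m2
  generalize (∫ x, x ^ 3 * F x) = m3
  field_simp
  ring

end Cumulant

theorem exists_taylor_two {f f' f'' : ℝ → ℝ} {x y : ℝ}
    (h0 : ∀ s ∈ uIcc x y, HasDerivAt f (f' s) s)
    (h1 : ∀ s ∈ uIcc x y, HasDerivAt f' (f'' s) s) :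
    ∃ ξ ∈ uIcc x y, f y - f x - f' x * (y - x) = f'' ξ * (y - x) ^ 2 / 2 := by
  set F : ℝ → ℝ := fun s => f s + f' s * (y - s) with hF
  have hFd : ∀ s ∈ uIcc x y, HasDerivAt F (f'' s * (y - s)) s := by
    intro s hs
    have := (h0 s hs).add ((h1 s hs).mul ((hasDerivAt_id s).const_sub y))
    refine this.congr_deriv ?_
    simp only [id]
    ring
  have hKd : ∀ s, HasDerivAt (fun s => (y - s) ^ 2 / 2) (-(y - s)) s := by
    intro s
    refine ((((hasDerivAt_id s).const_sub y).pow 2).div_const 2).congr_deriv ?_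
    simp only [id]
    push_cast
    ring
  rcases lt_trichotomy x y with h | h | h
  · rw [uIcc_of_lt h] at *
    obtain ⟨c, hc, he⟩ := exists_ratio_hasDerivAt_eq_ratio_slope F _ h
      (fun s hs => (hFd s hs).continuousAt.continuousWithinAt)
      (fun s hs => hFd s (Ioo_subset_Icc_self hs)) (fun s => (y - s) ^ 2 / 2) _
      (fun s _ => (hKd s).continuousAt.continuousWithinAt) (fun s _ => hKd s)
    refine ⟨c, Ioo_subset_Icc_self hc, ?_⟩
    have hne : y - c ≠ 0 := by linarith [hc.2]
    refine mul_right_cancel₀ hne ?_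
    simp only [hF] at he
    linear_combination he
  · subst h
    exact ⟨x, left_mem_uIcc, by simp⟩
  · rw [uIcc_of_gt h] at *
    obtain ⟨c, hc, he⟩ := exists_ratio_hasDerivAt_eq_ratio_slope F _ h
      (fun s hs => (hFd s hs).continuousAt.continuousWithinAt)
      (fun s hs => hFd s (Ioo_subset_Icc_self hs)) (fun s => (y - s) ^ 2 / 2) _
      (fun s _ => (hKd s).continuousAt.continuousWithinAt) (fun s _ => hKd s)
    refine ⟨c, Ioo_subset_Icc_self hc, ?_⟩
    have hne : y - c ≠ 0 := by linarith [hc.1]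
    refine mul_right_cancel₀ hne ?_
    simp only [hF] at he
    linear_combination -he

theorem exists_taylor_three {f f' f'' f''' : ℝ → ℝ} {x y : ℝ}
    (h0 : ∀ s ∈ uIcc x y, HasDerivAt f (f' s) s)
    (h1 : ∀ s ∈ uIcc x y, HasDerivAt f' (f'' s) s)
    (h2 : ∀ s ∈ uIcc x y, HasDerivAt f'' (f''' s) s) :
    ∃ ξ ∈ uIcc x y, f y - f x - f' x * (y - x) - f'' x * (y - x) ^ 2 / 2 =
      f''' ξ * (y - x) ^ 3 / 6 := by
  set F : ℝ → ℝ := fun s => f s + f' s * (y - s) + f'' s * ((y - s) ^ 2 / 2) with hF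
  have hKd : ∀ s, HasDerivAt (fun s => (y - s) ^ 2 / 2) (-(y - s)) s := by
    intro s
    refine ((((hasDerivAt_id s).const_sub y).pow 2).div_const 2).congr_deriv ?_
    simp only [id]
    push_cast
    ring
  have hFd : ∀ s ∈ uIcc x y, HasDerivAt F (f''' s * ((y - s) ^ 2 / 2)) s := by
    intro s hs
    have := ((h0 s hs).add ((h1 s hs).mul ((hasDerivAt_id s).const_sub y))).add
      ((h2 s hs).mul (hKd s))
    refine this.congr_deriv ?_
    simp only [id]
    ring
  have hLd : ∀ s, HasDerivAt (fun s => (y - s) ^ 3 / 6) (-((y - s) ^ 2 / 2)) s := by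
    intro s
    refine ((((hasDerivAt_id s).const_sub y).pow 3).div_const 6).congr_deriv ?_
    simp only [id]
    push_cast
    ring
  rcases lt_trichotomy x y with h | h | h
  · rw [uIcc_of_lt h] at *
    obtain ⟨c, hc, he⟩ := exists_ratio_hasDerivAt_eq_ratio_slope F _ h
      (fun s hs => (hFd s hs).continuousAt.continuousWithinAt)
      (fun s hs => hFd s (Ioo_subset_Icc_self hs)) (fun s => (y - s) ^ 3 / 6) _
      (fun s _ => (hLd s).continuousAt.continuousWithinAt) (fun s _ => hLd s)
    refine ⟨c, Ioo_subset_Icc_self hc, ?_⟩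
    have hne : (y - c) ^ 2 / 2 ≠ 0 := by
      have : 0 < y - c := by linarith [hc.2]
      positivity
    refine mul_right_cancel₀ hne ?_
    simp only [hF] at he
    linear_combination he
  · subst h
    exact ⟨x, left_mem_uIcc, by simp⟩
  · rw [uIcc_of_gt h] at *
    obtain ⟨c, hc, he⟩ := exists_ratio_hasDerivAt_eq_ratio_slope F _ h
      (fun s hs => (hFd s hs).continuousAt.continuousWithinAt)
      (fun s hs => hFd s (Ioo_subset_Icc_self hs)) (fun s => (y - s) ^ 3 / 6) _
      (fun s _ => (hLd s).continuousAt.continuousWithinAt) (fun s _ => hLd s)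
    refine ⟨c, Ioo_subset_Icc_self hc, ?_⟩
    have hne : (y - c) ^ 2 / 2 ≠ 0 := by
      have : 0 < c - y := by linarith [hc.1]
      have : y - c ≠ 0 := by linarith
      positivity
    refine mul_right_cancel₀ hne ?_
    simp only [hF] at he
    linear_combination -he

theorem abs_exp_sub_exp_le {a b m : ℝ} (ha : a ≤ m) (hb : b ≤ m) :
    |exp a - exp b| ≤ |a - b| * exp m := by
  wlog h : b ≤ a generalizing a b
  · rw [abs_sub_comm, abs_sub_comm a]
    exact this hb ha (le_of_not_ge h)
  rw [abs_of_nonneg (sub_nonneg.2 (exp_le_exp.2 h)), abs_of_nonneg (sub_nonneg.2 h)]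
  have h1 : exp b = exp a * exp (b - a) := by rw [← exp_add]; ring_nf
  have h2 := add_one_le_exp (b - a)
  calc exp a - exp b = exp a * (1 - exp (b - a)) := by rw [h1]; ring
    _ ≤ exp a * (a - b) := mul_le_mul_of_nonneg_left (by linarith) (exp_pos _).le
    _ ≤ exp m * (a - b) := mul_le_mul_of_nonneg_right (exp_le_exp.2 ha) (by linarith)
    _ = _ := mul_comm _ _

theorem tendsto_exp_mul_sub_one_div {δ s : ℝ → ℝ} {L : ℝ} (hδ : ∀ᶠ v in atTop, δ v ≠ 0)
    (hδ0 : Tendsto δ atTop (nhds 0)) (hs : Tendsto s atTop (nhds L)) :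
    Tendsto (fun v => (exp (δ v * s v) - 1) / δ v) atTop (nhds L) := by
  have hr : Tendsto (fun v => δ v * s v) atTop (nhds 0) := by simpa using hδ0.mul hs
  have hb : Tendsto (fun v => |δ v| * s v ^ 2) atTop (nhds 0) := by
    simpa using hδ0.abs.mul (hs.pow 2)
  have hd : Tendsto (fun v => (exp (δ v * s v) - 1) / δ v - s v) atTop (nhds 0) := by
    refine squeeze_zero_norm' ?_ hb
    have h1 : ∀ᶠ v in atTop, |δ v * s v| < 1 := by
      have := hr.abs
      rw [abs_zero] at this
      exact this.eventually (gt_mem_nhds one_pos)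
    filter_upwards [h1, hδ] with v hv hδv
    have h2 := abs_exp_sub_one_sub_id_le hv.le
    rw [Real.norm_eq_abs, show (exp (δ v * s v) - 1) / δ v - s v =
      (exp (δ v * s v) - 1 - δ v * s v) / δ v by field_simp, abs_div,
      div_le_iff₀ (abs_pos.2 hδv)]
    refine h2.trans (le_of_eq ?_)
    rw [mul_pow, ← sq_abs (δ v)]
    ring
  simpa using hd.add hs

section Tilted

variable {g h h₁ h₂ : ℝ → ℝ} {x₀ a c y : ℝ}

theorem tilted_quadratic_lower_bound
    (hg : ∀ x > (0 : ℝ), HasDerivAt g (h x) x) (hh : ∀ x > (0 : ℝ), HasDerivAt h (h₁ x) x)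
    (hx : ∀ ξ, |ξ - x₀| ≤ a → 0 < ξ) (hc : ∀ ξ, |ξ - x₀| ≤ a → c * h₁ x₀ ≤ h₁ ξ) (hy : |y| ≤ a) :
    c * h₁ x₀ * y ^ 2 / 2 ≤ g (x₀ + y) - g x₀ - h x₀ * y := by
  have hsub : ∀ s ∈ uIcc x₀ (x₀ + y), |s - x₀| ≤ a := fun s hs => by
    have := abs_sub_left_of_mem_uIcc hs
    rw [add_sub_cancel_left] at this
    exact this.trans hy
  obtain ⟨ξ, hξ, he⟩ := exists_taylor_two (fun s hs => hg s (hx s (hsub s hs)))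
    (fun s hs => hh s (hx s (hsub s hs)))
  rw [add_sub_cancel_left] at he
  rw [he]
  have := hc ξ (hsub ξ hξ)
  have := mul_le_mul_of_nonneg_right this (sq_nonneg y)
  linarith

theorem tilted_linear_lower_bound (hconv : ConvexOn ℝ (Ioi 0) g)
    (hg : ∀ x > (0 : ℝ), HasDerivAt g (h x) x) (hh : ∀ x > (0 : ℝ), HasDerivAt h (h₁ x) x)
    (ha : 0 < a)
    (hx : ∀ ξ, |ξ - x₀| ≤ a → 0 < ξ) (hc : ∀ ξ, |ξ - x₀| ≤ a → c * h₁ x₀ ≤ h₁ ξ) (hy : a ≤ |y|)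
    (hxy : 0 < x₀ + y) :
    c * h₁ x₀ * (a * |y|) / 2 ≤ g (x₀ + y) - g x₀ - h x₀ * y := by
  have hy0 : 0 < |y| := ha.trans_le hy
  set s := a / |y| with hs
  have hs0 : 0 < s := div_pos ha hy0
  have hs1 : s ≤ 1 := (div_le_one hy0).2 hy
  have hsy : |s * y| = a := by
    rw [abs_mul, abs_of_pos hs0, hs, div_mul_cancel₀ _ hy0.ne']
  have h1 := tilted_quadratic_lower_bound hg hh hx hc hsy.le
  have hx0 : 0 < x₀ := hx x₀ (by simpa using ha.le)
  have h2 := hconv.2 (show x₀ ∈ Ioi (0 : ℝ) from hx0) (show x₀ + y ∈ Ioi (0 : ℝ) from hxy)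
    (sub_nonneg.2 hs1) hs0.le (sub_add_cancel 1 s)
  simp only [smul_eq_mul] at h2
  rw [show (1 - s) * x₀ + s * (x₀ + y) = x₀ + s * y by ring] at h2
  rw [← sq_abs, hsy] at h1
  have h3 : a = s * |y| := by rw [hs, div_mul_cancel₀ _ hy0.ne']
  refine le_of_mul_le_mul_left ?_ hs0
  have h4 : s * (c * h₁ x₀ * (a * |y|) / 2) = c * h₁ x₀ * a ^ 2 / 2 := by
    rw [h3]
    ring
  rw [h4]
  linarith

end Tilted

section Laplace

variable {g h h₁ h₂ p q Φ xh a : ℝ → ℝ} {c C M : ℝ}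

/-- The tilted density at `t = h x₀`, recentred at `x₀`, rescaled by `σ` and normalised to be `1`
at `z = 0` when `q = 0`. -/
def tiltedWeight (g h p : ℝ → ℝ) (x₀ σ z : ℝ) : ℝ :=
  exp (g x₀ - h x₀ * x₀) * (exp (h x₀ * (x₀ + σ * z)) * p (x₀ + σ * z))

theorem tiltedWeight_eq_exp (hp : ∀ x, p x = if 0 ≤ x then exp (-(g x - q x)) else 0)
    {x₀ σ z : ℝ} (hz : 0 < x₀ + σ * z) :
    tiltedWeight g h p x₀ σ z =
      exp (-(g (x₀ + σ * z) - g x₀ - h x₀ * (σ * z)) + q (x₀ + σ * z)) := by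
  rw [tiltedWeight, hp, if_pos hz.le, ← exp_add, ← exp_add]
  congr 1
  ring

theorem abs_tiltedWeight_sub_le
    (hg : ∀ x > (0 : ℝ), HasDerivAt g (h x) x) (hh : ∀ x > (0 : ℝ), HasDerivAt h (h₁ x) x)
    (hh₁ : ∀ x > (0 : ℝ), HasDerivAt h₁ (h₂ x) x)
    (hq : ∀ x ≥ (0 : ℝ), |q x| ≤ M) (hp : ∀ x, p x = if 0 ≤ x then exp (-(g x - q x)) else 0)
    (hc1 : c ≤ 1) {x₀ σ z r D : ℝ} (hσ : 0 < σ) (hσh : h₁ x₀ * σ ^ 2 = 1) (hz : σ * |z| ≤ r)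
    (hpos : ∀ ξ, |ξ - x₀| ≤ r → 0 < ξ) (hlow : ∀ ξ, |ξ - x₀| ≤ r → c * h₁ x₀ ≤ h₁ ξ)
    (hD : ∀ ξ, |ξ - x₀| ≤ r → |h₂ ξ| * σ ^ 3 ≤ D) (hqD : ∀ ξ, |ξ - x₀| ≤ r → |q ξ| ≤ D) :
    |tiltedWeight g h p x₀ σ z - exp (-z ^ 2 / 2)| ≤
      exp M * D * ((1 + |z| ^ 3) * exp (-(c / 2) * z ^ 2)) := by
  have hy : |σ * z| ≤ r := by rwa [abs_mul, abs_of_pos hσ]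
  have hyr : |x₀ + σ * z - x₀| ≤ r := by rwa [add_sub_cancel_left]
  have hz0 : 0 < x₀ + σ * z := hpos _ hyr
  have hM : 0 ≤ M := (abs_nonneg _).trans (hq 0 le_rfl)
  have hD0 : 0 ≤ D := (abs_nonneg _).trans (hqD _ hyr)
  have hsub : ∀ s ∈ uIcc x₀ (x₀ + σ * z), |s - x₀| ≤ r := fun s hs => by
    have := abs_sub_left_of_mem_uIcc hs
    rw [add_sub_cancel_left] at this
    exact this.trans hy
  obtain ⟨ξ, hξ, he⟩ := exists_taylor_three (fun s hs => hg s (hpos s (hsub s hs)))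
    (fun s hs => hh s (hpos s (hsub s hs))) (fun s hs => hh₁ s (hpos s (hsub s hs)))
  rw [add_sub_cancel_left] at he
  have hquad := tilted_quadratic_lower_bound hg hh hpos hlow hy
  have e1 : c * h₁ x₀ * (σ * z) ^ 2 / 2 = c / 2 * z ^ 2 := by
    linear_combination c * z ^ 2 / 2 * hσh
  have e2 : h₁ x₀ * (σ * z) ^ 2 / 2 = z ^ 2 / 2 := by linear_combination z ^ 2 / 2 * hσh
  rw [e1] at hquad
  rw [e2] at he
  rw [tiltedWeight_eq_exp hp hz0]
  have hqM := hq _ hz0.le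
  have hqd := hqD _ hyr
  set φ := g (x₀ + σ * z) - g x₀ - h x₀ * (σ * z)
  have b1 : -φ + q (x₀ + σ * z) ≤ M + -(c / 2) * z ^ 2 := by
    linarith [le_abs_self (q (x₀ + σ * z))]
  have b2 : -z ^ 2 / 2 ≤ M + -(c / 2) * z ^ 2 := by nlinarith [sq_nonneg z]
  refine (abs_exp_sub_exp_le b1 b2).trans ?_
  have b3 : |-φ + q (x₀ + σ * z) - -z ^ 2 / 2| ≤ D * (1 + |z| ^ 3) := by
    have e3 : -φ + q (x₀ + σ * z) - -z ^ 2 / 2 =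
        q (x₀ + σ * z) - h₂ ξ * (σ * z) ^ 3 / 6 := by linarith
    rw [e3]
    refine (abs_sub _ _).trans ?_
    have e4 : |h₂ ξ * (σ * z) ^ 3 / 6| = (|h₂ ξ| * σ ^ 3) * |z| ^ 3 / 6 := by
      rw [abs_div, abs_mul, abs_pow, abs_mul, abs_of_pos hσ, abs_of_pos (by norm_num : (0:ℝ) < 6)]
      ring
    rw [e4]
    have := mul_le_mul_of_nonneg_right (hD ξ (hsub ξ hξ)) (pow_nonneg (abs_nonneg z) 3)
    nlinarith [mul_nonneg hD0 (pow_nonneg (abs_nonneg z) 3)]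
  rw [exp_add]
  calc _ ≤ D * (1 + |z| ^ 3) * (exp M * exp (-(c / 2) * z ^ 2)) :=
        mul_le_mul_of_nonneg_right b3 (by positivity)
    _ = _ := by ring

theorem abs_tiltedWeight_le (hconv : ConvexOn ℝ (Ioi 0) g)
    (hg : ∀ x > (0 : ℝ), HasDerivAt g (h x) x) (hh : ∀ x > (0 : ℝ), HasDerivAt h (h₁ x) x)
    (hq : ∀ x ≥ (0 : ℝ), |q x| ≤ M) (hp : ∀ x, p x = if 0 ≤ x then exp (-(g x - q x)) else 0)
    {x₀ σ z r : ℝ} (hσ : 0 < σ) (hσh : h₁ x₀ * σ ^ 2 = 1) (hr : 0 < r) (hz : r ≤ σ * |z|)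
    (hpos : ∀ ξ, |ξ - x₀| ≤ r → 0 < ξ) (hlow : ∀ ξ, |ξ - x₀| ≤ r → c * h₁ x₀ ≤ h₁ ξ)
    (hz0 : x₀ + σ * z ≠ 0) :
    |tiltedWeight g h p x₀ σ z| ≤ exp M * exp (-(c / 2 * (r / σ * |z|))) := by
  rcases hz0.lt_or_gt with hz0 | hz0
  · rw [tiltedWeight, hp, if_neg hz0.not_ge]
    simp only [mul_zero, abs_zero]
    positivity
  have hy : |σ * z| = σ * |z| := by rw [abs_mul, abs_of_pos hσ]
  have hlin := tilted_linear_lower_bound hconv hg hh hr hpos hlow (hz.trans_eq hy.symm) hz0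
  have e1 : c * h₁ x₀ * (r * |σ * z|) / 2 = c / 2 * (r / σ * |z|) := by
    rw [hy]
    field_simp
    linear_combination c * |z| * hσh
  rw [e1] at hlin
  rw [tiltedWeight_eq_exp hp hz0, abs_exp, ← exp_add, exp_le_exp]
  linarith [le_abs_self (q (x₀ + σ * z)), hq _ hz0.le]

theorem tendsto_tiltedWeight_sub_div
    (hg : ∀ x > (0 : ℝ), HasDerivAt g (h x) x) (hh : ∀ x > (0 : ℝ), HasDerivAt h (h₁ x) x)
    (hh₁ : ∀ x > (0 : ℝ), HasDerivAt h₁ (h₂ x) x)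
    (hp : ∀ x, p x = if 0 ≤ x then exp (-(g x - q x)) else 0)
    {σ : ℝ → ℝ} (hσ : ∀ᶠ v in atTop, 0 < σ v) (hσh : ∀ᶠ v in atTop, h₁ (xh v) * σ v ^ 2 = 1)
    (hZ : Tendsto (fun v => a v / σ v) atTop atTop)
    (hδ : ∀ᶠ v in atTop, h₂ (xh v) * σ v ^ 3 ≠ 0)
    (hδ0 : Tendsto (fun v => h₂ (xh v) * σ v ^ 3) atTop (nhds 0))
    (hpos : ∀ᶠ v in atTop, ∀ ξ, |ξ - xh v| ≤ a v → 0 < ξ)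
    (hnear : ∀ ε > 0, ∃ ρ > 0, ∀ᶠ v in atTop, ∀ ξ, |ξ - xh v| ≤ ρ * a v →
      |h₂ ξ / h₂ (xh v) - 1| ≤ ε)
    (hqC : ∀ᶠ v in atTop, ∀ ξ, |ξ - xh v| ≤ a v → |q ξ| ≤ C * |q (xh v)|)
    (hqδ : Tendsto (fun v => q (xh v) / (h₂ (xh v) * σ v ^ 3)) atTop (nhds 0)) (z : ℝ) :
    Tendsto (fun v => (tiltedWeight g h p (xh v) (σ v) z - exp (-z ^ 2 / 2)) /
      (h₂ (xh v) * σ v ^ 3)) atTop (nhds (-z ^ 3 / 6 * exp (-z ^ 2 / 2))) := by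
  have hsmall : ∀ ρ > 0, ∀ᶠ v in atTop, |σ v * z| ≤ ρ * a v := by
    intro ρ hρ
    filter_upwards [hσ, hZ.eventually_ge_atTop (|z| / ρ)] with v h1 h2
    rw [abs_mul, abs_of_pos h1]
    rw [div_le_div_iff₀ hρ h1] at h2
    linarith
  have hsmall1 : ∀ᶠ v in atTop, |σ v * z| ≤ a v := by simpa using hsmall 1 one_pos
  set ψ : ℝ → ℝ := fun v =>
    g (xh v + σ v * z) - g (xh v) - h (xh v) * (σ v * z) - z ^ 2 / 2 with hψ
  set δ : ℝ → ℝ := fun v => h₂ (xh v) * σ v ^ 3 with hδdef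
  have hψlim : Tendsto (fun v => ψ v / δ v) atTop (nhds (z ^ 3 / 6)) := by
    rw [Metric.tendsto_nhds]
    intro ε hε
    obtain ⟨ρ, hρ, hev⟩ := hnear (ε / (1 + |z| ^ 3)) (by positivity)
    filter_upwards [hev, hsmall ρ hρ, hsmall1, hpos, hσ, hσh, hδ] with v hv hs hs1 hp0 hσv hσhv hδv
    have hsub : ∀ s ∈ uIcc (xh v) (xh v + σ v * z), |s - xh v| ≤ |σ v * z| := fun s hs => by
      have := abs_sub_left_of_mem_uIcc hs
      rwa [add_sub_cancel_left] at this
    have hps : ∀ s ∈ uIcc (xh v) (xh v + σ v * z), 0 < s := fun s hs =>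
      hp0 s ((hsub s hs).trans hs1)
    obtain ⟨ξ, hξ, he⟩ := exists_taylor_three (fun s hs => hg s (hps s hs))
      (fun s hs => hh s (hps s hs)) (fun s hs => hh₁ s (hps s hs))
    rw [add_sub_cancel_left] at he
    have e2 : h₁ (xh v) * (σ v * z) ^ 2 / 2 = z ^ 2 / 2 := by
      linear_combination z ^ 2 / 2 * hσhv
    rw [e2] at he
    have hh2 : h₂ (xh v) ≠ 0 := left_ne_zero_of_mul hδv
    have e3 : ψ v / δ v - z ^ 3 / 6 = (h₂ ξ / h₂ (xh v) - 1) * (z ^ 3 / 6) := by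
      simp only [hψ, hδdef]
      rw [he]
      field_simp
    rw [Real.dist_eq, e3, abs_mul, abs_div, abs_pow, abs_of_pos (by norm_num : (0 : ℝ) < 6)]
    have h1 := hv ξ ((hsub ξ hξ).trans hs)
    calc _ ≤ ε / (1 + |z| ^ 3) * (|z| ^ 3 / 6) := mul_le_mul_of_nonneg_right h1 (by positivity)
      _ < ε := by
        rw [div_mul_eq_mul_div, div_lt_iff₀ (by positivity)]
        have : 0 ≤ |z| ^ 3 := by positivity
        nlinarith
  have hqlim : Tendsto (fun v => q (xh v + σ v * z) / δ v) atTop (nhds 0) := by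
    have h0 : Tendsto (fun v => C * |q (xh v) / δ v|) atTop (nhds 0) := by
      simpa using hqδ.abs.const_mul C
    refine squeeze_zero_norm' ?_ h0
    filter_upwards [hqC, hsmall1] with v h1 h2
    rw [Real.norm_eq_abs, abs_div, abs_div, ← mul_div_assoc]
    exact div_le_div_of_nonneg_right (h1 _ (by rwa [add_sub_cancel_left])) (abs_nonneg _)
  have hs := hqlim.sub hψlim
  have hexp := (tendsto_exp_mul_sub_one_div hδ hδ0 hs).mul_const (exp (-z ^ 2 / 2))
  rw [show (0 - z ^ 3 / 6) = -z ^ 3 / 6 by ring] at hexp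
  refine hexp.congr' ?_
  filter_upwards [hpos, hsmall1, hδ] with v hp0 hs1 hδv
  rw [tiltedWeight_eq_exp hp (hp0 _ (by rwa [add_sub_cancel_left]))]
  have e : δ v * (q (xh v + σ v * z) / δ v - ψ v / δ v) = q (xh v + σ v * z) - ψ v := by
    have : δ v ≠ 0 := hδv
    field_simp
  rw [e, div_mul_eq_mul_div, sub_mul, ← exp_add, one_mul]
  congr 3
  simp only [hψ]
  ring

/-- Laplace-type expansion of the third cumulant of the tilted density, along a family of
saddle points `xh v` around which `h₁` and `h₂` are controlled on intervals of radius `a v`. -/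
theorem tendsto_iteratedDeriv_three_log_of_local
    (hg : ∀ x > (0 : ℝ), HasDerivAt g (h x) x) (hh : ∀ x > (0 : ℝ), HasDerivAt h (h₁ x) x)
    (hh₁ : ∀ x > (0 : ℝ), HasDerivAt h₁ (h₂ x) x) (hconv : ConvexOn ℝ (Ioi 0) g)
    (hq : ∀ x ≥ (0 : ℝ), |q x| ≤ M)
    (hp : ∀ x, p x = if 0 ≤ x then exp (-(g x - q x)) else 0)
    (hΦ : ∀ t, Φ t = ∫ x, exp (t * x) * p x)
    (hInt : ∀ t > (0 : ℝ), Integrable (fun x => exp (t * x) * p x))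
    (ht : ∀ᶠ v in atTop, 0 < h (xh v)) (ha : ∀ᶠ v in atTop, 0 < a v) (hc : 0 < c) (hc1 : c ≤ 1)
    (hC : 1 ≤ C)
    {σ : ℝ → ℝ} (hσ : ∀ᶠ v in atTop, 0 < σ v) (hσh : ∀ᶠ v in atTop, h₁ (xh v) * σ v ^ 2 = 1)
    (hloc : ∀ᶠ v in atTop, ∀ ξ, |ξ - xh v| ≤ a v →
      0 < ξ ∧ c * h₁ (xh v) ≤ h₁ ξ ∧ |h₂ ξ| ≤ C * |h₂ (xh v)| ∧ |q ξ| ≤ C * |q (xh v)|)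
    (hnear : ∀ ε > 0, ∃ ρ > 0, ∀ᶠ v in atTop, ∀ ξ, |ξ - xh v| ≤ ρ * a v →
      |h₂ ξ / h₂ (xh v) - 1| ≤ ε)
    (hZ : Tendsto (fun v => a v / σ v) atTop atTop)
    (hδ : ∀ᶠ v in atTop, h₂ (xh v) * σ v ^ 3 ≠ 0)
    (hδ0 : Tendsto (fun v => h₂ (xh v) * σ v ^ 3) atTop (nhds 0))
    {N : ℕ} (hN : ∀ᶠ v in atTop, 1 ≤ |h₂ (xh v) * σ v ^ 3| * (a v / σ v) ^ N)
    (hqδ : Tendsto (fun v => q (xh v) / (h₂ (xh v) * σ v ^ 3)) atTop (nhds 0)) :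
    Tendsto (fun v => iteratedDeriv 3 (fun u => log (Φ u)) (h (xh v)) /
      (h₂ (xh v) * σ v ^ 6)) atTop (nhds (-1)) := by
  have hp0 : ∀ x, 0 ≤ p x := fun x => by
    rw [hp]
    split_ifs
    exacts [(exp_pos _).le, le_rfl]
  have hΦpos : ∀ t > (0 : ℝ), 0 < Φ t := by
    intro t ht
    rw [hΦ, integral_pos_iff_support_of_nonneg (fun x => mul_nonneg (exp_pos _).le (hp0 x))
      (hInt t ht)]
    refine lt_of_lt_of_le ?_ (measure_mono (s := Ioi (0 : ℝ)) fun x hx => ?_)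
    · simp
    · have hx' : 0 ≤ x := le_of_lt hx
      rw [Function.mem_support, hp, if_pos hx']
      positivity
  have hM : 0 ≤ M := (abs_nonneg _).trans (hq 0 le_rfl)
  set w : ℝ → ℝ → ℝ := fun v => tiltedWeight g h p (xh v) (σ v) with hwdef
  set δ : ℝ → ℝ := fun v => h₂ (xh v) * σ v ^ 3 with hδdef
  have hin : ∀ᶠ v in atTop, ∀ᵐ z, |z| ≤ a v / σ v → |w v z - exp (-z ^ 2 / 2)| ≤
      (exp M * C) * |δ v| * ((1 + |z| ^ 3) * exp (-(c / 2) * z ^ 2)) := by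
    have hqs : ∀ᶠ v in atTop, |q (xh v) / δ v| < 1 := by
      have := hqδ.abs
      rw [abs_zero] at this
      exact this.eventually (gt_mem_nhds one_pos)
    filter_upwards [hloc, hσ, hσh, hqs, hδ] with v h1 h2 h3 h4 h5
    refine Eventually.of_forall fun z hz => ?_
    rw [abs_div, div_lt_one (abs_pos.2 h5)] at h4
    rw [mul_assoc (exp M)]
    refine abs_tiltedWeight_sub_le hg hh hh₁ hq hp hc1 h2 h3 (r := a v)
      (by rw [le_div_iff₀ h2] at hz; linarith) (fun ξ hξ => (h1 ξ hξ).1)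
      (fun ξ hξ => (h1 ξ hξ).2.1) (fun ξ hξ => ?_) (fun ξ hξ => ?_)
    · have := mul_le_mul_of_nonneg_right (h1 ξ hξ).2.2.1 (pow_pos h2 3).le
      simp only [hδdef]
      rwa [abs_mul, abs_of_pos (pow_pos h2 3), ← mul_assoc]
    · exact (h1 ξ hξ).2.2.2.trans (mul_le_mul_of_nonneg_left h4.le (by linarith))
  have hout : ∀ᶠ v in atTop, ∀ᵐ z, a v / σ v < |z| →
      |w v z| ≤ (exp M * C) * exp (-(c / 2 * (a v / σ v * |z|))) := by
    filter_upwards [hloc, hσ, hσh, ha] with v h1 h2 h3 h4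
    have hne : ∀ᵐ z : ℝ, z ≠ -xh v / σ v := by simp [ae_iff]
    filter_upwards [hne] with z hzne hz
    have hz0 : xh v + σ v * z ≠ 0 := fun h0 => hzne (by
      rw [eq_div_iff h2.ne']
      linarith)
    refine (abs_tiltedWeight_le hconv hg hh hq hp h2 h3 h4
      (by rw [div_lt_iff₀ h2] at hz; linarith) (fun ξ hξ => (h1 ξ hξ).1)
      (fun ξ hξ => (h1 ξ hξ).2.1) hz0).trans ?_
    refine mul_le_mul_of_nonneg_right ?_ (exp_pos _).le
    nlinarith [exp_pos M]
  obtain ⟨B, hB⟩ := exists_sub_gaussian_le (w := w) (δ := δ) (half_pos hc)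
    (by positivity : 0 ≤ exp M * C) hZ hN hin hout
  have hwm : ∀ᶠ v in atTop, AEStronglyMeasurable (w v) volume := by
    filter_upwards [ht, hσ] with v h1 h2
    exact ((((hInt _ h1).comp_add_left (xh v)).comp_mul_left' h2.ne').const_mul
      (exp (g (xh v) - h (xh v) * xh v))).aestronglyMeasurable
  have hlim := tendsto_third_cumulant_div hwm hδ hδ0 hB fun z _ =>
    tendsto_tiltedWeight_sub_div hg hh hh₁ hp hσ hσh hZ hδ hδ0
      (hloc.mono fun v hv ξ hξ => (hv ξ hξ).1) hnear
      (hloc.mono fun v hv ξ hξ => (hv ξ hξ).2.2.2) hqδ z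
  refine hlim.congr' ?_
  filter_upwards [ht, hσ] with v h1 h2
  rw [iteratedDeriv_three_log_rescaled (w := w v) hp0 hInt hΦ hΦpos h1 (xh v) h2
    (exp_pos (g (xh v) - h (xh v) * xh v)) (fun z => rfl)]
  rw [show h₂ (xh v) * σ v ^ 6 = σ v ^ 3 * (h₂ (xh v) * σ v ^ 3) by ring,
    mul_div_mul_left _ _ (pow_pos h2 3).ne']

end Laplace

section Saddle

/-- If `X'` is bounded below near `v` by `c X' v`, then `X` maps `[(1 - ρ) v, (1 + ρ) v]` onto a
set containing the interval of radius `c ρ v X' v` around `X v`. -/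
theorem exists_eq_of_abs_sub_le {X X' : ℝ → ℝ} {c v ρ ξ : ℝ} (hv : 0 < v) (hρ : 0 < ρ)
    (hd : ∀ s ∈ Icc ((1 - ρ) * v) ((1 + ρ) * v), HasDerivAt X (X' s) s)
    (hlow : ∀ s ∈ Icc ((1 - ρ) * v) ((1 + ρ) * v), c * X' v ≤ X' s)
    (hξ : |ξ - X v| ≤ c * ρ * v * X' v) : ∃ l ∈ Icc (1 - ρ) (1 + ρ), X (l * v) = ξ := by
  have hρv : 0 < ρ * v := mul_pos hρ hv
  have e1 : (1 - ρ) * v = v - ρ * v := by ring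
  have e2 : (1 + ρ) * v = v + ρ * v := by ring
  rw [e1, e2] at hd hlow
  have hmvt : ∀ x y, v - ρ * v ≤ x → x < y → y ≤ v + ρ * v →
      c * X' v * (y - x) ≤ X y - X x := by
    intro x y hx hxy hy
    have hmem : ∀ s ∈ Icc x y, s ∈ Icc (v - ρ * v) (v + ρ * v) := fun s hs =>
      ⟨hx.trans hs.1, hs.2.trans hy⟩
    obtain ⟨s, hs, he⟩ := exists_hasDerivAt_eq_slope X X' hxy
      (fun s hs => (hd s (hmem s hs)).continuousAt.continuousWithinAt)
      (fun s hs => hd s (hmem s (Ioo_subset_Icc_self hs)))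
    rw [eq_div_iff (sub_pos.2 hxy).ne'] at he
    rw [← he]
    exact mul_le_mul_of_nonneg_right (hlow s (hmem s (Ioo_subset_Icc_self hs)))
      (sub_pos.2 hxy).le
  have hup := hmvt v (v + ρ * v) (by linarith) (by linarith) le_rfl
  have hdown := hmvt (v - ρ * v) v le_rfl (by linarith) (by linarith)
  obtain ⟨h1, h2⟩ := abs_le.1 hξ
  obtain ⟨s, hs, he⟩ := intermediate_value_Icc (by linarith : v - ρ * v ≤ v + ρ * v)
    (fun s hs => (hd s hs).continuousAt.continuousWithinAt)
    (show ξ ∈ Icc (X (v - ρ * v)) (X (v + ρ * v)) from ⟨by nlinarith, by nlinarith⟩)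
  refine ⟨s / v, ⟨?_, ?_⟩, by rw [div_mul_cancel₀ _ hv.ne', he]⟩
  · rw [le_div_iff₀ hv, e1]
    exact hs.1
  · rw [div_le_iff₀ hv, e2]
    exact hs.2

theorem eventually_exists_eq_of_abs_sub_le {X X' : ℝ → ℝ} {d : ℝ}
    (hX : ∀ᶠ v in atTop, HasDerivAt X (X' v) v) (hX' : RegVary d X') (hX'm : Measurable X') :
    ∃ c > 0, ∀ᶠ v in atTop, ∀ ρ, 0 < ρ → ρ ≤ 1 / 2 → ∀ ξ, |ξ - X v| ≤ c * ρ * v * X' v →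
      ∃ l ∈ Icc (1 - ρ) (1 + ρ), X (l * v) = ξ := by
  obtain ⟨c, _, hc, _, hb⟩ := hX'.bounds hX'm
  obtain ⟨V, hV⟩ := eventually_atTop.1 hX
  refine ⟨c, hc, ?_⟩
  filter_upwards [hb, eventually_ge_atTop (2 * V), eventually_gt_atTop 0]
    with v hv h2 h0 ρ hρ hρ2 ξ hξ
  refine exists_eq_of_abs_sub_le h0 hρ (fun s hs => hV s (by nlinarith [hs.1])) (fun s hs => ?_) hξ
  have := (hv.2 (s / v) ⟨?_, ?_⟩).1
  · rwa [div_mul_cancel₀ _ h0.ne'] at this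
  · rw [le_div_iff₀ h0]
    nlinarith [hs.1]
  · rw [div_le_iff₀ h0]
    nlinarith [hs.2]

theorem div_eq_abs_div_abs_of_continuousOn {f : ℝ → ℝ} {V v w : ℝ} (hf : ContinuousOn f (Ici V))
    (h0 : ∀ x ≥ V, f x ≠ 0) (hv : V ≤ v) (hw : V ≤ w) : f w / f v = |f w| / |f v| := by
  have hsub : uIcc v w ⊆ Ici V := fun x hx => (le_min hv hw).trans hx.1
  have hiv := intermediate_value_uIcc (hf.mono hsub)
  have hno : (0 : ℝ) ∉ uIcc (f v) (f w) := fun hm => by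
    obtain ⟨x, hx, he⟩ := hiv hm
    exact h0 x (hsub hx) he
  rcases (h0 v hv).lt_or_gt with a | a <;> rcases (h0 w hw).lt_or_gt with b | b
  · rw [abs_of_neg a, abs_of_neg b, neg_div_neg_eq]
  · exact absurd (mem_uIcc.2 (Or.inl ⟨a.le, b.le⟩)) hno
  · exact absurd (mem_uIcc.2 (Or.inr ⟨b.le, a.le⟩)) hno
  · rw [abs_of_pos a, abs_of_pos b]

variable {g h h₁ h₂ p q Φ X X' : ℝ → ℝ} {M d a₁ a₂ η : ℝ}

/-- Asymptotics of the third cumulant at `t = h (X v)` when all the relevant functions are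
regularly varying in the parameter `v`. -/
theorem tendsto_iteratedDeriv_three_log_of_regVary
    (hg : ∀ x > (0 : ℝ), HasDerivAt g (h x) x) (hh : ∀ x > (0 : ℝ), HasDerivAt h (h₁ x) x)
    (hh₁ : ∀ x > (0 : ℝ), HasDerivAt h₁ (h₂ x) x) (hh₂ : ContinuousOn h₂ (Ioi 0))
    (hconv : ConvexOn ℝ (Ioi 0) g) (hq : ∀ x ≥ (0 : ℝ), |q x| ≤ M)
    (hp : ∀ x, p x = if 0 ≤ x then exp (-(g x - q x)) else 0)
    (hΦ : ∀ t, Φ t = ∫ x, exp (t * x) * p x)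
    (hInt : ∀ t > (0 : ℝ), Integrable (fun x => exp (t * x) * p x))
    (htop : Tendsto h atTop atTop) (hXtop : Tendsto X atTop atTop)
    (hX : ∀ᶠ v in atTop, HasDerivAt X (X' v) v)
    (hX' : RegVary d X') (hX'm : Measurable X')
    (h1 : RegVary a₁ (fun v => h₁ (X v))) (h1m : Measurable fun v => h₁ (X v))
    (h2 : RegVary a₂ (fun v => |h₂ (X v)|)) (h2m : Measurable fun v => |h₂ (X v)|)
    (h3 : RegVary η (fun v => |q (X v)|)) (h3m : Measurable fun v => |q (X v)|)
    (hδ : a₂ - 3 / 2 * a₁ < 0) (hZ : 0 < 1 + d + a₁ / 2) (hη : η < a₂ - 3 / 2 * a₁) :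
    Tendsto (fun v => iteratedDeriv 3 (fun u => log (Φ u)) (h (X v)) * h₁ (X v) ^ 3 / h₂ (X v))
      atTop (nhds (-1)) := by
  obtain ⟨c₀, hc₀, hcov⟩ := eventually_exists_eq_of_abs_sub_le hX hX' hX'm
  obtain ⟨c₁, _, hc₁, _, hb₁⟩ := h1.bounds h1m
  obtain ⟨_, C₂, _, hC₂, hb₂⟩ := h2.bounds h2m
  obtain ⟨_, C₃, _, hC₃, hb₃⟩ := h3.bounds h3m
  set σ : ℝ → ℝ := fun v => h₁ (X v) ^ (-(1 / 2) : ℝ) with hσdef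
  set a : ℝ → ℝ := fun v => c₀ / 2 * v * X' v with hadef
  have hσ : RegVary (a₁ * (-(1 / 2))) σ := h1.rpow _
  have hσm : Measurable σ := h1m.pow_const _
  have hσh : ∀ᶠ v in atTop, h₁ (X v) * σ v ^ 2 = 1 := by
    filter_upwards [h1.1] with v hv
    simp only [hσdef]
    rw [← rpow_natCast, ← rpow_mul hv.le]
    norm_num
    rw [rpow_neg_one, mul_inv_cancel₀ hv.ne']
  have ha : RegVary (1 + d) a := by
    have := ((RegVary.of_tendsto (half_pos hc₀)
      (tendsto_const_nhds (x := c₀ / 2) (f := atTop))).mul RegVary.id).mul hX'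
    rwa [zero_add] at this
  have ham : Measurable a := (measurable_id.const_mul _).mul hX'm
  have hZrv : RegVary (1 + d + a₁ / 2) (fun v => a v / σ v) := by
    have := ha.mul hσ.inv
    rw [show 1 + d + -(a₁ * (-(1 / 2))) = 1 + d + a₁ / 2 by ring] at this
    exact this
  have hZm : Measurable fun v => a v / σ v := ham.div hσm
  have hδrv : RegVary (a₂ - 3 / 2 * a₁) (fun v => |h₂ (X v) * σ v ^ 3|) := by
    have := h2.mul (hσ.rpow 3)
    rw [show a₂ + a₁ * (-(1 / 2)) * 3 = a₂ - 3 / 2 * a₁ by ring] at this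
    refine this.congr ?_
    filter_upwards [hσ.1] with v hv
    rw [abs_mul, abs_of_pos (pow_pos hv 3)]
    congr 1
    exact_mod_cast rpow_natCast (σ v) 3
  have hδm : Measurable fun v => |h₂ (X v) * σ v ^ 3| := by
    have : (fun v => |h₂ (X v) * σ v ^ 3|) = fun v => |h₂ (X v)| * |σ v ^ 3| := by
      ext v
      rw [abs_mul]
    rw [this]
    exact h2m.mul (hσm.pow_const 3).abs
  obtain ⟨N, hN⟩ := exists_nat_gt (-(a₂ - 3 / 2 * a₁) / (1 + d + a₁ / 2))
  rw [div_lt_iff₀ hZ] at hN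
  have hNrv : RegVary (a₂ - 3 / 2 * a₁ + (1 + d + a₁ / 2) * N)
      (fun v => |h₂ (X v) * σ v ^ 3| * (a v / σ v) ^ N) := by
    refine (hδrv.mul (hZrv.rpow N)).congr (Eventually.of_forall fun v => ?_)
    simp only [rpow_natCast]
  have hNtop := hNrv.tendsto_atTop (hδm.mul (hZm.pow_const N)) (by linarith)
  have hqδ : Tendsto (fun v => q (X v) / (h₂ (X v) * σ v ^ 3)) atTop (nhds 0) := by
    refine tendsto_zero_iff_abs_tendsto_zero _ |>.2 ?_
    refine ((h3.mul hδrv.inv).tendsto_zero_s2 (h3m.mul hδm.inv) (by linarith)).congr fun v => ?_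
    simp only [Function.comp]
    rw [abs_div, div_eq_mul_inv]
  have hδ0 : Tendsto (fun v => h₂ (X v) * σ v ^ 3) atTop (nhds 0) :=
    tendsto_zero_iff_abs_tendsto_zero _ |>.2 (hδrv.tendsto_zero_s2 hδm hδ)
  have hpos : ∀ᶠ v in atTop, 0 < v / 2 ∧ ∀ x ≥ v / 2, 0 < X x := by
    obtain ⟨V, hV⟩ := eventually_atTop.1 (hXtop.eventually_gt_atTop 0)
    filter_upwards [eventually_ge_atTop (2 * V), eventually_gt_atTop 0] with v hv h0
    exact ⟨by linarith, fun x hx => hV x (by linarith)⟩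
  have hsign : ∀ᶠ v in atTop, ∀ w ≥ v / 2, h₂ (X w) / h₂ (X v) = |h₂ (X w)| / |h₂ (X v)| := by
    obtain ⟨V, hV⟩ := eventually_atTop.1 (hX.and ((hXtop.eventually_gt_atTop 0).and h2.1))
    have hcont : ContinuousOn (fun v => h₂ (X v)) (Ici V) := hh₂.comp
      (fun v hv => (hV v hv).1.continuousAt.continuousWithinAt) fun v hv => (hV v hv).2.1
    filter_upwards [eventually_ge_atTop (2 * V), eventually_ge_atTop 0] with v hv hv0 w hw
    exact div_eq_abs_div_abs_of_continuousOn (f := fun v => h₂ (X v)) hcont (fun x hx => abs_pos.1 (hV x hx).2.2)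
      (by linarith) (by linarith)
  have hnear : ∀ ε > 0, ∃ ρ > 0, ∀ᶠ v in atTop, ∀ ξ, |ξ - X v| ≤ ρ * a v →
      |h₂ ξ / h₂ (X v) - 1| ≤ ε := by
    intro ε hε
    obtain ⟨ρ, hρ, hρ2, hev⟩ := h2.near_one h2m hε
    refine ⟨2 * ρ, by positivity, ?_⟩
    filter_upwards [hev, hcov, hsign, hpos] with v hv hcv hs hp0 ξ hξ
    obtain ⟨l, hl, rfl⟩ := hcv ρ hρ hρ2 ξ (hξ.trans_eq (by simp only [hadef]; ring))
    rw [hs (l * v) (by nlinarith [hl.1])]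
    exact hv l hl
  have hloc : ∀ᶠ v in atTop, ∀ ξ, |ξ - X v| ≤ a v → 0 < ξ ∧ min c₁ 1 * h₁ (X v) ≤ h₁ ξ ∧
      |h₂ ξ| ≤ max 1 (max C₂ C₃) * |h₂ (X v)| ∧ |q ξ| ≤ max 1 (max C₂ C₃) * |q (X v)| := by
    filter_upwards [hcov, hb₁, hb₂, hb₃, hpos] with v hcv hv1 hv2 hv3 hp0 ξ hξ
    obtain ⟨l, hl, rfl⟩ := hcv (1 / 2) (by norm_num) le_rfl ξ
      (hξ.trans_eq (by simp only [hadef]; ring))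
    have hl' : l ∈ Icc (1 / 2 : ℝ) 2 := ⟨by linarith [hl.1], by linarith [hl.2]⟩
    refine ⟨hp0.2 _ (by nlinarith [hl'.1]), ?_, ?_, ?_⟩
    · exact (mul_le_mul_of_nonneg_right (min_le_left _ _) hv1.1.le).trans (hv1.2 l hl').1
    · exact (hv2.2 l hl').2.trans (mul_le_mul_of_nonneg_right
        ((le_max_left _ _).trans (le_max_right _ _)) (abs_nonneg _))
    · exact (hv3.2 l hl').2.trans (mul_le_mul_of_nonneg_right
        ((le_max_right _ _).trans (le_max_right _ _)) (abs_nonneg _))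
  refine (tendsto_iteratedDeriv_three_log_of_local hg hh hh₁ hconv hq hp hΦ hInt
    ((htop.comp hXtop).eventually_gt_atTop 0) ha.1 (lt_min hc₁ one_pos) (min_le_right _ _)
    (le_max_left _ _) hσ.1 hσh hloc hnear (hZrv.tendsto_atTop hZm hZ)
    (hδrv.1.mono fun v hv => abs_pos.1 hv) hδ0 (hNtop.eventually_ge_atTop 1) hqδ).congr' ?_
  filter_upwards [hσh, h1.1, hσ.1] with v hv hv1 hv2
  have e : h₁ (X v) ^ 3 * σ v ^ 6 = 1 := by
    rw [show h₁ (X v) ^ 3 * σ v ^ 6 = (h₁ (X v) * σ v ^ 2) ^ 3 by ring, hv, one_pow]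
  rw [← mul_div_mul_right _ _ (pow_pos hv1 3).ne', mul_assoc (h₂ (X v)),
    mul_comm (σ v ^ 6), e, mul_one]

end Saddle

section Inverse

variable {g h h₁ h₂ ψ ε : ℝ → ℝ}

theorem hasDerivAt_iterate_deriv_of_contDiffOn (hg : ContDiffOn ℝ 4 g (Ioi 0)) :
    (∀ x > (0 : ℝ), HasDerivAt g (deriv g x) x) ∧
    (∀ x > (0 : ℝ), HasDerivAt (deriv g) (deriv (deriv g) x) x) ∧
    (∀ x > (0 : ℝ), HasDerivAt (deriv (deriv g)) (deriv (deriv (deriv g)) x) x) ∧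
    ContinuousOn (deriv (deriv (deriv g))) (Ioi 0) := by
  have h1 : ContDiffOn ℝ 3 (deriv g) (Ioi 0) := hg.deriv_of_isOpen isOpen_Ioi (by norm_num)
  have h2 : ContDiffOn ℝ 2 (deriv (deriv g)) (Ioi 0) :=
    h1.deriv_of_isOpen isOpen_Ioi (by norm_num)
  have h3 : ContDiffOn ℝ 1 (deriv (deriv (deriv g))) (Ioi 0) :=
    h2.deriv_of_isOpen isOpen_Ioi (by norm_num)
  refine ⟨fun x hx => ?_, fun x hx => ?_, fun x hx => ?_, h3.continuousOn⟩
  · exact ((hg.contDiffAt (Ioi_mem_nhds hx)).differentiableAt (by norm_num)).hasDerivAt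
  · exact ((h1.contDiffAt (Ioi_mem_nhds hx)).differentiableAt (by norm_num)).hasDerivAt
  · exact ((h2.contDiffAt (Ioi_mem_nhds hx)).differentiableAt (by norm_num)).hasDerivAt

theorem eventually_hasDerivAt_inverse (hh : ∀ x > (0 : ℝ), HasDerivAt h (h₁ x) x)
    (hh₁ : ContinuousOn h₁ (Ioi 0))
    (hψ : ∀ᶠ t in atTop, h (ψ t) = t) (hψ' : ∀ᶠ x in atTop, ψ (h x) = x)
    (htop : Tendsto ψ atTop atTop) (h0 : ∀ᶠ t in atTop, h₁ (ψ t) ≠ 0) :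
    ∀ᶠ t in atTop, HasDerivAt ψ (h₁ (ψ t))⁻¹ t := by
  obtain ⟨Y, hY⟩ := eventually_atTop.1 hψ'
  filter_upwards [hψ, h0, htop.eventually_gt_atTop 0, htop.eventually_gt_atTop Y]
    with t ht ht0 htpos htY
  have hs : HasStrictDerivAt h (h₁ (ψ t)) (ψ t) :=
    hasStrictDerivAt_of_hasDerivAt_of_continuousAt
      (by filter_upwards [Ioi_mem_nhds htpos] with x hx using hh x hx)
      (hh₁.continuousAt (Ioi_mem_nhds htpos))
  have := hs.to_local_left_inverse (g := ψ) ht0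
    (by filter_upwards [Ioi_mem_nhds htY] with x hx using hY x (le_of_lt hx))
  rw [ht] at this
  exact this.hasDerivAt

theorem eventually_iteratedDeriv_two_inverse (hh : ∀ x > (0 : ℝ), HasDerivAt h (h₁ x) x)
    (hh₁ : ∀ x > (0 : ℝ), HasDerivAt h₁ (h₂ x) x)
    (hψ : ∀ᶠ t in atTop, h (ψ t) = t) (hψ' : ∀ᶠ x in atTop, ψ (h x) = x)
    (htop : Tendsto ψ atTop atTop) (h0 : ∀ᶠ t in atTop, h₁ (ψ t) ≠ 0) :
    ∀ᶠ t in atTop, iteratedDeriv 2 ψ t = -h₂ (ψ t) / h₁ (ψ t) ^ 3 := by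
  have hd := eventually_hasDerivAt_inverse hh
    (fun x hx => (hh₁ x hx).continuousAt.continuousWithinAt) hψ hψ' htop h0
  obtain ⟨T, hT⟩ := eventually_atTop.1 hd
  filter_upwards [eventually_gt_atTop T, h0, htop.eventually_gt_atTop 0] with t ht ht0 htpos
  have e : deriv ψ =ᶠ[nhds t] fun s => (h₁ (ψ s))⁻¹ := by
    filter_upwards [Ioi_mem_nhds ht] with s hs using (hT s (le_of_lt hs)).deriv
  rw [iteratedDeriv_succ, iteratedDeriv_one, e.deriv_eq]
  have := (((hh₁ _ htpos).comp t (hT t ht.le)).fun_inv ht0).deriv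
  simp only [Function.comp] at this
  rw [this]
  field_simp

theorem hasDerivAt_integral_div (hε : ∀ x ≥ (1 : ℝ), DifferentiableAt ℝ ε x) {x : ℝ}
    (hx : 1 < x) : HasDerivAt (fun x => ∫ u in (1 : ℝ)..x, ε u / u) (ε x / x) x := by
  have hc : ContinuousOn (fun u => ε u / u) (Ici 1) := fun u hu =>
    ((hε u hu).continuousAt.div continuousAt_id
      (zero_lt_one.trans_le hu).ne').continuousWithinAt
  refine intervalIntegral.integral_hasDerivAt_right ?_ ?_ (hc.continuousAt (Ici_mem_nhds hx))
  · refine (hc.mono ?_).intervalIntegrable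
    rw [uIcc_of_le hx.le]
    exact Icc_subset_Ici_self
  · exact (hc.mono Ioi_subset_Ici_self).stronglyMeasurableAtFilter isOpen_Ioi x hx

theorem Case1.hasDerivAt {β c θ x : ℝ} (H : Case1 h β c θ ε) (hx : 1 < x) :
    HasDerivAt h (h x * x⁻¹ * (β + ε x)) x := by
  have hx0 : 0 < x := zero_lt_one.trans hx
  have hE := (hasDerivAt_integral_div H.eps_diff hx).exp
  have hd := ((hasDerivAt_rpow_const (p := β) (Or.inl hx0.ne')).const_mul c).mul hE
  have e : h =ᶠ[nhds x] fun x => c * x ^ β * exp (∫ u in (1 : ℝ)..x, ε u / u) := by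
    filter_upwards [Ici_mem_nhds hx] with y hy using H.h_eq y hy
  refine (hd.congr_of_eventuallyEq e).congr_deriv ?_
  rw [H.h_eq x hx.le, rpow_sub_one hx0.ne']
  field_simp

theorem Case1.regVary {β c θ : ℝ} (H : Case1 h β c θ ε) : RegVary β h := by
  have hpos : ∀ᶠ x in atTop, 0 < h x := by
    filter_upwards [eventually_ge_atTop 1] with x hx
    rw [H.h_eq x hx]
    have := H.c_pos
    have : 0 < x := by linarith
    positivity
  refine RegVary.of_logDeriv hpos
    ((eventually_gt_atTop 1).mono fun x hx => H.hasDerivAt hx) ?_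
  have := H.eps_to_zero.const_add β
  rw [add_zero] at this
  refine this.congr' ?_
  filter_upwards [hpos, eventually_gt_atTop 0] with x h1 h2
  field_simp

theorem Case1.regVary_deriv {β c θ : ℝ} (H : Case1 h β c θ ε) :
    RegVary (β - 1) (deriv h) := by
  have hlim := H.eps_to_zero.const_add β
  rw [add_zero] at hlim
  have := (H.regVary.mul RegVary.id.inv).mul (RegVary.of_tendsto H.beta_pos hlim)
  rw [add_zero, ← sub_eq_add_neg] at this
  exact this.congr ((eventually_gt_atTop 1).mono fun x hx => (H.hasDerivAt hx).deriv.symm)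

theorem Case2.psi_pos {c t : ℝ} (H : Case2 ψ c ε) (ht : 1 ≤ t) : 0 < ψ t := by
  rw [H.psi_eq t ht]
  have := H.c_pos
  positivity

theorem Case2.hasDerivAt {c t : ℝ} (H : Case2 ψ c ε) (ht : 1 < t) :
    HasDerivAt ψ (ψ t * ε t * t⁻¹) t := by
  have hd := (hasDerivAt_integral_div H.eps_diff ht).exp.const_mul c
  have e : ψ =ᶠ[nhds t] fun x => c * exp (∫ u in (1 : ℝ)..x, ε u / u) := by
    filter_upwards [Ici_mem_nhds ht] with y hy using H.psi_eq y hy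
  refine (hd.congr_of_eventuallyEq e).congr_deriv ?_
  rw [H.psi_eq t ht.le]
  ring

theorem Case2.deriv_mul_eq_one {c : ℝ} (H : Case2 ψ c ε)
    (hh : ∀ x > (0 : ℝ), HasDerivAt h (h₁ x) x) (hψ : ∀ᶠ t in atTop, h (ψ t) = t) :
    ∀ᶠ t in atTop, h₁ (ψ t) * (ψ t * ε t * t⁻¹) = 1 := by
  obtain ⟨T, hT⟩ := eventually_atTop.1 hψ
  filter_upwards [eventually_gt_atTop T, eventually_gt_atTop 1] with t ht ht1
  have h1 := (hh _ (H.psi_pos ht1.le)).comp t (H.hasDerivAt ht1)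
  have e : h ∘ ψ =ᶠ[nhds t] id := by
    filter_upwards [Ioi_mem_nhds ht] with s hs using hT s (le_of_lt hs)
  exact h1.unique ((hasDerivAt_id t).congr_of_eventuallyEq e)

theorem eventually_deriv_nonneg_of_strictMonoOn
    (hh : ∀ x > (0 : ℝ), HasDerivAt h (h₁ x) x) (hmono : ∃ x₀ : ℝ, StrictMonoOn h (Ioi x₀)) :
    ∀ᶠ x in atTop, 0 ≤ h₁ x := by
  obtain ⟨x₀, hm⟩ := hmono
  filter_upwards [eventually_gt_atTop x₀, eventually_gt_atTop 0] with x hx hx0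
  have := hm.monotoneOn.derivWithin_nonneg (x := x)
  rwa [derivWithin_of_isOpen isOpen_Ioi hx, (hh x hx0).deriv] at this

theorem Case2.regVary_eps {c : ℝ} (H : Case2 ψ c ε) (hpos : ∀ᶠ t in atTop, 0 < ε t) :
    RegVary 0 ε :=
  RegVary.of_logDeriv hpos
    ((eventually_ge_atTop 1).mono fun t ht => (H.eps_diff t ht).hasDerivAt) H.eps_ratio1

theorem Case2.regVary {c : ℝ} (H : Case2 ψ c ε) : RegVary 0 ψ := by
  have hpos : ∀ᶠ t in atTop, 0 < ψ t := (eventually_ge_atTop 1).mono fun t ht => H.psi_pos ht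
  refine RegVary.of_logDeriv hpos
    ((eventually_gt_atTop 1).mono fun x hx => H.hasDerivAt hx) (H.eps_to_zero.congr' ?_)
  filter_upwards [hpos, eventually_gt_atTop 0] with x h1 h2
  field_simp

theorem Case2.regVary_deriv {c : ℝ} (H : Case2 ψ c ε) (hpos : ∀ᶠ t in atTop, 0 < ε t) :
    RegVary (-1) (fun t => ψ t * ε t * t⁻¹) := by
  have := (H.regVary.mul (H.regVary_eps hpos)).mul RegVary.id.inv
  simpa only [zero_add] using this

theorem Case2.iteratedDeriv_two {c t : ℝ} (H : Case2 ψ c ε) (ht : 1 < t) (hε : ε t ≠ 0) :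
    iteratedDeriv 2 ψ t = -(ψ t * ε t * t⁻¹ * t⁻¹ * (1 - ε t - t * deriv ε t / ε t)) := by
  have e : deriv ψ =ᶠ[nhds t] fun s => ψ s * ε s * s⁻¹ := by
    filter_upwards [Ioi_mem_nhds ht] with s hs using (H.hasDerivAt hs).deriv
  have ht0 : t ≠ 0 := by linarith
  rw [iteratedDeriv_succ, iteratedDeriv_one, e.deriv_eq]
  have hd := (((H.hasDerivAt ht).mul (H.eps_diff t ht.le).hasDerivAt).mul
    (hasDerivAt_inv ht0)).deriv
  refine hd.trans ?_
  simp only [Pi.mul_apply]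
  field_simp
  ring

theorem Case2.regVary_iteratedDeriv_two {c : ℝ} (H : Case2 ψ c ε)
    (hpos : ∀ᶠ t in atTop, 0 < ε t) : RegVary (-2) (fun t => |iteratedDeriv 2 ψ t|) := by
  have hlim : Tendsto (fun t => 1 - ε t - t * deriv ε t / ε t) atTop (nhds 1) := by
    simpa using (H.eps_to_zero.const_sub 1).sub H.eps_ratio1
  have h1 := RegVary.of_tendsto one_pos hlim
  have h2 := ((H.regVary_deriv hpos).mul RegVary.id.inv).mul h1
  rw [show (-1 : ℝ) + -1 + 0 = -2 by norm_num] at h2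
  refine h2.congr ?_
  filter_upwards [h2.1, hpos, eventually_gt_atTop 1] with t a b c
  rw [H.iteratedDeriv_two c b.ne', abs_neg, abs_of_pos a]

end Inverse

/-- the third centered moment `μ₃(t)` of the tilted density satisfies
`μ₃(t) = ψ''(t)(1 + o(1))` as `t → ∞`. -/
theorem tilted_third_moment_asymptotic
    (g ψ q p Φ : ℝ → ℝ)
    (hg_pos : ∀ x > (0:ℝ), 0 < g x)
    (hg_conv : ConvexOn ℝ (Set.Ioi 0) g)
    (hg_smooth : ContDiffOn ℝ 4 g (Set.Ioi 0))
    (hg_super : Tendsto (fun x => g x / x) atTop atTop)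
    (hh_mono : ∃ x₀ : ℝ, StrictMonoOn (deriv g) (Set.Ioi x₀))
    (hh_top : Tendsto (deriv g) atTop atTop)
    (hψ_inv : ∀ᶠ t in atTop, deriv g (ψ t) = t)
    (hψ_inv' : ∀ᶠ x in atTop, ψ (deriv g x) = x)
    (hψ_top : Tendsto ψ atTop atTop)
    (hq_meas : Measurable q)
    (hq_bdd : ∃ M : ℝ, ∀ x ≥ (0:ℝ), |q x| ≤ M)
    (hcase :
      (∃ β c θ ε, Case1 (deriv g) β c θ ε ∧
        ∃ η, η < θ - 3 * β / 2 - 3 / 2 ∧ RegVary η (fun x => |q x|)) ∨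
      (∃ c ε, Case2 ψ c ε ∧
        ∃ η, η < -(1/2 : ℝ) ∧ RegVary η (fun t => |q (ψ t)|)))
    (hp : ∀ x, p x = if 0 ≤ x then Real.exp (-(g x - q x)) else 0)
    (hΦ : ∀ t, Φ t = ∫ x, Real.exp (t * x) * p x)
    (hΦ_int : ∀ t > (0:ℝ), Integrable (fun x => Real.exp (t * x) * p x)) :
    Tendsto (fun t => iteratedDeriv 3 (fun u => Real.log (Φ u)) t / iteratedDeriv 2 ψ t)
      atTop (nhds 1) := by
  obtain ⟨hg, hh, hh₁, hh₂⟩ := hasDerivAt_iterate_deriv_of_contDiffOn hg_smooth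
  obtain ⟨M, hM⟩ := hq_bdd
  have hm₁ : Measurable (deriv (deriv g)) := measurable_deriv _
  have hm₂ : Measurable (deriv (deriv (deriv g))) := measurable_deriv _
  have hψ₂ := eventually_iteratedDeriv_two_inverse hh hh₁ hψ_inv hψ_inv' hψ_top
  suffices H : (∀ᶠ t in atTop, deriv (deriv g) (ψ t) ≠ 0) ∧
      Tendsto (fun t => iteratedDeriv 3 (fun u => Real.log (Φ u)) t *
        deriv (deriv g) (ψ t) ^ 3 / deriv (deriv (deriv g)) (ψ t)) atTop (nhds (-1)) by
    have hneg := H.2.neg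
    rw [neg_neg] at hneg
    refine hneg.congr' ?_
    filter_upwards [hψ₂ H.1] with t ht
    rw [ht, neg_div, div_neg, div_div_eq_mul_div]
  rcases hcase with ⟨β, c, θ, ε, H, η, hη, hqη⟩ | ⟨c, ε, H, η, hη, hqη⟩
  · have hβ := H.beta_pos
    have hθ := H.theta_le
    refine ⟨hψ_top.eventually (H.regVary_deriv.1.mono fun x hx => hx.ne'), ?_⟩
    have hcore := tendsto_iteratedDeriv_three_log_of_regVary (X := fun v => v)
      (X' := fun _ => 1) hg hh hh₁ hh₂ hg_conv hM hp hΦ hΦ_int hh_top tendsto_id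
      (Eventually.of_forall fun v => hasDerivAt_id v)
      (RegVary.of_tendsto one_pos tendsto_const_nhds) measurable_const H.regVary_deriv hm₁
      H.h2_RV hm₂.abs hqη hq_meas.abs (by linarith) (by linarith) (by linarith)
    refine (hcore.comp hψ_top).congr' ?_
    filter_upwards [hψ_inv] with t ht
    simp only [Function.comp, ht]
  · have hone := H.deriv_mul_eq_one hh hψ_inv
    have hε : ∀ᶠ t in atTop, 0 < ε t := by
      filter_upwards [hone, hψ_top.eventually (eventually_deriv_nonneg_of_strictMonoOn hh hh_mono),
        eventually_ge_atTop 1] with t h1 h2 h3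
      have hψt := H.psi_pos h3
      by_contra hcon
      have : ψ t * ε t * t⁻¹ ≤ 0 := mul_nonpos_of_nonpos_of_nonneg
        (mul_nonpos_of_nonneg_of_nonpos hψt.le (not_lt.1 hcon)) (by positivity)
      nlinarith [mul_nonneg h2 (neg_nonneg.2 this)]
    have hne : ∀ᶠ t in atTop, deriv (deriv g) (ψ t) ≠ 0 :=
      hone.mono fun t ht h0 => by simp [h0] at ht
    refine ⟨hne, ?_⟩
    set X : ℝ → ℝ := fun t => ψ (max t 2) with hX
    have hXψ : X =ᶠ[atTop] ψ := by
      filter_upwards [eventually_ge_atTop 2] with t ht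
      simp only [hX, max_eq_left ht]
    have hXc : Continuous X := by
      refine continuous_iff_continuousAt.2 fun t => ContinuousAt.comp (g := ψ) ?_
        (continuous_id.max continuous_const).continuousAt
      exact (H.hasDerivAt (lt_of_lt_of_le one_lt_two (le_max_right t 2))).continuousAt
    have hXd : ∀ᶠ t in atTop, HasDerivAt X (ψ t * ε t * t⁻¹) t := by
      filter_upwards [eventually_gt_atTop 2] with t ht
      refine (H.hasDerivAt (by linarith)).congr_of_eventuallyEq ?_
      filter_upwards [Ioi_mem_nhds ht] with s hs
      simp only [hX, max_eq_left (show (2 : ℝ) ≤ s from le_of_lt hs)]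
    have hψ' := H.regVary_deriv hε
    have hr₁ : RegVary 1 (fun t => deriv (deriv g) (X t)) := by
      have := hψ'.inv
      rw [neg_neg] at this
      refine this.congr ?_
      filter_upwards [hone, hXψ] with t h1 h2
      rw [h2]
      exact (eq_inv_of_mul_eq_one_left h1).symm
    have hr₂ : RegVary 1 (fun t => |deriv (deriv (deriv g)) (X t)|) := by
      have := (H.regVary_iteratedDeriv_two hε).mul (hr₁.rpow 3)
      rw [show (-2 : ℝ) + 1 * 3 = 1 by norm_num] at this
      refine this.congr ?_
      filter_upwards [hψ₂ hne, hXψ, hr₁.1] with t h1 h2 h3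
      rw [h2] at h3 ⊢
      rw [h1, show (3 : ℝ) = (3 : ℕ) by norm_num, rpow_natCast, abs_div, abs_neg,
        abs_of_pos (pow_pos h3 3), div_mul_cancel₀ _ (pow_pos h3 3).ne']
    have hcore := tendsto_iteratedDeriv_three_log_of_regVary (X := X) (X' := deriv X)
      (d := -1) (η := η) hg hh hh₁ hh₂ hg_conv hM hp hΦ hΦ_int hh_top (hψ_top.congr' hXψ.symm)
      (hXd.mono fun t ht => ht.differentiableAt.hasDerivAt)
      (hψ'.congr (hXd.mono fun t ht => ht.deriv.symm)) (measurable_deriv X) hr₁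
      (hm₁.comp hXc.measurable) hr₂ (hm₂.comp hXc.measurable).abs
      (hqη.congr (hXψ.mono fun t ht => by simp only [ht])) (hq_meas.comp hXc.measurable).abs
      (by norm_num) (by norm_num) (by linarith)
    refine hcore.congr' ?_
    filter_upwards [hψ_inv, hXψ] with t h1 h2
    rw [h2, h1]
end
end
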